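/- arXiv:1406.3283 — 3 statements merged into one kernel-verified Lean document; each statement's English description precedes it below -/
import Mathlib

section
/- Let g: T → ℂ have bounded variation and suppose that g ∉ H^{r₀+ε}(T) for every ε > 0, where r₀ ∈ [1/2, 3/4). Then for almost every t ∈ ℝ, the graphs of the real part and of the imaginary part of (the continuous representative of) e^{it∂ₓₓ}g each have upper Minkowski dimension D satisfying 5/2 − 2r₀ ≤ D ≤ 3/2. In particular, if r₀ = 1/2 then D = 3/2. -/
open MeasureTheory Filter

/-- The `n`-th Fourier coefficient `ĝ(n) = (1/2π) ∫₀^{2π} e^{-inx} g(x) dx` of a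
`2π`-periodic function `g : ℝ → ℂ`. -/
noncomputable def fourierCoef (g : ℝ → ℂ) (n : ℤ) : ℂ :=
  (1 / (2 * Real.pi)) * ∫ x in (0 : ℝ)..(2 * Real.pi),
    Complex.exp (-Complex.I * (n : ℂ) * (x : ℂ)) * g x

/-- Membership in the Sobolev space `H^s(𝕋)`: `Σ (1+|n|)^{2s} |ĝ(n)|² < ∞`. -/
def InSobolev (g : ℝ → ℂ) (s : ℝ) : Prop :=
  Summable (fun n : ℤ => (1 + |(n : ℝ)|) ^ (2 * s) * ‖fourierCoef g n‖ ^ 2)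

/-- The minimal number of `ε`-balls needed to cover `E ⊆ ℝ²`. -/
noncomputable def coveringNumber (E : Set (ℝ × ℝ)) (ε : ℝ) : ℕ :=
  sInf {n : ℕ | ∃ S : Finset (ℝ × ℝ), S.card = n ∧ E ⊆ ⋃ c ∈ S, Metric.ball c ε}

/-- The upper Minkowski (box-counting) dimension of a set `E ⊆ ℝ²`:
`limsup_{ε→0⁺} log N(E,ε) / log (1/ε)`. -/
noncomputable def upperMinkowskiDim (E : Set (ℝ × ℝ)) : ℝ :=
  Filter.limsup (fun ε : ℝ => Real.log (coveringNumber E ε) / Real.log (1 / ε))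
    (nhdsWithin 0 (Set.Ioi 0))

/-- The graph `{(x, h x) : x ∈ [0, 2π)} ⊆ ℝ²` of a function on one period. -/
def graphOn (h : ℝ → ℝ) : Set (ℝ × ℝ) :=
  {p : ℝ × ℝ | ∃ x ∈ Set.Ico (0 : ℝ) (2 * Real.pi), p = (x, h x)}


lemma vdc_eq (z : ℕ → ℂ) (N : ℕ) : Complex.normSq (∑ n ∈ Finset.range N, z n)
    = ∑ n ∈ Finset.range N, Complex.normSq (z n)
      + 2 * (∑ k ∈ Finset.range N, ∑ m ∈ Finset.range (N - 1 - k),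
          z (m + k + 1) * (starRingEnd ℂ) (z m)).re := by
  induction N with
  | zero => simp
  | succ N ih =>
    rw [Finset.sum_range_succ, Complex.normSq_add, ih, Finset.sum_range_succ]
    have h1 : ∑ k ∈ Finset.range (N + 1), ∑ m ∈ Finset.range (N + 1 - 1 - k),
          z (m + k + 1) * (starRingEnd ℂ) (z m)
        = ∑ k ∈ Finset.range N, ∑ m ∈ Finset.range (N - 1 - k),
          z (m + k + 1) * (starRingEnd ℂ) (z m)
          + z N * (starRingEnd ℂ) (∑ n ∈ Finset.range N, z n) := by
      rw [Finset.sum_range_succ]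
      simp only [Nat.add_sub_cancel, Nat.sub_self, Finset.range_zero, Finset.sum_empty, add_zero]
      rw [map_sum, Finset.mul_sum, ← Finset.sum_range_reflect (fun j => z N * (starRingEnd ℂ) (z j)) N,
        ← Finset.sum_add_distrib]
      refine Finset.sum_congr rfl fun k hk => ?_
      have hk' := Finset.mem_range.1 hk
      have : N - k = (N - 1 - k) + 1 := by omega
      rw [this, Finset.sum_range_succ]
      congr 3
      omega
    rw [h1, Complex.add_re]
    have h2 : ((∑ n ∈ Finset.range N, z n) * (starRingEnd ℂ) (z N)).re
      = (z N * (starRingEnd ℂ) (∑ n ∈ Finset.range N, z n)).re := by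
      rw [← Complex.conj_re]
      simp [mul_comm]
    rw [h2]; ring

lemma vdc_le (z : ℕ → ℂ) (N : ℕ) : ‖∑ n ∈ Finset.range N, z n‖ ^ 2
    ≤ ∑ n ∈ Finset.range N, ‖z n‖ ^ 2
      + 2 * ∑ k ∈ Finset.range N, ‖∑ m ∈ Finset.range (N - 1 - k),
          z (m + k + 1) * (starRingEnd ℂ) (z m)‖ := by
  rw [← Complex.normSq_eq_norm_sq, vdc_eq]
  simp only [Complex.normSq_eq_norm_sq]
  gcongr
  exact (Complex.re_le_norm _).trans (norm_sum_le _ _)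

noncomputable def ew (t x : ℝ) (n : ℕ) : ℂ :=
  Complex.exp (Complex.I * ((n * x - n ^ 2 * t : ℝ) : ℂ))

lemma ew_norm (t x : ℝ) (n : ℕ) : ‖ew t x n‖ = 1 := Complex.norm_exp_I_mul_ofReal _

lemma ew_inner (t x : ℝ) (k M : ℕ) (hs : Real.sin ((k + 1 : ℕ) * t) ≠ 0) :
    ‖∑ m ∈ Finset.range M, ew t x (m + k + 1) * (starRingEnd ℂ) (ew t x m)‖
      ≤ |Real.sin ((k + 1 : ℕ) * t)|⁻¹ := by
  set h : ℝ := ((k + 1 : ℕ) : ℝ) with hh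
  have h1 : ∀ m, ew t x (m + k + 1) * (starRingEnd ℂ) (ew t x m)
      = Complex.exp (Complex.I * ((h * x - h ^ 2 * t : ℝ) : ℂ)) *
        (Complex.exp (Complex.I * ((-2 * (h * t) : ℝ) : ℂ))) ^ m := by
    intro m
    rw [ew, ew, ← Complex.exp_conj, ← Complex.exp_nat_mul, ← Complex.exp_add, ← Complex.exp_add]
    congr 1
    rw [map_mul, Complex.conj_I, Complex.conj_ofReal, hh]
    push_cast
    ring
  simp_rw [h1]
  rw [← Finset.mul_sum, norm_mul, Complex.norm_exp_I_mul_ofReal, one_mul]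
  set q := Complex.exp (Complex.I * ((-2 * (h * t) : ℝ) : ℂ)) with hq
  have hn : ‖q - 1‖ = 2 * |Real.sin (h * t)| := by
    rw [hq, Complex.norm_exp_I_mul_ofReal_sub_one]
    rw [show -2 * (h * t) / 2 = -(h * t) by ring, Real.sin_neg]
    simp
  have hpos : 0 < |Real.sin (h * t)| := abs_pos.2 hs
  have hq1 : q ≠ 1 := by
    intro h0
    rw [h0] at hn; simp at hn; exact hs hn
  rw [geom_sum_eq hq1, norm_div, hn]
  have : ‖q ^ M - 1‖ ≤ 2 := by
    refine (norm_sub_le _ _).trans ?_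
    rw [norm_pow, hq, Complex.norm_exp_I_mul_ofReal]
    norm_num
  rw [div_le_iff₀ (by positivity)]
  refine this.trans (le_of_eq ?_)
  field_simp

lemma min_interp {y A B e : ℝ} (hy : 0 ≤ y) (hA : y ≤ A) (hB : y ≤ B) (he : 0 ≤ e) (he1 : e ≤ 1) :
    y ≤ A ^ e * B ^ (1 - e) := by
  calc y = y ^ (e + (1 - e)) := by simp
    _ = y ^ e * y ^ (1 - e) := by
      rw [Real.rpow_add_of_nonneg hy he (by linarith)]
    _ ≤ _ := by
      have hA0 : 0 ≤ A := hy.trans hA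
      gcongr

lemma weyl_bound (t e : ℝ) (he : 0 < e) (he1 : e < 1)
    (hs : ∀ k : ℕ, Real.sin ((k + 1 : ℕ) * t) ≠ 0)
    (hsum : Summable fun k : ℕ => ((k + 1 : ℕ) : ℝ) ^ (-(1 + e)) *
      |Real.sin ((k + 1 : ℕ) * t)| ^ (-(1 - e))) :
    ∃ C : ℝ, 0 ≤ C ∧ ∀ (N : ℕ) (x : ℝ), ‖∑ n ∈ Finset.range N, ew t x n‖ ≤ C * (N : ℝ) ^ (1 / 2 + e) := by
  set Φ := ∑' k : ℕ, ((k + 1 : ℕ) : ℝ) ^ (-(1 + e)) *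
      |Real.sin ((k + 1 : ℕ) * t)| ^ (-(1 - e)) with hΦ
  have hΦ0 : 0 ≤ Φ := tsum_nonneg fun k => by positivity
  refine ⟨Real.sqrt (1 + 2 * Φ), Real.sqrt_nonneg _, fun N x => ?_⟩
  rcases Nat.eq_zero_or_pos N with rfl | hN
  · simp; positivity
  have hN1 : (1 : ℝ) ≤ N := by exact_mod_cast hN
  have hN0 : (0 : ℝ) < N := by linarith
  have key : ‖∑ n ∈ Finset.range N, ew t x n‖ ^ 2 ≤ (1 + 2 * Φ) * (N : ℝ) ^ (1 + 2 * e) := by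
    refine (vdc_le _ _).trans ?_
    simp only [ew_norm, one_pow, Finset.sum_const, Finset.card_range, nsmul_eq_mul, mul_one]
    have h1 : (N : ℝ) ≤ (N : ℝ) ^ (1 + 2 * e) := by
      conv_lhs => rw [← Real.rpow_one (N : ℝ)]
      exact Real.rpow_le_rpow_of_exponent_le hN1 (by linarith)
    have h2 : ∑ k ∈ Finset.range N, ‖∑ m ∈ Finset.range (N - 1 - k),
          ew t x (m + k + 1) * (starRingEnd ℂ) (ew t x m)‖ ≤ Φ * (N : ℝ) ^ (1 + 2 * e) := by
      calc _ ≤ ∑ k ∈ Finset.range N, (((k + 1 : ℕ) : ℝ) ^ (-(1 + e)) *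
            |Real.sin ((k + 1 : ℕ) * t)| ^ (-(1 - e))) * (N : ℝ) ^ (1 + 2 * e) := by
            refine Finset.sum_le_sum fun k hk => ?_
            have hk' := Finset.mem_range.1 hk
            have ha : ‖∑ m ∈ Finset.range (N - 1 - k),
              ew t x (m + k + 1) * (starRingEnd ℂ) (ew t x m)‖ ≤ N := by
              refine (norm_sum_le _ _).trans ?_
              simp only [norm_mul, RCLike.norm_conj, ew_norm, mul_one, Finset.sum_const, Finset.card_range, nsmul_eq_mul]
              exact_mod_cast (by omega)
            refine (min_interp (norm_nonneg _) ha (ew_inner t x k _ (hs k)) he.le he1.le).trans ?_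
            rw [Real.inv_rpow (abs_nonneg _), ← Real.rpow_neg (abs_nonneg _)]
            have hb : (1 : ℝ) ≤ ((k + 1 : ℕ) : ℝ) ^ (-(1 + e)) * (N : ℝ) ^ (1 + e) := by
              rw [Real.rpow_neg (by positivity), ← div_eq_inv_mul, one_le_div (by positivity)]
              have : ((k + 1 : ℕ) : ℝ) ≤ N := by exact_mod_cast hk'
              gcongr
            have hc : (N : ℝ) ^ (1 + 2 * e) = (N : ℝ) ^ (1 + e) * (N : ℝ) ^ e := by
              rw [← Real.rpow_add hN0]; ring_nf
            rw [hc]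
            calc _ = 1 * ((N : ℝ) ^ e * |Real.sin ((k + 1 : ℕ) * t)| ^ (-(1 - e))) := by ring
              _ ≤ (((k + 1 : ℕ) : ℝ) ^ (-(1 + e)) * (N : ℝ) ^ (1 + e)) * ((N : ℝ) ^ e * |Real.sin ((k + 1 : ℕ) * t)| ^ (-(1 - e))) := by gcongr
              _ = _ := by ring
        _ ≤ _ := by
            rw [← Finset.sum_mul]
            gcongr
            exact hsum.sum_le_tsum _ (fun k _ => by positivity)
    nlinarith
  have : (Real.sqrt (1 + 2 * Φ) * (N : ℝ) ^ (1 / 2 + e)) ^ 2 = (1 + 2 * Φ) * (N : ℝ) ^ (1 + 2 * e) := by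
    rw [mul_pow, Real.sq_sqrt (by positivity), ← Real.rpow_natCast, ← Real.rpow_mul hN0.le]
    congr 2; push_cast; ring
  rw [← this] at key
  exact (le_abs_self _).trans (abs_le_of_sq_le_sq key (by positivity))

lemma sin_int (p : ℝ) (hp0 : 0 < p) (hp : p < 1) :
    IntervalIntegrable (fun t => |Real.sin t| ^ (-p)) volume (-(Real.pi / 2)) (-(Real.pi / 2) + Real.pi) := by
  have h0 : IntervalIntegrable (fun t : ℝ => t ^ (-p)) volume 0 (Real.pi / 2) :=
    intervalIntegral.intervalIntegrable_rpow' (by linarith)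
  have hmeas : Measurable (fun t => |Real.sin t| ^ (-p)) := by fun_prop
  have h1 : IntervalIntegrable (fun t => |Real.sin t| ^ (-p)) volume 0 (Real.pi / 2) := by
    refine (h0.const_mul ((2 / Real.pi) ^ (-p))).mono_fun' hmeas.aestronglyMeasurable ?_
    rw [Set.uIoc_of_le (by positivity)]
    refine (ae_restrict_iff' measurableSet_Ioc).2 (ae_of_all _ fun t ht => ?_)
    have ht0 := ht.1
    beta_reduce
    rw [Real.norm_of_nonneg (by positivity), ← Real.mul_rpow (by positivity) ht0.le]
    refine Real.rpow_le_rpow_of_nonpos (by positivity) ?_ (by linarith)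
    exact (Real.mul_le_sin ht0.le ht.2).trans (le_abs_self _)
  have h2 : IntervalIntegrable (fun t => |Real.sin t| ^ (-p)) volume (-(Real.pi / 2)) 0 := by
    have := (IntervalIntegrable.iff_comp_neg (f := fun t => |Real.sin t| ^ (-p)) (a := 0) (b := Real.pi / 2) ).1 h1
    simpa using this.symm
  rw [show -(Real.pi / 2) + Real.pi = Real.pi / 2 by ring]
  exact h2.trans h1

lemma sin_per (p : ℝ) : Function.Periodic (fun t => |Real.sin t| ^ (-p)) Real.pi := by
  intro t; simp

lemma sin_int' (p : ℝ) (hp0 : 0 < p) (hp : p < 1) (a b : ℝ) :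
    IntervalIntegrable (fun t => |Real.sin t| ^ (-p)) volume a b :=
  (sin_per p).intervalIntegrable Real.pi_ne_zero (sin_int p hp0 hp) a b

lemma sin_scaled (p : ℝ) (hp0 : 0 < p) (hp : p < 1) (j : ℤ) (k : ℕ) :
    ∫ t in (j * Real.pi)..(j * Real.pi + Real.pi), |Real.sin ((k + 1 : ℕ) * t)| ^ (-p)
     = ∫ t in (0:ℝ)..Real.pi, |Real.sin t| ^ (-p) := by
  have h := intervalIntegral.integral_comp_mul_left (a := j * Real.pi) (b := j * Real.pi + Real.pi)
    (fun t => |Real.sin t| ^ (-p)) (c := ((k + 1 : ℕ) : ℝ)) (by positivity)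
  rw [h]
  have h2 := (sin_per p).intervalIntegral_add_zsmul_eq (k + 1 : ℕ) (((k + 1 : ℕ) : ℝ) * (j * Real.pi))
    (fun a b => sin_int' p hp0 hp a b)
  have h3 := (sin_per p).intervalIntegral_add_eq (((k + 1 : ℕ) : ℝ) * (j * Real.pi)) 0
  rw [h3] at h2
  rw [show ((k + 1 : ℕ) : ℝ) * (j * Real.pi + Real.pi) = ((k + 1 : ℕ) : ℝ) * (j * Real.pi) + ((k + 1 : ℕ) : ℤ) • Real.pi by
    simp; ring, h2]
  have : ((k + 1 : ℕ) : ℝ) ≠ 0 := by positivity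
  simp only [zsmul_eq_mul, smul_eq_mul, zero_add, Int.cast_natCast]
  field_simp

lemma ae_real_of_pieces {P : ℝ → Prop} (c : ℝ) (hc : 0 < c)
    (h : ∀ j : ℤ, ∀ᵐ t ∂(volume.restrict (Set.Ioc (j * c) (j * c + c))), P t) : ∀ᵐ t : ℝ, P t := by
  have := (ae_restrict_iUnion_iff (μ := volume) (fun j : ℤ => Set.Ioc ((j:ℝ) * c) (j * c + c)) P).2 h
  have hu : (⋃ j : ℤ, Set.Ioc ((j:ℝ) * c) (j * c + c)) = Set.univ := by
    have := iUnion_Ioc_zsmul hc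
    rw [← this]
    refine Set.iUnion_congr fun j => ?_
    simp only [zsmul_eq_mul]; push_cast; congr 1; ring
  rwa [hu, Measure.restrict_univ] at this

lemma ae_sum (e : ℝ) (he : 0 < e) (he1 : e < 1) : ∀ᵐ t : ℝ,
    Summable fun k : ℕ => ((k + 1 : ℕ) : ℝ) ^ (-(1 + e)) *
      |Real.sin ((k + 1 : ℕ) * t)| ^ (-(1 - e)) := by
  refine ae_real_of_pieces Real.pi Real.pi_pos fun j => ?_
  have hi : ∀ k : ℕ, IntegrableOn (fun t => ((k + 1 : ℕ) : ℝ) ^ (-(1 + e)) *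
      |Real.sin ((k + 1 : ℕ) * t)| ^ (-(1 - e))) (Set.Ioc (j * Real.pi) (j * Real.pi + Real.pi)) := by
    intro k
    refine Integrable.const_mul ?_ _
    rw [← IntegrableOn, ← intervalIntegrable_iff_integrableOn_Ioc_of_le (by linarith [Real.pi_pos])]
    have := (sin_int' (1 - e) (by linarith) (by linarith) (((k + 1 : ℕ) : ℝ) * (j * Real.pi)) (((k + 1 : ℕ) : ℝ) * (j * Real.pi + Real.pi))).comp_mul_left (c := ((k + 1 : ℕ) : ℝ))
    have h0 : ((k + 1 : ℕ) : ℝ) ≠ 0 := by positivity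
    rw [mul_div_cancel_left₀ _ h0, mul_div_cancel_left₀ _ h0] at this
    exact this
  have hS : Summable fun k : ℕ => ∫ t in Set.Ioc (j * Real.pi) (j * Real.pi + Real.pi), ‖((k + 1 : ℕ) : ℝ) ^ (-(1 + e)) *
      |Real.sin ((k + 1 : ℕ) * t)| ^ (-(1 - e))‖ := by
    have : ∀ k : ℕ, ∫ t in Set.Ioc (j * Real.pi) (j * Real.pi + Real.pi), ‖((k + 1 : ℕ) : ℝ) ^ (-(1 + e)) *
      |Real.sin ((k + 1 : ℕ) * t)| ^ (-(1 - e))‖ = ((k + 1 : ℕ) : ℝ) ^ (-(1 + e)) * ∫ t in (0:ℝ)..Real.pi, |Real.sin t| ^ (-(1-e)) := by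
      intro k
      rw [← sin_scaled (1 - e) (by linarith) (by linarith) j k, intervalIntegral.integral_of_le (by linarith [Real.pi_pos]),
        ← integral_const_mul]
      refine integral_congr_ae (ae_of_all _ fun t => ?_)
      exact Real.norm_of_nonneg (by positivity)
    simp_rw [this]
    refine Summable.mul_right _ ?_
    have := (Real.summable_nat_rpow (p := -(1 + e))).2 (by linarith)
    exact (summable_nat_add_iff 1).2 this
  have h3 : ∫⁻ t in Set.Ioc (j * Real.pi) (j * Real.pi + Real.pi), ∑' k : ℕ, ‖((k + 1 : ℕ) : ℝ) ^ (-(1 + e)) *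
      |Real.sin ((k + 1 : ℕ) * t)| ^ (-(1 - e))‖ₑ ≠ ⊤ := by
    rw [lintegral_tsum fun k => (hi k).aestronglyMeasurable.enorm]
    have : ∀ k : ℕ, ∫⁻ t in Set.Ioc (j * Real.pi) (j * Real.pi + Real.pi), ‖((k + 1 : ℕ) : ℝ) ^ (-(1 + e)) *
      |Real.sin ((k + 1 : ℕ) * t)| ^ (-(1 - e))‖ₑ = ENNReal.ofReal (∫ t in Set.Ioc (j * Real.pi) (j * Real.pi + Real.pi), ‖((k + 1 : ℕ) : ℝ) ^ (-(1 + e)) *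
      |Real.sin ((k + 1 : ℕ) * t)| ^ (-(1 - e))‖) := fun k =>
        (ofReal_integral_norm_eq_lintegral_enorm (hi k)).symm
    simp_rw [this]
    exact hS.tsum_ofReal_ne_top
  have h4 := ae_lt_top' (AEMeasurable.tsum fun k => (hi k).aestronglyMeasurable.enorm) h3
  filter_upwards [h4] with t ht
  have := ENNReal.summable_toReal ht.ne
  refine Summable.congr this fun k => ?_
  rw [toReal_enorm, Real.norm_of_nonneg (by positivity)]

lemma ae_sin : ∀ᵐ t : ℝ, ∀ k : ℕ, Real.sin ((k + 1 : ℕ) * t) ≠ 0 := by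
  rw [ae_all_iff]
  intro k
  have : Set.Countable {t : ℝ | ¬ Real.sin ((k + 1 : ℕ) * t) ≠ 0} := by
    refine (Set.countable_range fun n : ℤ => (n : ℝ) * Real.pi / ((k + 1 : ℕ) : ℝ)).mono ?_
    intro t ht
    simp only [ne_eq, not_not, Set.mem_ofPred_eq] at ht
    obtain ⟨n, hn⟩ := Real.sin_eq_zero_iff.1 ht
    refine ⟨n, ?_⟩
    have : ((k + 1 : ℕ) : ℝ) ≠ 0 := by positivity
    simp only
    rw [hn]; field_simp
  exact this.measure_zero _

def WeylGood (t : ℝ) : Prop := ∀ e : ℝ, 0 < e → ∃ C : ℝ, 0 ≤ C ∧ ∀ (N : ℕ) (x : ℝ),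
  ‖∑ n ∈ Finset.range N, ew t x n‖ ≤ C * (N : ℝ) ^ (1 / 2 + e)

lemma ae_weylGood : ∀ᵐ t : ℝ, WeylGood t := by
  have h : ∀ᵐ t : ℝ, ∀ j : ℕ, Summable fun k : ℕ => ((k + 1 : ℕ) : ℝ) ^ (-(1 + (1 / ((j:ℝ) + 2)))) *
      |Real.sin ((k + 1 : ℕ) * t)| ^ (-(1 - (1 / ((j:ℝ) + 2)))) := by
    rw [ae_all_iff]
    intro j
    refine ae_sum _ (by positivity) ?_
    rw [div_lt_one (by positivity)]
    have : (0:ℝ) ≤ j := by positivity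
    linarith
  filter_upwards [h, ae_sin] with t ht hs e he
  obtain ⟨j, hj⟩ := exists_nat_one_div_lt he
  have hj0 : (0:ℝ) ≤ j := by positivity
  obtain ⟨C, hC, hb⟩ := weyl_bound t (1 / ((j:ℝ) + 2)) (by positivity) (by rw [div_lt_one (by positivity)]; linarith) hs (ht j)
  refine ⟨C, hC, fun N x => (hb N x).trans ?_⟩
  rcases Nat.eq_zero_or_pos N with rfl | hN
  · have : (1:ℝ) / 2 + 1 / (j + 2) ≠ 0 := by positivity
    have h' : (1:ℝ) / 2 + e ≠ 0 := by positivity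
    simp only [Nat.cast_zero, Real.zero_rpow this, Real.zero_rpow h', le_refl]
  · gcongr
    · exact_mod_cast hN
    · refine le_trans ?_ hj.le
      gcongr; norm_num


lemma bv_integrable_real {f : ℝ → ℝ} {a b : ℝ} (hab : a ≤ b)
    (hf : LocallyBoundedVariationOn f (Set.Icc a b)) : IntervalIntegrable f volume a b := by
  obtain ⟨p, q, hp, hq, rfl⟩ := hf.exists_monotoneOn_sub_monotoneOn
  rw [← Set.uIcc_of_le hab] at hp hq
  exact hp.intervalIntegrable.sub hq.intervalIntegrable

lemma bv_integrable {g : ℝ → ℂ} {a b : ℝ} (hab : a ≤ b)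
    (hf : BoundedVariationOn g (Set.Icc a b)) : IntervalIntegrable g volume a b := by
  have h1 : IntervalIntegrable (fun x => (g x).re) volume a b :=
    bv_integrable_real hab (Complex.reCLM.lipschitz.comp_locallyBoundedVariationOn
      hf.locallyBoundedVariationOn)
  have h2 : IntervalIntegrable (fun x => (g x).im) volume a b :=
    bv_integrable_real hab (Complex.imCLM.lipschitz.comp_locallyBoundedVariationOn
      hf.locallyBoundedVariationOn)
  have h3 : IntervalIntegrable (fun x => (((g x).re : ℝ) : ℂ)) volume a b := ⟨h1.1.ofReal, h1.2.ofReal⟩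
  have h4 : IntervalIntegrable (fun x => (((g x).im : ℝ) : ℂ)) volume a b := ⟨h2.1.ofReal, h2.2.ofReal⟩
  have := h3.add (h4.mul_const Complex.I)
  refine this.congr ?_
  intro x hx
  simp [Complex.re_add_im]

lemma bv_var {g : ℝ → ℂ} {b : ℝ} (hb : 0 ≤ b) (hf : BoundedVariationOn g (Set.Icc 0 b)) :
    ∃ v : ℝ → ℝ, (∀ x y, 0 ≤ x → x ≤ y → y ≤ b → ‖g y - g x‖ ≤ v y - v x) := by
  refine ⟨fun x => variationOnFromTo g (Set.Icc 0 b) 0 x, fun x y hx hxy hy => ?_⟩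
  have h0 : (0:ℝ) ∈ Set.Icc 0 b := ⟨le_rfl, hb⟩
  have hxm : x ∈ Set.Icc 0 b := ⟨hx, hxy.trans hy⟩
  have hym : y ∈ Set.Icc 0 b := ⟨hx.trans hxy, hy⟩
  have := variationOnFromTo.add hf.locallyBoundedVariationOn h0 hxm hym
  simp only
  rw [← this, add_sub_cancel_left, variationOnFromTo.eq_of_le _ _ hxy, ← dist_eq_norm]
  exact (hf.mono Set.inter_subset_left).dist_le ⟨hym, hxy, le_rfl⟩ ⟨hxm, le_rfl, hxy⟩

lemma bv_pair {g : ℝ → ℂ} {b : ℝ} (hb : 0 < b) (hf : BoundedVariationOn g (Set.Icc 0 b))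
    (hg : g b = g 0) : ∃ V : ℝ, 0 ≤ V ∧ ∀ (L L' : ℝ → ℂ) (B : ℝ), 
      (∀ y, HasDerivAt L (L' y) y) → Continuous L' → L b = L 0 → (∀ y, ‖L y‖ ≤ B) → 
      ‖∫ y in (0:ℝ)..b, L' y * g y‖ ≤ B * V := by
  obtain ⟨v, hv⟩ := bv_var hb.le hf
  have hV : 0 ≤ v b - v 0 := (norm_nonneg _).trans (hv 0 b le_rfl hb.le le_rfl)
  refine ⟨v b - v 0, hV, fun L L' B hL hL' hLb hB => ?_⟩
  have hgi := bv_integrable hb.le hf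
  have hB0 : 0 ≤ B := (norm_nonneg _).trans (hB 0)
  obtain ⟨A, hA⟩ := (isCompact_Icc (a := 0) (b := b)).exists_bound_of_continuousOn hL'.continuousOn
  have hA0 : 0 ≤ A := (norm_nonneg _).trans (hA 0 ⟨le_rfl, hb.le⟩)
  have key : ∀ m : ℕ, ‖∫ y in (0:ℝ)..b, L' y * g y‖ ≤ B * (v b - v 0) + A * (v b - v 0) * b * (1 / ((m : ℝ) + 1)) := by
    intro m
    set d : ℝ := b / (m + 1) with hd
    have hd0 : 0 < d := by positivity
    set X : ℕ → ℝ := fun i => i * d with hX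
    have hX0 : X 0 = 0 := by simp [hX]
    have hXm : X (m + 1) = b := by simp [hX, hd]; field_simp
    have hXs : ∀ i, X (i + 1) = X i + d := by intro i; simp [hX]; ring
    have hXnn : ∀ i, 0 ≤ X i := fun i => by positivity
    have hXle : ∀ i, i < m + 1 → X (i + 1) ≤ b := by
      intro i hi
      rw [← hXm]; simp only [hX]; gcongr
      omega
    have hsub : ∀ i, i < m + 1 → Set.uIcc (X i) (X (i+1)) ⊆ Set.uIcc 0 b := by
      intro i hi
      rw [Set.uIcc_of_le (by rw [hXs]; linarith), Set.uIcc_of_le hb.le]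
      exact Set.Icc_subset_Icc (hXnn i) (hXle i hi)
    have hgi' : ∀ i < m + 1, IntervalIntegrable g volume (X i) (X (i + 1)) := fun i hi =>
      hgi.mono_set (hsub i hi)
    have hint : ∀ i < m + 1, IntervalIntegrable (fun y => L' y * g y) volume (X i) (X (i + 1)) := fun i hi =>
      (hgi' i hi).continuousOn_mul hL'.continuousOn
    have hsum := intervalIntegral.sum_integral_adjacent_intervals hint
    rw [hX0, hXm] at hsum
    rw [← hsum]
    have hpiece : ∀ i < m + 1, ‖(∫ y in (X i)..(X (i+1)), L' y * g y) - (L (X (i+1)) - L (X i)) * g (X i)‖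
        ≤ A * (v (X (i+1)) - v (X i)) * d := by
      intro i hi
      have h1 : (L (X (i+1)) - L (X i)) * g (X i) = ∫ y in (X i)..(X (i+1)), L' y * g (X i) := by
        rw [intervalIntegral.integral_mul_const, intervalIntegral.integral_eq_sub_of_hasDerivAt (fun y _ => hL y)
          (hL'.intervalIntegrable _ _)]
      have hc1 : IntervalIntegrable (fun y => L' y * g (X i)) volume (X i) (X (i+1)) :=
        Continuous.intervalIntegrable (by fun_prop) _ _
      rw [h1, ← intervalIntegral.integral_sub (hint i hi) hc1]
      have hdd : d = |X (i+1) - X i| := by rw [hXs]; simp [abs_of_pos hd0]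
      conv_rhs => rw [hdd]
      refine intervalIntegral.norm_integral_le_of_norm_le_const fun y hy => ?_
      have hle : X i ≤ X (i+1) := by rw [hXs]; linarith
      rw [Set.uIoc_of_le hle] at hy
      have hy0 : 0 ≤ y := (hXnn i).trans hy.1.le
      have hyb : y ≤ b := hy.2.trans (hXle i hi)
      rw [← mul_sub, norm_mul]
      have e1 := hA y ⟨hy0, hyb⟩
      have e2 := hv (X i) y (hXnn i) hy.1.le hyb
      have e3 := (norm_nonneg _).trans (hv y (X (i+1)) hy0 hy.2 (hXle i hi))
      gcongr
      linarith
    have habel : ∑ i ∈ Finset.range (m+1), (L (X (i+1)) - L (X i)) * g (X i) 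
        = - ∑ i ∈ Finset.range (m+1), L (X (i+1)) * (g (X (i+1)) - g (X i)) := by
      have h := Finset.sum_range_sub (fun i => L (X i) * g (X i)) (m+1)
      rw [hX0, hXm, hg, hLb, sub_self] at h
      rw [eq_neg_iff_add_eq_zero, ← Finset.sum_add_distrib, ← h]
      refine Finset.sum_congr rfl fun i _ => ?_
      ring
    have htel : ∑ i ∈ Finset.range (m+1), (v (X (i+1)) - v (X i)) = v b - v 0 := by
      rw [Finset.sum_range_sub (fun i => v (X i)), hX0, hXm]
    have h1 : ‖∑ i ∈ Finset.range (m+1), L (X (i+1)) * (g (X (i+1)) - g (X i))‖ ≤ B * (v b - v 0) := by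
      rw [← htel, Finset.mul_sum]
      refine norm_sum_le_of_le _ fun i hi => ?_
      rw [norm_mul]
      have hi' := Finset.mem_range.1 hi
      have := hv (X i) (X (i+1)) (hXnn i) (by rw [hXs]; linarith) (hXle i hi')
      have := hB (X (i+1))
      gcongr
    have h2 : ‖∑ i ∈ Finset.range (m+1), ((∫ y in (X i)..(X (i+1)), L' y * g y) - (L (X (i+1)) - L (X i)) * g (X i))‖
       ≤ A * (v b - v 0) * d := by
      rw [← htel, Finset.mul_sum, Finset.sum_mul]
      exact norm_sum_le_of_le _ fun i hi => hpiece i (Finset.mem_range.1 hi)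
    rw [Finset.sum_sub_distrib, habel, sub_neg_eq_add] at h2
    calc _ = ‖(∑ i ∈ Finset.range (m+1), (∫ y in (X i)..(X (i+1)), L' y * g y) + ∑ i ∈ Finset.range (m+1), L (X (i+1)) * (g (X (i+1)) - g (X i))) - ∑ i ∈ Finset.range (m+1), L (X (i+1)) * (g (X (i+1)) - g (X i))‖ := by rw [add_sub_cancel_right]
      _ ≤ A * (v b - v 0) * d + B * (v b - v 0) := (norm_sub_le _ _).trans (add_le_add h2 h1)
      _ = _ := by rw [hd]; ring
  have hlim : Tendsto (fun m : ℕ => B * (v b - v 0) + A * (v b - v 0) * b * (1 / ((m : ℝ) + 1))) atTop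
      (nhds (B * (v b - v 0) + A * (v b - v 0) * b * 0)) :=
    (tendsto_one_div_add_atTop_nhds_zero_nat.const_mul _).const_add _
  rw [mul_zero, add_zero] at hlim
  exact ge_of_tendsto' hlim key

lemma cover_upper {f : ℝ → ℝ} {C α : ℝ} (hC : 0 ≤ C) (hα0 : 0 < α) (hα : α ≤ 1)
    (hf : ∀ x y, |f x - f y| ≤ C * |x - y| ^ α) {r : ℝ} (hr : 0 < r) (hr1 : r < 1) :
    ∃ S : Finset (ℝ × ℝ), graphOn f ⊆ ⋃ c ∈ S, Metric.ball c r ∧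
      (S.card : ℝ) ≤ ((2 * Real.pi + 1) * (2 * C + 3)) * r ^ (α - 2) := by
  classical
  set M := ⌈2 * Real.pi / r⌉₊ with hM
  set J := ⌈C * r ^ (α - 1)⌉₊ with hJ
  refine ⟨(Finset.range M ×ˢ Finset.Icc (-(J:ℤ)) J).image
    (fun q => ((q.1 : ℝ) * r, f ((q.1 : ℝ) * r) + q.2 * r)), ?_, ?_⟩
  · rintro p ⟨x, ⟨hx0, hx1⟩, rfl⟩
    simp only [Set.mem_iUnion]
    set i := ⌊x / r⌋₊ with hi
    have hi1 : (i : ℝ) ≤ x / r := Nat.floor_le (by positivity)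
    have hi2 : x / r < i + 1 := Nat.lt_floor_add_one _
    rw [le_div_iff₀ hr] at hi1
    rw [div_lt_iff₀ hr] at hi2
    have hiM : i < M := by
      rw [hM, Nat.lt_ceil, lt_div_iff₀ hr]
      linarith
    set y := (f x - f (i * r)) / r with hy
    have hxi : |x - i * r| ≤ r := by rw [abs_le]; constructor <;> linarith
    have hyb : |y| ≤ C * r ^ (α - 1) := by
      rw [hy, abs_div, abs_of_pos hr, div_le_iff₀ hr, mul_assoc, ← Real.rpow_add_one hr.ne']
      refine (hf _ _).trans ?_
      rw [sub_add_cancel]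
      gcongr
    have hyJ : |y| ≤ J := hyb.trans (Nat.le_ceil _)
    rw [abs_le] at hyJ
    refine ⟨((i : ℝ) * r, f ((i : ℝ) * r) + (⌊y⌋ : ℤ) * r), ?_, ?_⟩
    · refine Finset.mem_image.2 ⟨(i, ⌊y⌋), ?_, rfl⟩
      simp only [Finset.mem_product, Finset.mem_range, Finset.mem_Icc]
      refine ⟨hiM, ?_, ?_⟩
      · rw [Int.le_floor]; push_cast; exact hyJ.1
      · have : ((⌊y⌋ : ℤ) : ℝ) ≤ ((J : ℤ) : ℝ) := (Int.floor_le y).trans (by push_cast; exact hyJ.2)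
        exact_mod_cast this
    · rw [Metric.mem_ball, Prod.dist_eq, max_lt_iff, Real.dist_eq, Real.dist_eq]
      have hyr : f x = f (i * r) + y * r := by rw [hy]; field_simp; ring
      have f1 := Int.floor_le y
      have f2 := Int.lt_floor_add_one y
      constructor
      · simp only; rw [abs_lt]; constructor <;> linarith
      · simp only; rw [hyr, abs_lt]; constructor <;> nlinarith
  · have h1 : ((Finset.range M ×ˢ Finset.Icc (-(J:ℤ)) J).image
      (fun q => ((q.1 : ℝ) * r, f ((q.1 : ℝ) * r) + q.2 * r))).card ≤ M * (2 * J + 1) := by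
      refine Finset.card_image_le.trans ?_
      rw [Finset.card_product, Finset.card_range, Int.card_Icc]
      gcongr
      omega
    have h2 : (M : ℝ) ≤ (2 * Real.pi + 1) * r⁻¹ := by
      have := Nat.ceil_lt_add_one (a := 2 * Real.pi / r) (by positivity)
      have hr1 : 1 ≤ r⁻¹ := (one_le_inv₀ hr).2 hr1.le
      rw [div_eq_mul_inv] at this
      rw [hM, div_eq_mul_inv]
      nlinarith
    have h3 : (2 * (J:ℝ) + 1) ≤ (2 * C + 3) * r ^ (α - 1) := by
      have := Nat.ceil_lt_add_one (a := C * r ^ (α - 1)) (by positivity)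
      have hr2 : 1 ≤ r ^ (α - 1) := Real.one_le_rpow_of_pos_of_le_one_of_nonpos hr hr1.le (by linarith)
      rw [hJ]
      nlinarith
    calc _ ≤ ((M * (2 * J + 1) : ℕ) : ℝ) := by exact_mod_cast h1
      _ = M * (2 * J + 1) := by push_cast; ring
      _ ≤ ((2 * Real.pi + 1) * r⁻¹) * ((2 * C + 3) * r ^ (α - 1)) := by gcongr
      _ = _ := by
        rw [show α - 2 = -1 + (α - 1) by ring, Real.rpow_add hr, Real.rpow_neg_one]; ring

lemma cover_le {f : ℝ → ℝ} {C α : ℝ} (hC : 0 ≤ C) (hα0 : 0 < α) (hα : α ≤ 1)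
    (hf : ∀ x y, |f x - f y| ≤ C * |x - y| ^ α) {r : ℝ} (hr : 0 < r) (hr1 : r < 1) :
    (coveringNumber (graphOn f) r : ℝ) ≤ ((2 * Real.pi + 1) * (2 * C + 3)) * r ^ (α - 2) := by
  obtain ⟨S, hS, hc⟩ := cover_upper hC hα0 hα hf hr hr1
  refine le_trans ?_ hc
  have : coveringNumber (graphOn f) r ≤ S.card := Nat.sInf_le ⟨S, rfl, hS⟩
  exact_mod_cast this

lemma cover_attained {f : ℝ → ℝ} {C α : ℝ} (hC : 0 ≤ C) (hα0 : 0 < α) (hα : α ≤ 1)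
    (hf : ∀ x y, |f x - f y| ≤ C * |x - y| ^ α) {r : ℝ} (hr : 0 < r) (hr1 : r < 1) :
    ∃ S : Finset (ℝ × ℝ), S.card = coveringNumber (graphOn f) r ∧ graphOn f ⊆ ⋃ c ∈ S, Metric.ball c r := by
  obtain ⟨S, hS, hc⟩ := cover_upper hC hα0 hα hf hr hr1
  exact Nat.sInf_mem (s := {n : ℕ | ∃ S : Finset (ℝ × ℝ), S.card = n ∧ graphOn f ⊆ ⋃ c ∈ S, Metric.ball c r})
    ⟨S.card, S, rfl, hS⟩

lemma ratio_nonneg (E : Set (ℝ × ℝ)) : ∀ᶠ r : ℝ in nhdsWithin 0 (Set.Ioi 0),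
    0 ≤ Real.log (coveringNumber E r) / Real.log (1 / r) := by
  filter_upwards [Ioo_mem_nhdsGT (zero_lt_one' ℝ)] with r hr
  refine div_nonneg (Real.log_natCast_nonneg _) (Real.log_nonneg ?_)
  rw [le_div_iff₀ hr.1]; linarith [hr.2]

lemma ratio_le {f : ℝ → ℝ} {C α : ℝ} (hC : 0 ≤ C) (hα0 : 0 < α) (hα : α ≤ 1)
    (hf : ∀ x y, |f x - f y| ≤ C * |x - y| ^ α) {δ : ℝ} (hδ : 0 < δ) :
    ∀ᶠ r : ℝ in nhdsWithin 0 (Set.Ioi 0),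
      Real.log (coveringNumber (graphOn f) r) / Real.log (1 / r) ≤ 2 - α + δ := by
  set K := (2 * Real.pi + 1) * (2 * C + 3) with hK
  have hK1 : 1 ≤ K := by rw [hK]; nlinarith [Real.pi_pos]
  have h1 : Tendsto (fun r : ℝ => Real.log (1 / r)) (nhdsWithin 0 (Set.Ioi 0)) atTop := by
    simp only [one_div]
    exact Real.tendsto_log_atTop.comp tendsto_inv_nhdsGT_zero
  filter_upwards [Ioo_mem_nhdsGT (zero_lt_one' ℝ), h1.eventually_ge_atTop (Real.log K / δ),
    h1.eventually_gt_atTop 0] with r hr hr2 hr3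
  rw [div_le_iff₀ hr3]
  rw [div_le_iff₀ hδ] at hr2
  have hlog : Real.log (coveringNumber (graphOn f) r) ≤ Real.log K + (2 - α) * Real.log (1 / r) := by
    rcases Nat.eq_zero_or_pos (coveringNumber (graphOn f) r) with h0 | h0
    · rw [h0]; simp only [Nat.cast_zero, Real.log_zero]
      have := Real.log_nonneg hK1
      have : 0 ≤ (2 - α) * Real.log (1 / r) := mul_nonneg (by linarith) hr3.le
      linarith
    · have := Real.log_le_log (by exact_mod_cast h0) (cover_le hC hα0 hα hf hr.1 hr.2)
      rw [Real.log_mul (by positivity) (Real.rpow_pos_of_pos hr.1 _).ne', Real.log_rpow hr.1] at this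
      rw [one_div, Real.log_inv]
      linarith
  nlinarith

lemma dim_le {f : ℝ → ℝ} {C α : ℝ} (hC : 0 ≤ C) (hα0 : 0 < α) (hα : α ≤ 1)
    (hf : ∀ x y, |f x - f y| ≤ C * |x - y| ^ α) : upperMinkowskiDim (graphOn f) ≤ 2 - α := by
  refine le_of_forall_pos_le_add fun δ hδ => ?_
  refine limsup_le_of_le ?_ (ratio_le hC hα0 hα hf hδ)
  exact IsBoundedUnder.isCoboundedUnder_le ⟨0, by simpa using ratio_nonneg _⟩

lemma cover_of_dim_lt {f : ℝ → ℝ} {C α D : ℝ} (hC : 0 ≤ C) (hα0 : 0 < α) (hα : α ≤ 1)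
    (hf : ∀ x y, |f x - f y| ≤ C * |x - y| ^ α) (hD : upperMinkowskiDim (graphOn f) < D) :
    ∀ᶠ r : ℝ in nhdsWithin 0 (Set.Ioi 0), (coveringNumber (graphOn f) r : ℝ) ≤ r ^ (-D) := by
  have h := eventually_lt_of_limsup_lt hD ⟨2 - α + 1, by simpa using ratio_le hC hα0 hα hf zero_lt_one⟩
  filter_upwards [h, Ioo_mem_nhdsGT (zero_lt_one' ℝ)] with r hr hr1
  have hl : 0 < Real.log (1 / r) := Real.log_pos (by rw [lt_div_iff₀ hr1.1]; linarith [hr1.2])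
  rw [div_lt_iff₀ hl] at hr
  rcases Nat.eq_zero_or_pos (coveringNumber (graphOn f) r) with h0 | h0
  · rw [h0]; simp only [Nat.cast_zero]; exact (Real.rpow_pos_of_pos hr1.1 _).le
  · rw [← Real.log_le_log_iff (by exact_mod_cast h0) (Real.rpow_pos_of_pos hr1.1 _), Real.log_rpow hr1.1]
    rw [one_div, Real.log_inv] at hr
    linarith

lemma osc_count {f : ℝ → ℝ} (hf : Continuous f) {r : ℝ} (hr : 0 < r) (S : Finset (ℝ × ℝ))
    (hS : graphOn f ⊆ ⋃ c ∈ S, Metric.ball c r) {x h : ℝ} (hx : 0 ≤ x) (hh : 0 ≤ h) (hxh : x + h < 2 * Real.pi) :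
    |f (x + h) - f x| ≤ 2 * r * ∑ c ∈ S, (Set.Ioo (c.1 - h - r) (c.1 + r)).indicator (fun _ => (1:ℝ)) x := by
  classical
  set S' := S.filter (fun c => x ∈ Set.Ioo (c.1 - h - r) (c.1 + r)) with hS'
  have hsub : Set.uIcc (f x) (f (x + h)) ⊆ ⋃ c ∈ S', Metric.ball c.2 r := by
    refine (intermediate_value_uIcc hf.continuousOn).trans ?_
    rintro _ ⟨z, hz, rfl⟩
    rw [Set.uIcc_of_le (by linarith)] at hz
    have := hS ⟨z, ⟨by linarith [hz.1], by linarith [hz.2]⟩, rfl⟩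
    simp only [Set.mem_iUnion] at this ⊢
    obtain ⟨c, hc, hcb⟩ := this
    rw [Metric.mem_ball, Prod.dist_eq, max_lt_iff, Real.dist_eq] at hcb
    refine ⟨c, Finset.mem_filter.2 ⟨hc, ?_⟩, hcb.2⟩
    have := abs_lt.1 hcb.1
    simp only at this
    constructor <;> linarith [hz.1, hz.2]
  have hm := (measure_mono (μ := volume) hsub).trans (measure_biUnion_finset_le _ _)
  simp only [Real.volume_interval, Real.volume_ball, Finset.sum_const, nsmul_eq_mul] at hm
  rw [← ENNReal.ofReal_natCast, ← ENNReal.ofReal_mul (by positivity),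
    ENNReal.ofReal_le_ofReal_iff (by positivity)] at hm
  have : ∑ c ∈ S, (Set.Ioo (c.1 - h - r) (c.1 + r)).indicator (fun _ => (1:ℝ)) x = S'.card := by
    simp only [hS', Set.indicator_apply, Finset.sum_boole]
  rw [this]
  linarith

lemma osc_int {f : ℝ → ℝ} (hf : Continuous f) {r : ℝ} (hr : 0 < r) (S : Finset (ℝ × ℝ))
    (hS : graphOn f ⊆ ⋃ c ∈ S, Metric.ball c r) {h : ℝ} (hh : 0 ≤ h) :
    ∫ x in Set.Ioo 0 (2 * Real.pi - h), |f (x + h) - f x| ≤ 2 * r * (S.card * (h + 2 * r)) := by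
  have hind : ∀ c : ℝ × ℝ, IntegrableOn ((Set.Ioo (c.1 - h - r) (c.1 + r)).indicator (fun _ => (1:ℝ))) 
      (Set.Ioo 0 (2 * Real.pi - h)) := by
    intro c
    refine IntegrableOn.indicator ?_ measurableSet_Ioo
    simp
  calc _ ≤ ∫ x in Set.Ioo 0 (2 * Real.pi - h), 2 * r * ∑ c ∈ S, (Set.Ioo (c.1 - h - r) (c.1 + r)).indicator (fun _ => (1:ℝ)) x := by
        refine setIntegral_mono_on ?_ ?_ measurableSet_Ioo fun x hx => osc_count hf hr S hS hx.1.le hh (by linarith [hx.2])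
        · have : Continuous fun x => |f (x + h) - f x| := by fun_prop
          exact (this.integrableOn_Icc (a := 0) (b := 2 * Real.pi - h)).mono_set Set.Ioo_subset_Icc_self
        · exact (integrable_finsetSum _ fun c _ => hind c).const_mul _
    _ ≤ _ := by
        rw [integral_const_mul, integral_finsetSum _ fun c _ => hind c]
        gcongr
        rw [← nsmul_eq_mul]
        refine Finset.sum_le_card_nsmul _ _ _ fun c _ => ?_
        rw [integral_indicator measurableSet_Ioo, Measure.restrict_restrict measurableSet_Ioo]
        simp only [integral_const, smul_eq_mul, mul_one, measureReal_def, Measure.restrict_apply MeasurableSet.univ, Set.univ_inter]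
        refine ENNReal.toReal_le_of_le_ofReal (by linarith) ((measure_mono Set.inter_subset_left).trans ?_)
        rw [Real.volume_Ioo]
        refine ENNReal.ofReal_le_ofReal (by linarith)

lemma osc_sq {f : ℝ → ℝ} (hf : Continuous f) {C α : ℝ} (hC : 0 ≤ C)
    (hH : ∀ x y, |f x - f y| ≤ C * |x - y| ^ α) {h : ℝ} (S : Finset (ℝ × ℝ)) (hh : 0 < h) (hh1 : h < 1)
    (hS : graphOn f ⊆ ⋃ c ∈ S, Metric.ball c h) :
    ∫ x in (0:ℝ)..(2 * Real.pi), |f (x + h) - f x| ^ 2 ≤ 6 * C * h ^ (2 + α) * S.card + C ^ 2 * h ^ (1 + 2 * α) := by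
  have hpt : ∀ x, |f (x + h) - f x| ≤ C * h ^ α := by
    intro x
    have := hH (x + h) x
    rwa [add_sub_cancel_left, abs_of_pos hh] at this
  have hc1 : Continuous fun x => |f (x + h) - f x| := by fun_prop
  have hc2 : Continuous fun x => |f (x + h) - f x| ^ 2 := by fun_prop
  have hpi := Real.pi_gt_three
  rw [← intervalIntegral.integral_add_adjacent_intervals (b := 2 * Real.pi - h) (hc2.intervalIntegrable _ _) (hc2.intervalIntegrable _ _)]
  refine add_le_add ?_ ?_
  · calc _ ≤ ∫ x in (0:ℝ)..(2 * Real.pi - h), (C * h ^ α) * |f (x + h) - f x| := by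
          refine intervalIntegral.integral_mono_on (by linarith) (hc2.intervalIntegrable _ _) ((hc1.const_mul _).intervalIntegrable _ _) fun x hx => ?_
          have := hpt x
          have h0 := abs_nonneg (f (x + h) - f x)
          nlinarith
      _ = (C * h ^ α) * ∫ x in Set.Ioo 0 (2 * Real.pi - h), |f (x + h) - f x| := by
          rw [intervalIntegral.integral_const_mul, intervalIntegral.integral_of_le (by linarith), integral_Ioc_eq_integral_Ioo]
      _ ≤ (C * h ^ α) * (2 * h * (S.card * (h + 2 * h))) := by
          gcongr
          exact osc_int hf hh S hS hh.le
      _ = _ := by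
          rw [Real.rpow_add hh, Real.rpow_two]; ring
  · have : ∫ x in (2 * Real.pi - h)..(2 * Real.pi), |f (x + h) - f x| ^ 2 ≤ ∫ x in (2 * Real.pi - h)..(2 * Real.pi), (C * h ^ α) ^ 2 := by
      refine intervalIntegral.integral_mono_on (by linarith) (hc2.intervalIntegrable _ _) (by simp) fun x hx => ?_
      have := hpt x
      gcongr
    refine this.trans (le_of_eq ?_)
    rw [intervalIntegral.integral_const, smul_eq_mul, Real.rpow_add hh, Real.rpow_one, mul_comm 2 α, Real.rpow_mul hh.le, Real.rpow_two]
    ring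

lemma fourierCoef_eq (g : ℝ → ℂ) (n : ℤ) : fourierCoef g n = fourierCoeffOn (a := 0) (b := 2 * Real.pi) (by positivity) g n := by
  rw [fourierCoeffOn_eq_integral, fourierCoef, Complex.real_smul]
  congr 1
  · push_cast; simp
  · refine intervalIntegral.integral_congr fun x _ => ?_
    simp only [smul_eq_mul]
    rw [fourier_coe_apply]
    congr 2
    have : (Real.pi : ℂ) ≠ 0 := by exact_mod_cast Real.pi_ne_zero
    push_cast
    rw [sub_zero]
    field_simp

lemma fourierCoef_shift {g : ℝ → ℂ} (hper : Function.Periodic g (2 * Real.pi)) (h : ℝ) (n : ℤ) :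
    fourierCoef (fun x => g (x + h)) n = Complex.exp (Complex.I * ((n * h : ℝ) : ℂ)) * fourierCoef g n := by
  rw [fourierCoef, fourierCoef, ← mul_assoc, mul_comm (Complex.exp _), mul_assoc]
  congr 1
  rw [← intervalIntegral.integral_const_mul]
  set G : ℝ → ℂ := fun x => Complex.exp (Complex.I * ((n * h : ℝ) : ℂ)) * (Complex.exp (-Complex.I * n * x) * g x) with hG
  have hGp : Function.Periodic G (2 * Real.pi) := by
    intro x
    simp only [hG]
    rw [hper x]
    congr 2
    rw [Complex.exp_eq_exp_iff_exists_int]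
    refine ⟨-n, ?_⟩
    push_cast; ring
  have h1 := hGp.intervalIntegral_add_eq 0 h
  rw [zero_add] at h1
  rw [h1, show h + 2 * Real.pi = 2 * Real.pi + h by ring]
  have h2 := intervalIntegral.integral_comp_add_right (a := 0) (b := 2 * Real.pi) G h
  rw [zero_add] at h2
  rw [← h2]
  refine intervalIntegral.integral_congr fun x _ => ?_
  simp only [hG]
  rw [← mul_assoc, ← Complex.exp_add]
  congr 2
  push_cast; ring

lemma bessel_shift {f : ℝ → ℝ} (hf : Continuous f) (hper : Function.Periodic f (2 * Real.pi)) (h : ℝ) (s : Finset ℤ) :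
    ∑ n ∈ s, ‖Complex.exp (Complex.I * ((n * h : ℝ) : ℂ)) - 1‖ ^ 2 * ‖fourierCoef (fun x => (f x : ℂ)) n‖ ^ 2
      ≤ (2 * Real.pi)⁻¹ * ∫ x in (0:ℝ)..(2 * Real.pi), |f (x + h) - f x| ^ 2 := by
  set G : ℝ → ℂ := fun x => ((f (x + h) : ℝ) : ℂ) - ((f x : ℝ) : ℂ) with hG
  have hGc : Continuous G := by fun_prop
  have hL2 : MemLp G 2 (volume.restrict (Set.Ioc 0 (2 * Real.pi))) := by
    obtain ⟨A, hA⟩ := (isCompact_Icc (a := 0) (b := 2 * Real.pi)).exists_bound_of_continuousOn hGc.continuousOn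
    refine MemLp.of_bound hGc.aestronglyMeasurable A ?_
    exact (ae_restrict_iff' measurableSet_Ioc).2 (ae_of_all _ fun x hx => hA x (Set.Ioc_subset_Icc_self hx))
  have hP := hasSum_sq_fourierCoeffOn (a := 0) (b := 2 * Real.pi) (by positivity) hL2
  have hle := hP.summable.sum_le_tsum s (fun _ _ => by positivity)
  rw [hP.tsum_eq] at hle
  have hperC : Function.Periodic (fun x => (f x : ℂ)) (2 * Real.pi) := fun x => by simp only [hper x]
  calc _ = ∑ n ∈ s, ‖fourierCoef G n‖ ^ 2 := by
        refine Finset.sum_congr rfl fun n _ => ?_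
        have : fourierCoef G n = (Complex.exp (Complex.I * ((n * h : ℝ) : ℂ)) - 1) * fourierCoef (fun x => (f x : ℂ)) n := by
          rw [sub_mul, ← fourierCoef_shift hperC, one_mul]
          simp only [fourierCoef, hG]
          rw [← mul_sub, ← intervalIntegral.integral_sub]
          · simp only [mul_sub]
          · exact Continuous.intervalIntegrable (by fun_prop) _ _
          · exact Continuous.intervalIntegrable (by fun_prop) _ _
        rw [this, norm_mul, mul_pow]
    _ ≤ _ := by
        simp_rw [fourierCoef_eq]
        refine hle.trans (le_of_eq ?_)
        rw [sub_zero, smul_eq_mul]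
        congr 1
        refine intervalIntegral.integral_congr fun x _ => ?_
        simp only [hG]
        rw [← Complex.ofReal_sub, Complex.norm_real, Real.norm_eq_abs]

lemma block_decay {f : ℝ → ℝ} (hf : Continuous f) (hper : Function.Periodic f (2 * Real.pi)) {C α D : ℝ}
    (hC : 0 ≤ C) (hα0 : 0 < α) (hα : α ≤ 1)
    (hH : ∀ x y, |f x - f y| ≤ C * |x - y| ^ α) (hD : upperMinkowskiDim (graphOn f) < D) (hD1 : 1 ≤ D) :
    ∃ (K : ℝ) (k₀ : ℕ), 0 ≤ K ∧ ∀ k : ℕ, k₀ ≤ k → ∑ n ∈ Finset.Ico (2 ^ k) (2 ^ (k + 1)),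
      ‖fourierCoef (fun x => (f x : ℂ)) ((n : ℕ) : ℤ)‖ ^ 2 ≤ K * (((2:ℝ) ^ k)⁻¹) ^ (2 + α - D) := by
  have hev := cover_of_dim_lt hC hα0 hα hH hD
  have htend : Tendsto (fun k : ℕ => ((2:ℝ) ^ k)⁻¹) atTop (nhdsWithin 0 (Set.Ioi 0)) := by
    refine tendsto_inv_atTop_nhdsGT_zero.comp (tendsto_pow_atTop_atTop_of_one_lt (by norm_num))
  obtain ⟨k₀, hk₀⟩ := eventually_atTop.1 (htend.eventually hev)
  refine ⟨4 * (6 * C + C ^ 2), k₀ + 1, by positivity, fun k hk => ?_⟩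
  set h : ℝ := ((2:ℝ) ^ k)⁻¹ with hh
  have h0 : 0 < h := by positivity
  have h1 : h < 1 := by
    rw [hh]; apply inv_lt_one_of_one_lt₀
    exact one_lt_pow₀ (by norm_num) (by omega)
  obtain ⟨S, hSc, hS⟩ := cover_attained hC hα0 hα hH h0 h1
  have hN : (S.card : ℝ) ≤ h ^ (-D) := by rw [hSc]; exact hk₀ k (by omega)
  have hosc := osc_sq hf hC hH S h0 h1 hS
  have hb := bessel_shift hf hper h ((Finset.Ico (2 ^ k) (2 ^ (k + 1))).image (fun n : ℕ => (n : ℤ)))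
  rw [Finset.sum_image (by intro a _ b _ hab; simpa using hab)] at hb
  have hlow : ∀ n ∈ Finset.Ico (2 ^ k) (2 ^ (k + 1)), 
     (1/4) * ‖fourierCoef (fun x => (f x : ℂ)) ((n : ℕ) : ℤ)‖ ^ 2 ≤ 
      ‖Complex.exp (Complex.I * (((((n : ℕ) : ℤ) : ℝ) * h : ℝ) : ℂ)) - 1‖ ^ 2 * ‖fourierCoef (fun x => (f x : ℂ)) ((n : ℕ) : ℤ)‖ ^ 2 := by
    intro n hn
    have hn' := Finset.mem_Ico.1 hn
    gcongr
    rw [Complex.norm_exp_I_mul_ofReal_sub_one]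
    have a1 : (2:ℝ) ^ k ≤ n := by exact_mod_cast hn'.1
    have a2 : (n:ℝ) ≤ (2:ℝ) ^ k * 2 := by rw [← pow_succ]; exact_mod_cast hn'.2.le
    have b1 : 1 ≤ (n:ℝ) * h := by rw [hh, ← div_eq_mul_inv, le_div_iff₀ (by positivity)]; linarith
    have b2 : (n:ℝ) * h ≤ 2 := by rw [hh, ← div_eq_mul_inv, div_le_iff₀ (by positivity)]; linarith
    have hp3 := Real.pi_gt_three
    have hp4 := Real.pi_le_four
    have := Real.mul_le_sin (x := n * h / 2) (by positivity) (by linarith)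
    have h2p : 1 / 2 ≤ 2 / Real.pi := by rw [div_le_div_iff₀ (by norm_num) (by positivity)]; linarith
    have h3 : (1/4 : ℝ) ≤ Real.sin (n * h / 2) := by
      refine le_trans ?_ this
      nlinarith
    simp only [Int.cast_natCast]
    rw [Real.norm_of_nonneg (by positivity)]
    nlinarith
  have hsum := (Finset.sum_le_sum hlow).trans hb
  rw [← Finset.mul_sum] at hsum
  have hI0 : 0 ≤ ∫ x in (0:ℝ)..(2 * Real.pi), |f (x + h) - f x| ^ 2 :=
    intervalIntegral.integral_nonneg (by positivity) fun x _ => by positivity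
  have hpi1 : (2 * Real.pi)⁻¹ ≤ 1 := inv_le_one_of_one_le₀ (by linarith [Real.pi_gt_three])
  have e1 : h ^ (2 + α) * S.card ≤ h ^ (2 + α - D) := by
    rw [sub_eq_add_neg, Real.rpow_add h0 (2 + α) (-D)]
    exact mul_le_mul_of_nonneg_left hN (by positivity)
  have e2 : h ^ (1 + 2 * α) ≤ h ^ (2 + α - D) :=
    Real.rpow_le_rpow_of_exponent_ge h0 h1.le (by linarith)
  have e3 : 6 * C * h ^ (2 + α) * S.card + C ^ 2 * h ^ (1 + 2 * α) ≤ (6 * C + C ^ 2) * h ^ (2 + α - D) := by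
    have f1 := mul_le_mul_of_nonneg_left e1 (by positivity : 0 ≤ 6 * C)
    have f2 := mul_le_mul_of_nonneg_left e2 (by positivity : 0 ≤ C ^ 2)
    linarith
  have e4 : (2 * Real.pi)⁻¹ * ∫ x in (0:ℝ)..(2 * Real.pi), |f (x + h) - f x| ^ 2 ≤ ∫ x in (0:ℝ)..(2 * Real.pi), |f (x + h) - f x| ^ 2 := by
    nlinarith
  linarith

lemma abel_bound (z : ℕ → ℂ) (c : ℕ → ℝ) (B : ℝ) (hc : Antitone c) (hc0 : ∀ n, 0 ≤ c n)
    (J : ℕ) (hB : ∀ j ≤ J, ‖∑ n ∈ Finset.range j, z n‖ ≤ B) :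
    ‖∑ n ∈ Finset.range J, (c n : ℂ) * z n‖ ≤ c 0 * B := by
  have hB0 : 0 ≤ B := (norm_nonneg _).trans (hB 0 (Nat.zero_le _))
  rcases Nat.eq_zero_or_pos J with rfl | hJ
  · simp; exact mul_nonneg (hc0 0) hB0
  have key := Finset.sum_range_by_parts (fun n => (c n : ℂ)) z J
  simp only [smul_eq_mul] at key
  rw [key]
  have h1 : ‖(c (J - 1) : ℂ) * ∑ n ∈ Finset.range J, z n‖ ≤ c (J - 1) * B := by
    rw [norm_mul, Complex.norm_real, Real.norm_of_nonneg (hc0 _)]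
    exact mul_le_mul_of_nonneg_left (hB J le_rfl) (hc0 _)
  have h2 : ‖∑ i ∈ Finset.range (J - 1), ((c (i + 1) : ℂ) - c i) * ∑ n ∈ Finset.range (i + 1), z n‖
      ≤ ∑ i ∈ Finset.range (J - 1), (c i - c (i + 1)) * B := by
    refine norm_sum_le_of_le _ fun i hi => ?_
    have hi' := Finset.mem_range.1 hi
    rw [norm_mul, ← Complex.ofReal_sub, Complex.norm_real, Real.norm_eq_abs, abs_sub_comm,
      abs_of_nonneg (sub_nonneg.2 (hc (Nat.le_succ i)))]
    exact mul_le_mul_of_nonneg_left (hB _ (by omega)) (sub_nonneg.2 (hc (Nat.le_succ i)))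
  rw [← Finset.sum_mul, Finset.sum_range_sub'] at h2
  refine (norm_sub_le _ _).trans ((add_le_add h1 h2).trans (le_of_eq ?_))
  ring

lemma ew_deriv (t : ℝ) (n : ℕ) (s x y : ℝ) :
    HasDerivAt (fun y => ew t (s * (x - y)) n) (-(Complex.I * n * s) * ew t (s * (x - y)) n) y := by
  unfold ew
  have h1 : HasDerivAt (fun y : ℝ => (n * (s * (x - y)) - n ^ 2 * t : ℝ)) (-(n * s)) y := by
    have := ((((hasDerivAt_id y).const_sub x).const_mul s).const_mul (n:ℝ)).sub_const ((n:ℝ) ^ 2 * t)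
    exact this.congr_deriv (by ring)
  have h2 := ((h1.ofReal_comp).const_mul Complex.I).cexp
  convert h2 using 1
  push_cast; ring

lemma ew_deriv' (t : ℝ) (n : ℕ) (s y : ℝ) :
    HasDerivAt (fun y => ew t (s * y) n) (Complex.I * n * s * ew t (s * y) n) y := by
  have := ew_deriv t n (-s) 0 y
  simp only [zero_sub, neg_mul_neg] at this
  convert this using 1
  push_cast; ring

lemma ew_cont (t : ℝ) (n : ℕ) {φ : ℝ → ℝ} (h : Continuous φ) : Continuous fun y => ew t (φ y) n := by
  unfold ew; fun_prop

lemma ew_per (t : ℝ) (n : ℕ) (σ : ℤ) (x : ℝ) : ew t (x + σ * (2 * Real.pi)) n = ew t x n := by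
  unfold ew
  rw [Complex.exp_eq_exp_iff_exists_int]
  refine ⟨n * σ, ?_⟩
  push_cast; ring

lemma coef_ew {g : ℝ → ℂ} (t : ℝ) (σ : ℤ) (n : ℕ) (x : ℝ) :
    fourierCoef g (σ * n) * ew t (σ * x) n
      = (1 / (2 * Real.pi)) * ∫ y in (0:ℝ)..(2 * Real.pi), ew t (σ * (x - y)) n * g y := by
  rw [fourierCoef, mul_assoc, ← intervalIntegral.integral_mul_const]
  congr 1
  refine intervalIntegral.integral_congr fun y _ => ?_
  rw [mul_right_comm]
  congr 1
  unfold ew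
  rw [← Complex.exp_add]
  congr 1
  push_cast; ring

lemma half_bound {g : ℝ → ℂ} (hper : Function.Periodic g (2 * Real.pi))
    (hbv : BoundedVariationOn g (Set.Icc 0 (2 * Real.pi))) :
    ∃ V : ℝ, 0 ≤ V ∧ ∀ (t : ℝ) (σ : ℤ), σ ^ 2 = 1 → ∀ (s : Finset ℕ) (c : ℕ → ℂ) (B : ℝ), (∀ n ∈ s, n ≠ 0) →
      (∀ x, ‖∑ n ∈ s, c n * ew t x n‖ ≤ B) →
      ∀ x : ℝ, ‖∑ n ∈ s, (n * c n) * (fourierCoef g (σ * n) * ew t (σ * x) n)‖ ≤ B * V := by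
  obtain ⟨V, hV, h⟩ := bv_pair (by positivity) hbv (by simpa using hper 0)
  refine ⟨V, hV, fun t σ hσ s c B hs hB x => ?_⟩
  have hσC : (σ : ℂ) ^ 2 = 1 := by exact_mod_cast hσ
  have hgi := bv_integrable (by positivity) hbv
  set L : ℝ → ℂ := fun y => ∑ n ∈ s, (c n * (σ * Complex.I)) * ew t (σ * (x - y)) n with hL
  set L' : ℝ → ℂ := fun y => ∑ n ∈ s, (n * c n) * ew t (σ * (x - y)) n with hL'
  have h1 := h L L' B (fun y => by
      have := HasDerivAt.fun_sum (u := s) fun n _ => (ew_deriv t n σ x y).const_mul (c n * (σ * Complex.I))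
      refine this.congr_deriv ?_
      change _ = ∑ n ∈ s, (n * c n) * ew t (σ * (x - y)) n
      refine Finset.sum_congr rfl fun n _ => ?_
      push_cast
      linear_combination ((n * c n) * ew t (σ * (x - y)) n) * hσC - (n * c n * σ ^ 2 * ew t (σ * (x - y)) n) * Complex.I_sq )
    (by
      refine continuous_finsetSum _ fun n _ => continuous_const.mul (ew_cont t n (by fun_prop)))
    (by
      simp only [hL]
      refine Finset.sum_congr rfl fun n _ => ?_
      congr 1
      rw [← ew_per t n σ (σ * (x - 2 * Real.pi))]
      congr 1; ring)
    (fun y => by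
      have := hB (σ * (x - y))
      refine le_trans (le_of_eq ?_) this
      have e : L y = (σ * Complex.I) * ∑ n ∈ s, c n * ew t (σ * (x - y)) n := by
        simp only [hL]; rw [Finset.mul_sum]; refine Finset.sum_congr rfl fun n _ => ?_
        ring
      have hσn : ‖(σ : ℂ)‖ = 1 := by
        have : ‖(σ:ℂ)‖ ^ 2 = 1 := by rw [← norm_pow, hσC, norm_one]
        nlinarith [norm_nonneg (σ : ℂ)]
      rw [e, norm_mul, norm_mul, hσn, Complex.norm_I]; simp)
  have h2 : ∑ n ∈ s, (n * c n) * (fourierCoef g (σ * n) * ew t (σ * x) n) 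
      = (1 / (2 * Real.pi)) * ∫ y in (0:ℝ)..(2 * Real.pi), L' y * g y := by
    simp only [coef_ew, hL', Finset.sum_mul]
    rw [intervalIntegral.integral_finsetSum]
    · rw [Finset.mul_sum]
      refine Finset.sum_congr rfl fun n _ => ?_
      simp only [mul_assoc]
      rw [intervalIntegral.integral_const_mul, intervalIntegral.integral_const_mul]
      ring
    · intro n _
      refine hgi.continuousOn_mul (Continuous.continuousOn ?_)
      exact continuous_const.mul (ew_cont t n (by fun_prop))
  rw [h2, norm_mul]
  have h3 : ‖(1 / (2 * Real.pi) : ℂ)‖ ≤ 1 := by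
    rw [norm_div, norm_one, norm_mul, Complex.norm_real, Real.norm_of_nonneg Real.pi_pos.le, Complex.norm_two, div_le_one (by positivity)]
    linarith [Real.pi_gt_three]
  calc _ ≤ 1 * (B * V) := by gcongr
    _ = _ := one_mul _

lemma coef_decay {g : ℝ → ℂ} (hper : Function.Periodic g (2 * Real.pi))
    (hbv : BoundedVariationOn g (Set.Icc 0 (2 * Real.pi))) :
    ∃ V : ℝ, 0 ≤ V ∧ ∀ n : ℕ, n ≠ 0 → ‖fourierCoef g n‖ ≤ V / n ∧ ‖fourierCoef g (-n)‖ ≤ V / n := by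
  obtain ⟨V, hV, h⟩ := half_bound hper hbv
  refine ⟨V, hV, fun n hn => ?_⟩
  have hn0 : (0:ℝ) < n := by positivity
  have key : ∀ σ : ℤ, σ ^ 2 = 1 → ‖fourierCoef g (σ * n)‖ ≤ V / n := by
    intro σ hσ
    have := h 0 σ hσ {n} (fun _ => 1) 1 (by simpa using hn) (fun x => by simp [ew_norm]) 0
    simp only [Finset.sum_singleton, norm_mul, ew_norm] at this
    rw [le_div_iff₀ hn0]
    simpa [mul_comm] using this
  exact ⟨by simpa using key 1 rfl, by simpa using key (-1) rfl⟩

noncomputable def hblk (g : ℝ → ℂ) (t : ℝ) (σ : ℤ) (k : ℕ) (x : ℝ) : ℂ :=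
  ∑ n ∈ Finset.Ico ((2:ℕ) ^ k) (2 ^ (k + 1)), fourierCoef g (σ * n) * ew t (σ * x) n

lemma hblk_bounds {g : ℝ → ℂ} (hper : Function.Periodic g (2 * Real.pi))
    (hbv : BoundedVariationOn g (Set.Icc 0 (2 * Real.pi))) {t : ℝ} (ht : WeylGood t) {e : ℝ} (he : 0 < e) :
    ∃ A : ℝ, 0 ≤ A ∧ ∀ σ : ℤ, σ ^ 2 = 1 → ∀ k : ℕ,
      (∀ x, ‖hblk g t σ k x‖ ≤ A * ((2:ℝ) ^ k) ^ (-(1 / 2 - e))) ∧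
      (∀ x y, ‖hblk g t σ k x - hblk g t σ k y‖ ≤ A * (((2:ℝ) ^ k) ^ (1 / 2 + e) * |x - y|)) := by
  obtain ⟨V, hV, h⟩ := half_bound hper hbv
  obtain ⟨C, hC, hw⟩ := ht e he
  refine ⟨2 * C * 2 ^ (1 / 2 + e) * V, by positivity, fun σ hσ k => ?_⟩
  have hpk : (0:ℝ) < 2 ^ k := by positivity
  have hJ : (2:ℕ) ^ (k + 1) - 2 ^ k = 2 ^ k := by rw [pow_succ]; omega
  have hpart : ∀ j ≤ 2 ^ k, ∀ x, ‖∑ i ∈ Finset.range j, ew t x (2 ^ k + i)‖ ≤ 2 * C * 2 ^ (1 / 2 + e) * ((2:ℝ) ^ k) ^ (1 / 2 + e) := by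
    intro j hj x
    have h1 : ∑ i ∈ Finset.range j, ew t x (2 ^ k + i) = ∑ n ∈ Finset.range (2 ^ k + j), ew t x n - ∑ n ∈ Finset.range (2 ^ k), ew t x n := by
      rw [Finset.sum_range_add, add_sub_cancel_left]
    have hm : ∀ N : ℕ, N ≤ 2 ^ k + 2 ^ k → ‖∑ n ∈ Finset.range N, ew t x n‖ ≤ C * (2 ^ (1 / 2 + e) * ((2:ℝ) ^ k) ^ (1 / 2 + e)) := by
      intro N hN
      refine (hw N x).trans ?_
      rw [← Real.mul_rpow (by norm_num) hpk.le]
      have : (N : ℝ) ≤ 2 * 2 ^ k := by rw [two_mul]; exact_mod_cast hN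
      gcongr
    rw [h1]
    refine (norm_sub_le _ _).trans ((add_le_add (hm _ (by omega)) (hm _ (by omega))).trans (le_of_eq ?_))
    ring
  have hne : ∀ n ∈ Finset.Ico ((2:ℕ) ^ k) (2 ^ (k + 1)), n ≠ 0 := by
    intro n hn
    have := (Finset.mem_Ico.1 hn).1
    have : 0 < 2 ^ k := by positivity
    omega
  constructor
  · intro x
    have := h t σ hσ (Finset.Ico ((2:ℕ) ^ k) (2 ^ (k + 1))) (fun n => (((n:ℝ)⁻¹ : ℝ) : ℂ))
      (((2:ℝ) ^ k)⁻¹ * (2 * C * 2 ^ (1 / 2 + e) * ((2:ℝ) ^ k) ^ (1 / 2 + e))) hne (fun x => by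
        rw [Finset.sum_Ico_eq_sum_range, hJ]
        have := abel_bound (fun i => ew t x (2 ^ k + i)) (fun i => (((2 ^ k + i : ℕ) : ℝ))⁻¹) _ (by
            intro i j hij
            have h0 : (0:ℝ) < ((2 ^ k + i : ℕ) : ℝ) := by positivity
            have h1 : ((2 ^ k + i : ℕ) : ℝ) ≤ ((2 ^ k + j : ℕ) : ℝ) := by exact_mod_cast Nat.add_le_add_left hij _
            exact inv_anti₀ h0 h1) (fun n => by positivity) (2 ^ k) (fun j hj => hpart j hj x)
        simpa using this) x
    have e1 : ∑ n ∈ Finset.Ico ((2:ℕ) ^ k) (2 ^ (k + 1)), ((n:ℂ) * (((n:ℝ)⁻¹ : ℝ) : ℂ)) * (fourierCoef g (σ * n) * ew t (σ * x) n) = hblk g t σ k x := by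
      unfold hblk
      refine Finset.sum_congr rfl fun n hn => ?_
      have : (n : ℂ) ≠ 0 := by exact_mod_cast hne n hn
      push_cast
      field_simp
    rw [e1] at this
    refine this.trans (le_of_eq ?_)
    rw [show -(1 / 2 - e) = -1 + (1 / 2 + e) by ring, Real.rpow_add hpk (-1) (1 / 2 + e), Real.rpow_neg_one]
    ring
  · have hd : ∀ x, HasDerivAt (hblk g t σ k) (∑ n ∈ Finset.Ico ((2:ℕ) ^ k) (2 ^ (k + 1)), fourierCoef g (σ * n) * (Complex.I * n * σ * ew t (σ * x) n)) x := by
      intro x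
      have := HasDerivAt.fun_sum (u := Finset.Ico ((2:ℕ) ^ k) (2 ^ (k + 1))) fun n _ => (ew_deriv' t n σ x).const_mul (fourierCoef g (σ * n))
      refine this.congr_deriv ?_
      refine Finset.sum_congr rfl fun n _ => ?_
      push_cast; ring
    have hdb : ∀ x, ‖∑ n ∈ Finset.Ico ((2:ℕ) ^ k) (2 ^ (k + 1)), fourierCoef g (σ * n) * (Complex.I * n * σ * ew t (σ * x) n)‖ 
        ≤ 2 * C * 2 ^ (1 / 2 + e) * V * ((2:ℝ) ^ k) ^ (1 / 2 + e) := by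
      intro x
      have := h t σ hσ (Finset.Ico ((2:ℕ) ^ k) (2 ^ (k + 1))) (fun n => Complex.I * σ)
        (2 * C * 2 ^ (1 / 2 + e) * ((2:ℝ) ^ k) ^ (1 / 2 + e)) hne (fun x => by
          rw [← Finset.mul_sum, norm_mul, Finset.sum_Ico_eq_sum_range, hJ]
          have hσn : ‖(σ : ℂ)‖ = 1 := by
            have : ‖(σ:ℂ)‖ ^ 2 = 1 := by rw [← norm_pow]; norm_cast; rw [hσ]; simp
            nlinarith [norm_nonneg (σ : ℂ)]
          rw [norm_mul, hσn, Complex.norm_I]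
          simpa using hpart _ le_rfl x) x
      refine le_trans (le_of_eq ?_) (this.trans (le_of_eq ?_))
      · congr 1
        refine Finset.sum_congr rfl fun n _ => ?_
        ring
      · ring
    intro x y
    have := convex_univ.norm_image_sub_le_of_norm_hasDerivWithin_le (fun z _ => (hd z).hasDerivWithinAt) (fun z _ => hdb z) (Set.mem_univ y) (Set.mem_univ x)
    rw [Real.norm_eq_abs] at this
    linarith


lemma int_exp_int (q : ℤ) (hq : q ≠ 0) (a : ℝ) :
    ∫ x in a..(a + 2 * Real.pi), Complex.exp (Complex.I * q * (x : ℂ)) = 0 := by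
  rw [integral_exp_mul_complex (mul_ne_zero Complex.I_ne_zero (by exact_mod_cast hq))]
  have : Complex.exp (Complex.I * q * ((a + 2 * Real.pi : ℝ) : ℂ)) = Complex.exp (Complex.I * q * (a : ℂ)) := by
    rw [Complex.exp_eq_exp_iff_exists_int]
    refine ⟨q, ?_⟩
    push_cast; ring
  rw [this, sub_self, zero_div]

lemma coef_cont_int {f : ℝ → ℂ} (hf : Continuous f) (m : ℤ) (a b : ℝ) :
    IntervalIntegrable (fun x : ℝ => Complex.exp (-Complex.I * (m : ℂ) * (x : ℂ)) * f x) volume a b := by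
  refine Continuous.intervalIntegrable ?_ _ _
  exact (by fun_prop : Continuous fun x : ℝ => Complex.exp (-Complex.I * (m : ℂ) * (x : ℂ))).mul hf

lemma coef_add {f h : ℝ → ℂ} (hf : Continuous f) (hh : Continuous h) (m : ℤ) :
    fourierCoef (fun x => f x + h x) m = fourierCoef f m + fourierCoef h m := by
  unfold fourierCoef
  rw [← mul_add, ← intervalIntegral.integral_add (coef_cont_int hf m _ _) (coef_cont_int hh m _ _)]
  simp only [mul_add]

lemma coef_exp (t : ℝ) (σ : ℤ) (n : ℕ) (c : ℂ) (m : ℤ) :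
    fourierCoef (fun x => c * ew t (σ * x) n) m
      = if m = σ * n then c * Complex.exp (-Complex.I * (t : ℂ) * (n : ℂ) ^ 2) else 0 := by
  unfold fourierCoef
  have e : ∀ x : ℝ, Complex.exp (-Complex.I * (m : ℂ) * (x : ℂ)) * (c * ew t (σ * x) n)
      = (c * Complex.exp (-Complex.I * (t : ℂ) * (n : ℂ) ^ 2)) * Complex.exp (Complex.I * ((σ * n - m : ℤ) : ℂ) * (x:ℂ)) := by
    intro x
    unfold ew
    rw [mul_left_comm, ← Complex.exp_add, mul_assoc c, ← Complex.exp_add]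
    congr 2
    push_cast; ring
  simp only [e]
  rw [intervalIntegral.integral_const_mul]
  split_ifs with h
  · have : (σ * n - m : ℤ) = 0 := by omega
    rw [this]
    have hp : (Real.pi : ℂ) ≠ 0 := by exact_mod_cast Real.pi_ne_zero
    simp
    field_simp
  · have := int_exp_int (σ * n - m) (by omega) 0
    rw [zero_add] at this
    rw [this]; simp

lemma hblk_cont (g : ℝ → ℂ) (t : ℝ) (σ : ℤ) (k : ℕ) : Continuous (hblk g t σ k) := by
  unfold hblk
  exact continuous_finsetSum _ fun n _ => continuous_const.mul (ew_cont t n (by fun_prop))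

lemma coef_hblk (g : ℝ → ℂ) (t : ℝ) (σ : ℤ) (hσ : σ ^ 2 = 1) (k : ℕ) (m : ℤ) :
    fourierCoef (hblk g t σ k) m
      = if 0 < σ * m ∧ k = Nat.log 2 (σ * m).toNat then
          Complex.exp (-Complex.I * (t : ℂ) * (m : ℂ) ^ 2) * fourierCoef g m else 0 := by
  have h1 : fourierCoef (hblk g t σ k) m = ∑ n ∈ Finset.Ico ((2:ℕ) ^ k) (2 ^ (k + 1)),
      fourierCoef (fun x => fourierCoef g (σ * n) * ew t (σ * x) n) m := by
    unfold hblk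
    generalize Finset.Ico ((2:ℕ) ^ k) (2 ^ (k + 1)) = s
    induction s using Finset.cons_induction with
    | empty => simp [fourierCoef]
    | cons a s ha ih =>
      simp only [Finset.sum_cons]
      have hc : ∀ n : ℕ, Continuous fun x : ℝ => fourierCoef g (σ * n) * ew t (σ * x) n :=
        fun n => continuous_const.mul (ew_cont t n (by fun_prop))
      rw [coef_add (hc a) (continuous_finsetSum s fun n _ => hc n), ih]
  rw [h1]
  simp only [coef_exp]
  have hmn : ∀ n : ℕ, m = σ * n ↔ σ * m = n := by
    intro n
    constructor
    · rintro rfl; linear_combination (n:ℤ) * hσ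
    · intro h; rw [← h]; linear_combination (-m) * hσ
  split_ifs with h
  · obtain ⟨h0, hk⟩ := h
    set p := (σ * m).toNat with hp
    have hpm : σ * m = p := by rw [hp, Int.toNat_of_nonneg h0.le]
    have hp0 : p ≠ 0 := by rintro h; rw [h] at hpm; simp at hpm; omega
    have hl := (Nat.log_eq_iff (Or.inr ⟨by norm_num, hp0⟩)).1 hk.symm
    have hm := (hmn p).2 hpm
    rw [Finset.sum_eq_single_of_mem p (Finset.mem_Ico.2 hl)]
    · rw [if_pos hm, ← hm, mul_comm]
      congr 2
      have hσC : (σ : ℂ) ^ 2 = 1 := by exact_mod_cast hσ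
      have hmC : (m : ℂ) = σ * p := by exact_mod_cast hm
      rw [hmC]; linear_combination (Complex.I * t * p ^ 2) * hσC
    · intro b _ hb
      rw [if_neg]
      intro hb'
      exact hb (by have := (hmn b).1 hb'; omega)
  · refine Finset.sum_eq_zero fun n hn => ?_
    rw [if_neg]
    intro hm
    have hm' := (hmn n).1 hm
    have hI := Finset.mem_Ico.1 hn
    have : 0 < 2 ^ k := by positivity
    refine h ⟨by omega, ?_⟩
    rw [hm', Int.toNat_natCast]
    exact ((Nat.log_eq_iff (Or.inr ⟨by norm_num, by omega⟩)).2 hI).symm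

lemma coef_tsum {F : ℕ → ℝ → ℂ} {b : ℕ → ℝ} (hF : ∀ k, Continuous (F k)) (hb : Summable b)
    (hFb : ∀ k x, ‖F k x‖ ≤ b k) (m : ℤ) :
    HasSum (fun k => fourierCoef (F k) m) (fourierCoef (fun x => ∑' k, F k x) m) := by
  unfold fourierCoef
  refine HasSum.mul_left _ ?_
  refine intervalIntegral.hasSum_integral_of_dominated_convergence (fun k _ => b k) ?_ ?_ ?_ ?_ ?_
  · intro k
    exact ((by fun_prop : Continuous fun x : ℝ => Complex.exp (-Complex.I * (m : ℂ) * (x : ℂ))).mul (hF k)).aestronglyMeasurable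
  · intro k
    refine Eventually.of_forall fun x _ => ?_
    rw [norm_mul, show -Complex.I * (m:ℂ) * (x:ℂ) = Complex.I * ((-(m * x) : ℝ) : ℂ) by push_cast; ring,
      Complex.norm_exp_I_mul_ofReal, one_mul]
    exact hFb k x
  · exact Eventually.of_forall fun _ _ => hb
  · simp
  · refine Eventually.of_forall fun x _ => HasSum.mul_left _ ?_
    exact (Summable.of_norm_bounded hb (fun k => hFb k x)).hasSum

lemma pow_geom (k : ℕ) (e : ℝ) : ((2:ℝ) ^ k) ^ e = ((2:ℝ) ^ e) ^ k := by
  rw [← Real.rpow_natCast, ← Real.rpow_natCast, ← Real.rpow_mul (by norm_num), ← Real.rpow_mul (by norm_num), mul_comm]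

lemma summable_pow_geom {e : ℝ} (he : e < 0) : Summable fun k : ℕ => ((2:ℝ) ^ k) ^ e := by
  simp only [pow_geom]
  exact summable_geometric_of_lt_one (by positivity) (Real.rpow_lt_one_of_one_lt_of_neg (by norm_num) he)

lemma exists_u {g : ℝ → ℂ} (hper : Function.Periodic g (2 * Real.pi))
    (hbv : BoundedVariationOn g (Set.Icc 0 (2 * Real.pi))) {t : ℝ} (ht : WeylGood t) :
    ∃ u : ℝ → ℂ, Continuous u ∧ Function.Periodic u (2 * Real.pi) ∧
      (∀ n : ℤ, fourierCoef u n =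
        Complex.exp (-Complex.I * (t : ℂ) * (n : ℂ) ^ 2) * fourierCoef g n) ∧
      ∀ θ : ℝ, 0 < θ → θ < 1 / 2 → ∃ C : ℝ, 0 ≤ C ∧ ∀ x y, ‖u x - u y‖ ≤ C * |x - y| ^ θ := by
  set F : ℕ → ℝ → ℂ := fun k x => hblk g t 1 k x + hblk g t (-1) k x with hF
  have hFc : ∀ k, Continuous (F k) := fun k => (hblk_cont g t 1 k).add (hblk_cont g t (-1) k)
  obtain ⟨A, hA, hAb⟩ := hblk_bounds hper hbv ht (e := 1 / 4) (by norm_num)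
  have hFb : ∀ k x, ‖F k x‖ ≤ 2 * A * ((2:ℝ) ^ k) ^ (-(1 / 2 - 1 / 4) : ℝ) := by
    intro k x
    have h1 := (hAb 1 rfl k).1 x
    have h2 := (hAb (-1) rfl k).1 x
    refine (norm_add_le _ _).trans ?_
    linarith
  have hs : Summable fun k : ℕ => 2 * A * ((2:ℝ) ^ k) ^ (-(1 / 2 - 1 / 4) : ℝ) :=
    (summable_pow_geom (by norm_num)).mul_left _
  have hFs : ∀ x, Summable fun k => F k x := fun x => Summable.of_norm_bounded hs fun k => hFb k x
  have hcont : Continuous fun x => ∑' k, F k x := continuous_tsum hFc hs hFb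
  refine ⟨fun x => fourierCoef g 0 + ∑' k, F k x, continuous_const.add hcont, ?_, ?_, ?_⟩
  · intro x
    have : ∀ k, F k (x + 2 * Real.pi) = F k x := by
      intro k
      simp only [hF, hblk]
      congr 1
      · refine Finset.sum_congr rfl fun n _ => ?_
        rw [← ew_per t n 1 (((1:ℤ):ℝ) * x)]; congr 2; push_cast; ring
      · refine Finset.sum_congr rfl fun n _ => ?_
        rw [← ew_per t n (-1) (((-1:ℤ):ℝ) * x)]; congr 2; push_cast; ring
    simp only [this]
  · intro m
    rw [coef_add continuous_const hcont]
    have h0 : fourierCoef (fun _ => fourierCoef g 0) m = if m = 0 then fourierCoef g 0 else 0 := by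
      have := coef_exp 0 1 0 (fourierCoef g 0) m
      simpa [ew] using this
    rw [h0]
    have hsum := coef_tsum hFc hs hFb m
    have hFm : ∀ k, fourierCoef (F k) m = (if 0 < 1 * m ∧ k = Nat.log 2 (1 * m).toNat then
          Complex.exp (-Complex.I * (t : ℂ) * (m : ℂ) ^ 2) * fourierCoef g m else 0) + 
        (if 0 < -1 * m ∧ k = Nat.log 2 (-1 * m).toNat then
          Complex.exp (-Complex.I * (t : ℂ) * (m : ℂ) ^ 2) * fourierCoef g m else 0) := by
      intro k
      simp only [hF]
      rw [coef_add (hblk_cont g t 1 k) (hblk_cont g t (-1) k), coef_hblk g t 1 rfl, coef_hblk g t (-1) rfl]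
    simp only [hFm] at hsum
    rcases lt_trichotomy m 0 with h | h | h
    · have e1 : ¬ (0 < 1 * m) := by omega
      have e2 : 0 < -1 * m := by omega
      simp only [e1, e2, false_and, true_and, if_false, zero_add] at hsum
      rw [if_neg h.ne, zero_add]
      exact hsum.unique (hasSum_ite_eq _ _)
    · subst h
      simp only [mul_zero, lt_irrefl, false_and, if_false, add_zero] at hsum
      rw [hsum.unique hasSum_zero]; simp
    · have e1 : ¬ (0 < -1 * m) := by omega
      have e2 : 0 < 1 * m := by omega
      simp only [e1, e2, false_and, true_and, if_false, add_zero] at hsum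
      rw [if_neg h.ne', zero_add]
      exact hsum.unique (hasSum_ite_eq _ _)
  · intro θ hθ hθ2
    obtain ⟨A, hA, hAb⟩ := hblk_bounds hper hbv ht (e := (1 / 2 - θ) / 2) (by linarith)
    set e := (1 / 2 - θ) / 2 with he
    have hd : ∀ σ : ℤ, σ ^ 2 = 1 → ∀ k x y, ‖hblk g t σ k x - hblk g t σ k y‖ 
        ≤ (2 * A * ((2:ℝ) ^ k) ^ (-e)) * |x - y| ^ θ := by
      intro σ hσ k x y
      have h1 : ‖hblk g t σ k x - hblk g t σ k y‖ ≤ 2 * A * ((2:ℝ) ^ k) ^ (-(1 / 2 - e)) := by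
        have h1 := (hAb σ hσ k).1 x
        have h2 := (hAb σ hσ k).1 y
        refine (norm_sub_le _ _).trans ?_
        linarith
      have h2 : ‖hblk g t σ k x - hblk g t σ k y‖ ≤ 2 * A * (((2:ℝ) ^ k) ^ (1 / 2 + e) * |x - y|) := by
        refine ((hAb σ hσ k).2 x y).trans ?_
        have : 0 ≤ A * (((2:ℝ) ^ k) ^ (1 / 2 + e) * |x - y|) := by positivity
        linarith
      have h3 := min_interp (norm_nonneg _) h2 h1 hθ.le (by linarith)
      refine h3.trans (le_of_eq ?_)
      have hp : (0:ℝ) < 2 ^ k := by positivity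
      have hA2 : 0 ≤ 2 * A := by positivity
      rw [Real.mul_rpow hA2 (by positivity), Real.mul_rpow hA2 (by positivity),
        Real.mul_rpow (by positivity) (abs_nonneg _), ← Real.rpow_mul hp.le, ← Real.rpow_mul hp.le]
      have e1 : (2 * A) ^ θ * (2 * A) ^ (1 - θ) = 2 * A := by
        rw [← Real.rpow_add' (by positivity) (by norm_num)]; simp
      have e2 : ((2:ℝ) ^ k) ^ ((1 / 2 + e) * θ) * ((2:ℝ) ^ k) ^ (-(1 / 2 - e) * (1 - θ)) = ((2:ℝ) ^ k) ^ (-e) := by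
        rw [← Real.rpow_add hp]; congr 1; rw [he]; ring
      calc (2 * A) ^ θ * (((2:ℝ) ^ k) ^ ((1 / 2 + e) * θ) * |x - y| ^ θ) * ((2 * A) ^ (1 - θ) * ((2:ℝ) ^ k) ^ (-(1 / 2 - e) * (1 - θ)))
          = ((2 * A) ^ θ * (2 * A) ^ (1 - θ)) * (((2:ℝ) ^ k) ^ ((1 / 2 + e) * θ) * ((2:ℝ) ^ k) ^ (-(1 / 2 - e) * (1 - θ))) * |x - y| ^ θ := by ring
        _ = _ := by rw [e1, e2]
    have hse : Summable fun k : ℕ => ((2:ℝ) ^ k) ^ (-e) := summable_pow_geom (by linarith)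
    refine ⟨∑' k : ℕ, (2 * (2 * A * ((2:ℝ) ^ k) ^ (-e))), tsum_nonneg fun k => by positivity, fun x y => ?_⟩
    rw [add_sub_add_left_eq_sub, ← (hFs x).tsum_sub (hFs y), ← tsum_mul_right]
    have hb : Summable fun k : ℕ => 2 * (2 * A * ((2:ℝ) ^ k) ^ (-e)) * |x - y| ^ θ :=
      ((hse.mul_left _).mul_left _).mul_right _
    refine tsum_of_norm_bounded hb.hasSum fun k => ?_
    have h1 := hd 1 rfl k x y
    have h2 := hd (-1) rfl k x y
    simp only [hF]
    rw [add_sub_add_comm]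
    refine (norm_add_le _ _).trans ?_
    linarith


lemma parseval_piece (c : ℕ → ℂ) (a : ℝ) (N : ℕ) :
    ∫ t in a..(a + 2 * Real.pi), ‖∑ n ∈ Finset.range N, c n * Complex.exp (Complex.I * ((-(2 * ((n:ℤ) + 1) ^ 2) : ℤ) : ℂ) * (t:ℂ))‖ ^ 2
      = 2 * Real.pi * ∑ n ∈ Finset.range N, ‖c n‖ ^ 2 := by
  set q : ℕ → ℤ := fun n => -(2 * ((n:ℤ) + 1) ^ 2) with hq
  have hqne : ∀ m n : ℕ, m ≠ n → q n - q m ≠ 0 := by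
    intro m n hmn h
    have h1 : ((n:ℤ) + 1) ^ 2 = ((m:ℤ) + 1) ^ 2 := by simp only [hq] at h; linarith
    have h2 : ((n:ℤ) + 1) = (m:ℤ) + 1 := by
      rcases sq_eq_sq_iff_eq_or_eq_neg.1 h1 with h | h <;> omega
    omega
  have key : ∀ t : ℝ, ((‖∑ n ∈ Finset.range N, c n * Complex.exp (Complex.I * (q n : ℂ) * (t:ℂ))‖ ^ 2 : ℝ) : ℂ)
      = ∑ n ∈ Finset.range N, ∑ m ∈ Finset.range N, (c n * (starRingEnd ℂ) (c m)) * Complex.exp (Complex.I * ((q n - q m : ℤ) : ℂ) * (t:ℂ)) := by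
    intro t
    rw [Complex.ofReal_pow, ← Complex.mul_conj', map_sum, Finset.sum_mul_sum]
    refine Finset.sum_congr rfl fun n _ => Finset.sum_congr rfl fun m _ => ?_
    rw [map_mul, ← Complex.exp_conj, mul_mul_mul_comm, ← Complex.exp_add]
    congr 2
    simp only [map_mul, Complex.conj_I, Complex.conj_ofReal, map_intCast]
    push_cast; ring
  rw [← Complex.ofReal_inj, ← intervalIntegral.integral_ofReal]
  refine Eq.trans (intervalIntegral.integral_congr fun t _ => key t) ?_
  have hci : ∀ n m : ℕ, IntervalIntegrable (fun t : ℝ => (c n * (starRingEnd ℂ) (c m)) * Complex.exp (Complex.I * ((q n - q m : ℤ) : ℂ) * (t:ℂ))) volume a (a + 2 * Real.pi) :=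
    fun n m => Continuous.intervalIntegrable (by fun_prop) _ _
  rw [intervalIntegral.integral_finsetSum fun n _ => 
    Continuous.intervalIntegrable (by fun_prop) _ _]
  rw [Complex.ofReal_mul, Complex.ofReal_sum, Finset.mul_sum]
  refine Finset.sum_congr rfl fun n hn => ?_
  rw [intervalIntegral.integral_finsetSum fun m _ => hci n m]
  rw [Finset.sum_eq_single_of_mem n hn]
  · rw [intervalIntegral.integral_const_mul, sub_self, Complex.mul_conj']
    simp
    ring
  · intro m _ hm
    rw [intervalIntegral.integral_const_mul, int_exp_int _ (hqne m n hm), mul_zero]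

lemma ae_unbdd (p : ℕ → ℝ) (hp : ∀ n, 0 ≤ p n) (hps : ¬ Summable p) (c : ℕ → ℂ)
    (hc : Summable fun n => ‖c n‖ ^ 2) :
    ∀ᵐ t : ℝ, ∀ M : ℝ, ∃ N, M < ∑ n ∈ Finset.range N,
      (p n + (c n * Complex.exp (Complex.I * ((-(2 * ((n:ℤ) + 1) ^ 2) : ℤ) : ℂ) * (t:ℂ))).re) := by
  set Q : ℕ → ℝ → ℂ := fun N t => ∑ n ∈ Finset.range N, c n * Complex.exp (Complex.I * ((-(2 * ((n:ℤ) + 1) ^ 2) : ℤ) : ℂ) * (t:ℂ)) with hQ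
  have hQc : ∀ N, Continuous (Q N) := fun N => by simp only [hQ]; fun_prop
  have hX : ∀ N (t : ℝ), ∑ n ∈ Finset.range N,
      (p n + (c n * Complex.exp (Complex.I * ((-(2 * ((n:ℤ) + 1) ^ 2) : ℤ) : ℂ) * (t:ℂ))).re)
      = ∑ n ∈ Finset.range N, p n + (Q N t).re := by
    intro N t
    rw [Finset.sum_add_distrib, hQ, Complex.re_sum]
  simp only [hX]
  refine ae_real_of_pieces (2 * Real.pi) (by positivity) fun j => ?_
  set a : ℝ := j * (2 * Real.pi) with ha
  have hab : a ≤ a + 2 * Real.pi := by linarith [Real.pi_pos]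
  suffices h : ∀ M : ℕ, ∀ᵐ t ∂(volume.restrict (Set.Ioc a (a + 2 * Real.pi))), 
      ∃ N, (M:ℝ) < ∑ n ∈ Finset.range N, p n + (Q N t).re by
    filter_upwards [ae_all_iff.2 h] with t ht M
    obtain ⟨m, hm⟩ := exists_nat_ge M
    obtain ⟨N, hN⟩ := ht m
    exact ⟨N, hm.trans_lt hN⟩
  intro M
  set μ := volume.restrict (Set.Ioc a (a + 2 * Real.pi)) with hμ
  set E : Set ℝ := {t | ∀ N, ∑ n ∈ Finset.range N, p n + (Q N t).re ≤ M} with hE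
  have hEm : MeasurableSet E := by
    rw [hE, Set.ofPred_forall]
    refine (isClosed_iInter fun N => isClosed_le ?_ continuous_const).measurableSet
    exact continuous_const.add (Complex.continuous_re.comp (hQc N))
  have hE0 : μ E = 0 := by
    by_contra hne
    have hfin : μ E ≠ ⊤ := measure_ne_top _ _
    have hpos : 0 < μ.real E := ENNReal.toReal_pos hne hfin
    set K : ℝ := 2 * Real.pi + 2 * Real.pi * ∑' n, ‖c n‖ ^ 2 with hK
    have hbd : ∀ N, ∑ n ∈ Finset.range N, p n ≤ (M * μ.real E + K) / μ.real E := by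
      intro N
      rw [le_div_iff₀ hpos]
      have hint : ∀ f : ℝ → ℝ, Continuous f → Integrable f μ := fun f hf => by
        have := hf.intervalIntegrable (μ := volume) a (a + 2 * Real.pi)
        exact (intervalIntegrable_iff_integrableOn_Ioc_of_le hab).1 this
      have c1 : Continuous fun t => (M:ℝ) + (1 + ‖Q N t‖ ^ 2) := by
        have := hQc N; fun_prop
      have c2 : Continuous fun t => (1 + ‖Q N t‖ ^ 2) := by
        have := hQc N; fun_prop
      calc (∑ n ∈ Finset.range N, p n) * μ.real E = ∫ t in E, (∑ n ∈ Finset.range N, p n) ∂μ := by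
            rw [setIntegral_const, smul_eq_mul, mul_comm]
        _ ≤ ∫ t in E, ((M:ℝ) + (1 + ‖Q N t‖ ^ 2)) ∂μ := by
            refine setIntegral_mono_on (integrable_const _).integrableOn (hint _ c1).integrableOn hEm fun t ht => ?_
            have h1 : ∑ n ∈ Finset.range N, p n + (Q N t).re ≤ M := ht N
            have h2 := Complex.abs_re_le_norm (Q N t)
            have h3 := neg_abs_le (Q N t).re
            nlinarith [sq_nonneg (‖Q N t‖ - 1 / 2)]
        _ = M * μ.real E + ∫ t in E, (1 + ‖Q N t‖ ^ 2) ∂μ := by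
            rw [integral_add (integrable_const _) (hint _ c2).integrableOn, setIntegral_const, smul_eq_mul, mul_comm]
        _ ≤ M * μ.real E + ∫ t, (1 + ‖Q N t‖ ^ 2) ∂μ := by
            have := setIntegral_le_integral (s := E) (hint _ c2) (Eventually.of_forall fun t => by positivity)
            linarith
        _ ≤ _ := by
            gcongr
            rw [hμ, ← intervalIntegral.integral_of_le hab, intervalIntegral.integral_add (by simp) 
              (Continuous.intervalIntegrable (by have := hQc N; fun_prop) _ _)]
            simp only [hQ]
            rw [parseval_piece]
            simp only [intervalIntegral.integral_const, add_sub_cancel_left, smul_eq_mul, mul_one]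
            rw [hK]
            gcongr
            exact hc.sum_le_tsum _ fun n _ => by positivity
    exact hps (summable_of_sum_range_le hp hbd)
  have : ∀ᵐ t ∂μ, t ∉ E := measure_eq_zero_iff_ae_notMem.1 hE0
  filter_upwards [this] with t ht
  simpa [hE] using ht


lemma coef_mul (u : ℝ → ℂ) (θ : ℂ) (n : ℤ) :
    fourierCoef (fun x => θ * u x) n = θ * fourierCoef u n := by
  unfold fourierCoef
  simp only [mul_left_comm _ θ]
  rw [intervalIntegral.integral_const_mul]
  ring

lemma coef_conj (u : ℝ → ℂ) (n : ℤ) :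
    fourierCoef (fun x => (starRingEnd ℂ) (u x)) n = (starRingEnd ℂ) (fourierCoef u (-n)) := by
  unfold fourierCoef
  rw [map_mul, ← intervalIntegral.intervalIntegral_conj]
  congr 1
  · have : (1 / (2 * (Real.pi:ℂ))) = ((1 / (2 * Real.pi) : ℝ) : ℂ) := by push_cast; rfl
    rw [this, Complex.conj_ofReal]
  · congr 1; ext x
    rw [map_mul, ← Complex.exp_conj]
    simp

lemma re_coef {u : ℝ → ℂ} (hu : Continuous u) (θ : ℂ) (n : ℤ) :
    fourierCoef (fun x => (((θ * u x).re : ℝ) : ℂ)) n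
      = (1 / 2) * (θ * fourierCoef u n + (starRingEnd ℂ) (θ * fourierCoef u (-n))) := by
  have e : (fun x => (((θ * u x).re : ℝ) : ℂ)) = fun x => (1 / 2) * (θ * u x + (starRingEnd ℂ) (θ * u x)) := by
    ext x; rw [Complex.re_eq_add_conj]; ring
  rw [e, coef_mul, coef_add (h := fun x => (starRingEnd ℂ) (θ * u x)) (by fun_prop) (Complex.continuous_conj.comp (by fun_prop)), coef_conj, coef_mul, coef_mul]

lemma norm_add_conj_sq (z w : ℂ) : ‖z + (starRingEnd ℂ) w‖ ^ 2 = ‖z‖ ^ 2 + ‖w‖ ^ 2 + 2 * (z * w).re := by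
  simp only [← Complex.normSq_eq_norm_sq, Complex.normSq_apply, Complex.add_re, Complex.add_im,
    Complex.conj_re, Complex.conj_im, Complex.mul_re]
  ring

lemma ae_nonsob {g : ℝ → ℂ} (hper : Function.Periodic g (2 * Real.pi))
    (hbv : BoundedVariationOn g (Set.Icc 0 (2 * Real.pi))) {s : ℝ} (hs0 : 0 < s) (hs : s < 3 / 4)
    (hns : ¬ InSobolev g s) (θ : ℂ) (hθ : ‖θ‖ = 1) :
    ∀ᵐ t : ℝ, ∀ u : ℝ → ℂ, Continuous u → (∀ n : ℤ, fourierCoef u n =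
        Complex.exp (-Complex.I * (t : ℂ) * (n : ℂ) ^ 2) * fourierCoef g n) → 
      ∀ M : ℝ, ∃ N : ℕ, M < ∑ n ∈ Finset.range N, (1 + ((n + 1 : ℕ) : ℝ)) ^ (2 * s) *
        ‖fourierCoef (fun x => (((θ * u x).re : ℝ) : ℂ)) ((n + 1 : ℕ) : ℤ)‖ ^ 2 := by
  set w : ℕ → ℝ := fun n => (1 + ((n + 1 : ℕ) : ℝ)) ^ (2 * s) with hw
  have hw0 : ∀ n, 0 ≤ w n := fun n => by positivity
  set p : ℕ → ℝ := fun n => w n * ((‖fourierCoef g ((n + 1 : ℕ) : ℤ)‖ ^ 2 + ‖fourierCoef g (-((n + 1 : ℕ) : ℤ))‖ ^ 2) / 4) with hpdef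
  set c : ℕ → ℂ := fun n => (w n : ℂ) * (θ ^ 2 * fourierCoef g ((n + 1 : ℕ) : ℤ) * fourierCoef g (-((n + 1 : ℕ) : ℤ)) / 2) with hcdef
  have hp0 : ∀ n, 0 ≤ p n := fun n => mul_nonneg (hw0 n) (by positivity)
  have hps : ¬ Summable p := by
    intro hp
    apply hns
    unfold InSobolev
    refine Summable.of_nat_of_neg_add_one ?_ ?_
    · rw [← summable_nat_add_iff 1]
      refine Summable.of_nonneg_of_le (fun n => by positivity) (fun n => ?_) (hp.mul_left 4)
      have : w n = (1 + |(((n + 1 : ℕ) : ℤ) : ℝ)|) ^ (2 * s) := by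
        simp only [hw]; congr 2; rw [Int.cast_natCast, abs_of_nonneg (by positivity)]
      rw [← this]
      simp only [hpdef]
      nlinarith [mul_nonneg (hw0 n) (sq_nonneg ‖fourierCoef g (-((n + 1 : ℕ) : ℤ))‖)]
    · refine Summable.of_nonneg_of_le (fun n => by positivity) (fun n => ?_) (hp.mul_left 4)
      have : w n = (1 + |((-((n:ℤ) + 1) : ℤ) : ℝ)|) ^ (2 * s) := by
        simp only [hw]; congr 2; push_cast; rw [abs_neg, abs_of_nonneg (by positivity)]
      rw [← this]
      simp only [hpdef]
      have e : -((n:ℤ) + 1) = -((n + 1 : ℕ) : ℤ) := by push_cast; ring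
      rw [e]
      nlinarith [mul_nonneg (hw0 n) (sq_nonneg ‖fourierCoef g ((n + 1 : ℕ) : ℤ)‖)]
  obtain ⟨V, hV, hdec⟩ := coef_decay hper hbv
  have hcs : Summable fun n => ‖c n‖ ^ 2 := by
    have h1 : Summable fun n : ℕ => ((n + 1 : ℕ) : ℝ) ^ (4 * s - 4) :=
      (summable_nat_add_iff 1).2 (Real.summable_nat_rpow.2 (by linarith))
    refine Summable.of_nonneg_of_le (fun n => by positivity) (fun n => ?_) (h1.mul_left ((2 ^ (2 * s) * V ^ 2) ^ 2))
    set m : ℝ := ((n + 1 : ℕ) : ℝ) with hm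
    have hm1 : 1 ≤ m := by rw [hm]; push_cast; linarith [Nat.cast_nonneg (α := ℝ) n]
    have hm0 : 0 < m := by linarith
    have hwn : w n ≤ 2 ^ (2 * s) * m ^ (2 * s) := by
      rw [← Real.mul_rpow (by norm_num) hm0.le]
      simp only [hw]
      refine Real.rpow_le_rpow (by positivity) ?_ (by positivity)
      rw [← hm]; linarith
    obtain ⟨d1, d2⟩ := hdec (n + 1) (by omega)
    rw [← hm] at d1 d2
    have hcn : ‖c n‖ ≤ (2 ^ (2 * s) * V ^ 2) * m ^ (2 * s - 2) := by
      simp only [hcdef]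
      rw [norm_mul, norm_div, norm_mul, norm_mul, norm_pow, hθ, Complex.norm_real, Real.norm_of_nonneg (hw0 n), Complex.norm_two]
      calc _ ≤ (2 ^ (2 * s) * m ^ (2 * s)) * (1 ^ 2 * (V / m) * (V / m) / 1) := by
            gcongr
            norm_num
        _ = _ := by
            rw [Real.rpow_sub hm0, Real.rpow_two]; field_simp
    calc ‖c n‖ ^ 2 ≤ ((2 ^ (2 * s) * V ^ 2) * m ^ (2 * s - 2)) ^ 2 := by gcongr
      _ = _ := by
        rw [mul_pow, ← Real.rpow_natCast (m ^ (2 * s - 2)) 2, ← Real.rpow_mul hm0.le]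
        congr 2; push_cast; ring
  filter_upwards [ae_unbdd p hp0 hps c hcs] with t ht u hu hun M
  obtain ⟨N, hN⟩ := ht M
  refine ⟨N, hN.trans_eq (Finset.sum_congr rfl fun n _ => ?_)⟩
  change _ = w n * _
  rw [re_coef hu, hun, hun, norm_mul, mul_pow, norm_add_conj_sq]
  have hE : ∀ m : ℤ, ‖Complex.exp (-Complex.I * (t : ℂ) * (m : ℂ) ^ 2)‖ = 1 := by
    intro m
    rw [show -Complex.I * (t : ℂ) * (m : ℂ) ^ 2 = Complex.I * ((-(t * m ^ 2) : ℝ) : ℂ) by push_cast; ring,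
      Complex.norm_exp_I_mul_ofReal]
  rw [norm_mul, norm_mul, norm_mul, norm_mul, hθ, hE, hE, one_mul, one_mul, one_mul, one_mul]
  have e1 : c n * Complex.exp (Complex.I * ((-(2 * ((n:ℤ) + 1) ^ 2) : ℤ) : ℂ) * (t:ℂ)) 
      = ((w n / 2 : ℝ) : ℂ) * (θ * (Complex.exp (-Complex.I * (t : ℂ) * (((n + 1 : ℕ) : ℤ) : ℂ) ^ 2) * fourierCoef g ((n + 1 : ℕ) : ℤ)) *
        (θ * (Complex.exp (-Complex.I * (t : ℂ) * ((-((n + 1 : ℕ) : ℤ) : ℤ) : ℂ) ^ 2) * fourierCoef g (-((n + 1 : ℕ) : ℤ))))) := by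
    have : Complex.exp (Complex.I * ((-(2 * ((n:ℤ) + 1) ^ 2) : ℤ) : ℂ) * (t:ℂ)) = 
        Complex.exp (-Complex.I * (t : ℂ) * (((n + 1 : ℕ) : ℤ) : ℂ) ^ 2) * Complex.exp (-Complex.I * (t : ℂ) * ((-((n + 1 : ℕ) : ℤ) : ℤ) : ℂ) ^ 2) := by
      rw [← Complex.exp_add]; congr 1; push_cast; ring
    rw [this]
    simp only [hcdef]
    rw [Complex.ofReal_div, Complex.ofReal_ofNat]
    ring
  rw [e1, Complex.re_ofReal_mul]
  have h4 : ‖(1 / 2 : ℂ)‖ ^ 2 = 1 / 4 := by norm_num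
  rw [h4]
  simp only [hpdef]
  ring


lemma blocks_bound (h : ℕ → ℝ) (h0 : ∀ n, 0 ≤ h n)
    (hs : Summable fun k : ℕ => ∑ n ∈ Finset.Ico ((2:ℕ) ^ k) (2 ^ (k + 1)), h n) :
    ∃ M : ℝ, ∀ N, ∑ n ∈ Finset.range N, h (n + 1) ≤ M := by
  refine ⟨∑' k : ℕ, ∑ n ∈ Finset.Ico ((2:ℕ) ^ k) (2 ^ (k + 1)), h n, fun N => ?_⟩
  have h1 : ∀ K : ℕ, ∑ n ∈ Finset.Ico 1 (2 ^ K), h n = ∑ k ∈ Finset.range K, ∑ n ∈ Finset.Ico ((2:ℕ) ^ k) (2 ^ (k + 1)), h n := by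
    intro K
    induction K with
    | zero => simp
    | succ K ih =>
      rw [Finset.sum_range_succ, ← ih, Finset.sum_Ico_consecutive _ Nat.one_le_two_pow
        (Nat.pow_le_pow_right (by norm_num) (Nat.le_succ K))]
  have h2 : ∑ n ∈ Finset.range N, h (n + 1) = ∑ n ∈ Finset.Ico 1 (N + 1), h n := by
    rw [Finset.sum_Ico_eq_sum_range]
    simp [add_comm]
  rw [h2]
  refine le_trans ?_ ((h1 N).le.trans (hs.sum_le_tsum _ fun k _ => Finset.sum_nonneg fun n _ => h0 n))
  refine Finset.sum_le_sum_of_subset_of_nonneg ?_ fun n _ _ => h0 n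
  exact Finset.Ico_subset_Ico_right Nat.lt_two_pow_self

lemma dim_lower {f : ℝ → ℝ} (hf : Continuous f) (hper : Function.Periodic f (2 * Real.pi)) {r₀ : ℝ}
    (hr0 : 0 < r₀) (hr : r₀ < 3 / 4)
    (hH : ∀ θ : ℝ, 0 < θ → θ < 1 / 2 → ∃ C : ℝ, 0 ≤ C ∧ ∀ x y, |f x - f y| ≤ C * |x - y| ^ θ)
    (hun : ∀ j : ℕ, ∀ M : ℝ, ∃ N : ℕ, M < ∑ n ∈ Finset.range N, 
      (1 + ((n + 1 : ℕ) : ℝ)) ^ (2 * (r₀ + (3 / 4 - r₀) / (j + 2))) *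
        ‖fourierCoef (fun x => (f x : ℂ)) ((n + 1 : ℕ) : ℤ)‖ ^ 2) :
    5 / 2 - 2 * r₀ ≤ upperMinkowskiDim (graphOn f) := by
  by_contra hlt
  push Not at hlt
  obtain ⟨D, hD1, hD2⟩ := exists_between (max_lt hlt (by linarith : (1:ℝ) < 5 / 2 - 2 * r₀))
  obtain ⟨hDd, hD1⟩ := max_lt_iff.1 hD1
  set δ : ℝ := min (1 / 4) ((5 / 2 - 2 * r₀ - D) / 2) with hδ
  have hδ0 : 0 < δ := lt_min (by norm_num) (by linarith)
  have hδ1 : δ ≤ 1 / 4 := min_le_left _ _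
  have hδ2 : δ ≤ (5 / 2 - 2 * r₀ - D) / 2 := min_le_right _ _
  obtain ⟨C, hC, hHC⟩ := hH (1 / 2 - δ) (by linarith) (by linarith)
  obtain ⟨K, k₀, hK, hb⟩ := block_decay hf hper hC (by linarith) (by linarith) hHC hDd hD1.le
  set β : ℝ := 2 + (1 / 2 - δ) - D with hβ
  have hβr : 2 * r₀ < β := by linarith
  obtain ⟨j, hj⟩ := exists_nat_gt (2 * (3 / 4 - r₀) / (β - 2 * r₀))
  set s : ℝ := r₀ + (3 / 4 - r₀) / (j + 2) with hs
  have hs0 : 0 < s := by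
    have : 0 < (3 / 4 - r₀) / ((j:ℝ) + 2) := div_pos (by linarith) (by positivity)
    linarith
  have hsβ : 2 * s < β := by
    rw [div_lt_iff₀ (by linarith)] at hj
    have : (3 / 4 - r₀) / ((j:ℝ) + 2) < (β - 2 * r₀) / 2 := by
      rw [div_lt_iff₀ (by positivity)]
      nlinarith
    linarith
  set h : ℕ → ℝ := fun n => (1 + (n : ℝ)) ^ (2 * s) * ‖fourierCoef (fun x => (f x : ℂ)) ((n : ℕ) : ℤ)‖ ^ 2 with hh
  have h0 : ∀ n, 0 ≤ h n := fun n => by positivity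
  have hsum : Summable fun k : ℕ => ∑ n ∈ Finset.Ico ((2:ℕ) ^ k) (2 ^ (k + 1)), h n := by
    refine Summable.of_norm_bounded_eventually_nat
      ((summable_pow_geom (e := 2 * s - β) (by linarith)).mul_left (4 ^ (2 * s) * K)) ?_
    filter_upwards [eventually_ge_atTop k₀] with k hk
    rw [Real.norm_of_nonneg (Finset.sum_nonneg fun n _ => h0 n)]
    have hp : (0:ℝ) < 2 ^ k := by positivity
    calc ∑ n ∈ Finset.Ico ((2:ℕ) ^ k) (2 ^ (k + 1)), h n 
        ≤ ∑ n ∈ Finset.Ico ((2:ℕ) ^ k) (2 ^ (k + 1)), (4 * (2:ℝ) ^ k) ^ (2 * s) * ‖fourierCoef (fun x => (f x : ℂ)) ((n : ℕ) : ℤ)‖ ^ 2 := by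
          refine Finset.sum_le_sum fun n hn => ?_
          have hn2 := (Finset.mem_Ico.1 hn).2
          have hn3 : (n:ℝ) ≤ 2 ^ (k + 1) := by exact_mod_cast hn2.le
          have h1 : (1:ℝ) ≤ 2 ^ k := one_le_pow₀ (by norm_num)
          simp only [hh]
          gcongr
          rw [pow_succ] at hn3
          linarith
      _ = (4 * (2:ℝ) ^ k) ^ (2 * s) * ∑ n ∈ Finset.Ico ((2:ℕ) ^ k) (2 ^ (k + 1)), ‖fourierCoef (fun x => (f x : ℂ)) ((n : ℕ) : ℤ)‖ ^ 2 := by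
          rw [Finset.mul_sum]
      _ ≤ (4 * (2:ℝ) ^ k) ^ (2 * s) * (K * (((2:ℝ) ^ k)⁻¹) ^ β) := by
          gcongr
          exact hb k hk
      _ = _ := by
          rw [Real.mul_rpow (by norm_num) hp.le, Real.inv_rpow hp.le, Real.rpow_sub hp (2 * s) β]
          ring
  obtain ⟨M, hM⟩ := blocks_bound h h0 hsum
  obtain ⟨N, hN⟩ := hun j M
  exact absurd (hM N) (not_le.2 hN)

lemma dim_upper {f : ℝ → ℝ}
    (hH : ∀ θ : ℝ, 0 < θ → θ < 1 / 2 → ∃ C : ℝ, 0 ≤ C ∧ ∀ x y, |f x - f y| ≤ C * |x - y| ^ θ) :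
    upperMinkowskiDim (graphOn f) ≤ 3 / 2 := by
  refine le_of_forall_pos_le_add fun δ hδ => ?_
  have h1 : 0 < min δ (1 / 4) := lt_min hδ (by norm_num)
  have h2 : min δ (1 / 4) ≤ 1 / 4 := min_le_right _ _
  have h3 : min δ (1 / 4) ≤ δ := min_le_left _ _
  obtain ⟨C, hC, h⟩ := hH (1 / 2 - min δ (1 / 4)) (by linarith) (by linarith)
  have := dim_le hC (by linarith) (by linarith) h
  linarith


/-- If `g : 𝕋 → ℂ` has bounded variation and `g ∉ H^{r₀+ε}` for every `ε > 0`, where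
`r₀ ∈ [1/2, 3/4)`, then for almost every `t` the graphs of the real and imaginary parts of
the continuous representative of `e^{it∂ₓₓ}g` have upper Minkowski dimension `D` with
`5/2 - 2r₀ ≤ D ≤ 3/2`. -/
theorem linear_schrodinger_fractal_dimension (g : ℝ → ℂ) (r₀ : ℝ)
    (hr₀ : r₀ ∈ Set.Ico (1 / 2 : ℝ) (3 / 4))
    (hper : Function.Periodic g (2 * Real.pi))
    (hbv : BoundedVariationOn g (Set.Icc 0 (2 * Real.pi)))
    (hns : ∀ ε : ℝ, 0 < ε → ¬ InSobolev g (r₀ + ε)) :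
    ∀ᵐ t : ℝ, ∃ u : ℝ → ℂ, Continuous u ∧ Function.Periodic u (2 * Real.pi) ∧
      (∀ n : ℤ, fourierCoef u n =
        Complex.exp (-Complex.I * (t : ℂ) * (n : ℂ) ^ 2) * fourierCoef g n) ∧
      (5 / 2 - 2 * r₀ ≤ upperMinkowskiDim (graphOn (fun x => (u x).re)) ∧
        upperMinkowskiDim (graphOn (fun x => (u x).re)) ≤ 3 / 2) ∧
      (5 / 2 - 2 * r₀ ≤ upperMinkowskiDim (graphOn (fun x => (u x).im)) ∧
        upperMinkowskiDim (graphOn (fun x => (u x).im)) ≤ 3 / 2) := by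
  obtain ⟨hr1, hr2⟩ := hr₀
  have hN : ∀ θ : ℂ, ‖θ‖ = 1 → ∀ᵐ t : ℝ, ∀ j : ℕ, ∀ u : ℝ → ℂ, Continuous u → (∀ n : ℤ, fourierCoef u n =
        Complex.exp (-Complex.I * (t : ℂ) * (n : ℂ) ^ 2) * fourierCoef g n) → 
      ∀ M : ℝ, ∃ N : ℕ, M < ∑ n ∈ Finset.range N, (1 + ((n + 1 : ℕ) : ℝ)) ^ (2 * (r₀ + (3 / 4 - r₀) / (j + 2))) *
        ‖fourierCoef (fun x => (((θ * u x).re : ℝ) : ℂ)) ((n + 1 : ℕ) : ℤ)‖ ^ 2 := by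
    intro θ hθ
    refine ae_all_iff.2 fun j => ?_
    have hj : 0 < (3 / 4 - r₀) / ((j:ℝ) + 2) := div_pos (by linarith) (by positivity)
    have hj2 : (3 / 4 - r₀) / ((j:ℝ) + 2) < 3 / 4 - r₀ :=
      div_lt_self (by linarith) (by linarith [Nat.cast_nonneg (α := ℝ) j])
    exact ae_nonsob hper hbv (by linarith) (by linarith) (hns _ hj) θ hθ
  filter_upwards [ae_weylGood, hN 1 (by simp), hN (-Complex.I) (by simp)] with t ht h1 h2
  obtain ⟨u, hu, hup, huc, huH⟩ := exists_u hper hbv ht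
  have hRe : ∀ θ : ℝ, 0 < θ → θ < 1 / 2 → ∃ C : ℝ, 0 ≤ C ∧ ∀ x y, |(u x).re - (u y).re| ≤ C * |x - y| ^ θ := by
    intro θ a b
    obtain ⟨C, hC, h⟩ := huH θ a b
    refine ⟨C, hC, fun x y => le_trans ?_ (h x y)⟩
    rw [← Complex.sub_re]; exact Complex.abs_re_le_norm _
  have hIm : ∀ θ : ℝ, 0 < θ → θ < 1 / 2 → ∃ C : ℝ, 0 ≤ C ∧ ∀ x y, |(u x).im - (u y).im| ≤ C * |x - y| ^ θ := by
    intro θ a b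
    obtain ⟨C, hC, h⟩ := huH θ a b
    refine ⟨C, hC, fun x y => le_trans ?_ (h x y)⟩
    rw [← Complex.sub_im]; exact Complex.abs_im_le_norm _
  refine ⟨u, hu, hup, huc, ⟨?_, dim_upper hRe⟩, ⟨?_, dim_upper hIm⟩⟩
  · refine dim_lower (f := fun x => (u x).re) (Complex.continuous_re.comp hu) (fun x => by simp only [hup x]) (by linarith) hr2 hRe fun j => ?_
    have := h1 j u hu huc
    simpa only [one_mul] using this
  · refine dim_lower (f := fun x => (u x).im) (Complex.continuous_im.comp hu) (fun x => by simp only [hup x]) (by linarith) hr2 hIm fun j => ?_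
    have := h2 j u hu huc
    have e : ∀ z : ℂ, (-Complex.I * z).re = z.im := by intro z; simp
    simpa only [e] using this
end

section
/- Let g: T → ℂ have bounded variation and set r₀ := sup{ s ∈ ℝ : g ∈ H^s(T) }; assume r₀ ∈ [1/2, 1). Then for almost every t ∈ ℝ the following holds: for every r > r₀, neither the real part nor the imaginary part of e^{it∂ₓₓ}g belongs to H^r(T). -/
open MeasureTheory Filter

lemma aux_orth (a : ℝ) (k : ℤ) (hk : k ≠ 0) :
    ∫ t in a..(a + 2 * Real.pi), Complex.exp (Complex.I * k * t) = 0 := by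
  have hc : (Complex.I * k : ℂ) ≠ 0 := mul_ne_zero Complex.I_ne_zero (by exact_mod_cast hk)
  rw [integral_exp_mul_complex hc]
  have : Complex.I * k * ((a + 2 * Real.pi : ℝ) : ℂ) = Complex.I * k * a + k * (2 * Real.pi * Complex.I) := by
    push_cast; ring
  rw [this, Complex.exp_add, Complex.exp_int_mul_two_pi_mul_I]
  simp

lemma aux_L2 (a : ℝ) (c : ℕ → ℂ) (N : ℕ) :
    ∫ t in a..(a + 2 * Real.pi),
      ‖∑ n ∈ Finset.range N, Complex.exp (-2 * Complex.I * t * n ^ 2) * c n‖ ^ 2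
      = 2 * Real.pi * ∑ n ∈ Finset.range N, ‖c n‖ ^ 2 := by
  have key : ∀ t : ℝ, ((‖∑ n ∈ Finset.range N, Complex.exp (-2 * Complex.I * t * n ^ 2) * c n‖ ^ 2 : ℝ) : ℂ)
      = ∑ n ∈ Finset.range N, ∑ m ∈ Finset.range N,
        (c n * (starRingEnd ℂ) (c m)) * Complex.exp (Complex.I * ((2 * ((m:ℤ)^2 - (n:ℤ)^2) : ℤ) : ℂ) * t) := by
    intro t
    push_cast
    rw [← Complex.mul_conj', map_sum, Finset.sum_mul_sum]
    refine Finset.sum_congr rfl fun n _ => Finset.sum_congr rfl fun m _ => ?_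
    rw [map_mul, ← Complex.exp_conj]
    have : Complex.exp (Complex.I * (2 * ((m:ℂ)^2 - (n:ℂ)^2)) * t) =
      Complex.exp (-2 * Complex.I * t * n ^ 2) * Complex.exp ((starRingEnd ℂ) (-2 * Complex.I * t * m ^ 2)) := by
      rw [← Complex.exp_add]
      congr 1
      have h2 : (starRingEnd ℂ) (2:ℂ) = 2 := Complex.conj_ofNat 2
      simp [h2]
      ring
    rw [this]; ring
  apply Complex.ofReal_injective
  rw [← intervalIntegral.integral_ofReal]
  simp_rw [key]
  rw [intervalIntegral.integral_finsetSum]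
  · have : ∀ n ∈ Finset.range N, (∫ t in a..(a + 2 * Real.pi), ∑ m ∈ Finset.range N,
        (c n * (starRingEnd ℂ) (c m)) * Complex.exp (Complex.I * ((2 * ((m:ℤ)^2 - (n:ℤ)^2) : ℤ) : ℂ) * t))
        = 2 * Real.pi * ‖c n‖ ^ 2 := by
      intro n hn
      rw [intervalIntegral.integral_finsetSum]
      · rw [Finset.sum_eq_single_of_mem n hn]
        · simp only [sub_self, mul_zero, Int.cast_zero, zero_mul, Complex.exp_zero, mul_one,
            intervalIntegral.integral_const, add_sub_cancel_left, Complex.real_smul, Complex.mul_conj']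
          push_cast; ring
        · intro m _ hmn
          rw [intervalIntegral.integral_const_mul, aux_orth, mul_zero]
          intro h
          have h2 : ((m:ℤ))^2 = (n:ℤ)^2 := by linarith
          apply hmn
          have h3 : m^2 = n^2 := by exact_mod_cast h2
          exact Nat.pow_left_injective (by norm_num) h3
      · intro m _
        apply Continuous.intervalIntegrable
        fun_prop
    rw [Finset.sum_congr rfl this, ← Finset.mul_sum]
    push_cast; rfl
  · intro m _
    apply Continuous.intervalIntegrable
    fun_prop

lemma aux_ae (d : ℕ → ℝ) (c : ℕ → ℂ) (hcd : ∀ n, ‖c n‖ ≤ d n) (hd : ¬ Summable d)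
    (hc : Summable fun n => ‖c n‖ ^ 2) :
    ∀ᵐ t : ℝ, ¬ Summable fun n : ℕ => d n + (Complex.exp (-2 * Complex.I * t * n ^ 2) * c n).re := by
  have hd0 : ∀ n, 0 ≤ d n := fun n => (norm_nonneg _).trans (hcd n)
  have hnn : ∀ (t : ℝ) (n : ℕ), 0 ≤ d n + (Complex.exp (-2 * Complex.I * t * n ^ 2) * c n).re := by
    intro t n
    have h1 : ‖Complex.exp (-2 * Complex.I * t * n ^ 2) * c n‖ ≤ d n := by
      rw [norm_mul, Complex.norm_exp]
      have : (-2 * Complex.I * (t:ℂ) * (n:ℂ) ^ 2).re = 0 := by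
        have : (-2 * Complex.I * (t:ℂ) * (n:ℂ) ^ 2) = ((-2 * t * n^2 : ℝ) : ℂ) * Complex.I := by push_cast; ring
        rw [this, Complex.re_ofReal_mul]; simp
      rw [this]; simpa using hcd n
    have h2 := Complex.abs_re_le_norm (Complex.exp (-2 * Complex.I * t * n ^ 2) * c n)
    have h3 := neg_abs_le (Complex.exp (-2 * Complex.I * t * n ^ 2) * c n).re
    linarith
  have hdt : Tendsto (fun N => ∑ n ∈ Finset.range N, d n) atTop atTop :=
    (not_summable_iff_tendsto_nat_atTop_of_nonneg hd0).1 hd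
  set K : ℝ := 2 * Real.pi * ∑' n, ‖c n‖ ^ 2 with hK
  have hK0 : 0 ≤ K := by
    have : 0 ≤ ∑' n, ‖c n‖ ^ 2 := tsum_nonneg (fun n => by positivity)
    have := Real.pi_pos
    positivity
  have main : ∀ (a : ℝ) (M : ℕ), volume.restrict (Set.Ioc a (a + 2 * Real.pi))
      {t : ℝ | ∀ N, ∑ n ∈ Finset.range N, (d n + (Complex.exp (-2 * Complex.I * t * n ^ 2) * c n).re) ≤ M} = 0 := by
    intro a M
    set μ := volume.restrict (Set.Ioc a (a + 2 * Real.pi))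
    set B := {t : ℝ | ∀ N, ∑ n ∈ Finset.range N, (d n + (Complex.exp (-2 * Complex.I * t * n ^ 2) * c n).re) ≤ M}
    by_contra hB
    have hp : 0 < μ.real B := by
      rw [measureReal_def]
      exact ENNReal.toReal_pos hB (measure_ne_top _ _)
    obtain ⟨N, hN⟩ := (hdt.eventually_ge_atTop (M + 1 + K / μ.real B)).exists
    set L := 1 + K / μ.real B
    have hL : 1 ≤ L := by
      have : 0 ≤ K / μ.real B := by positivity
      simp only [L]; linarith
    have hcheb := mul_meas_ge_le_integral_of_nonneg (μ := μ)
      (f := fun t : ℝ => ‖∑ n ∈ Finset.range N, Complex.exp (-2 * Complex.I * t * n ^ 2) * c n‖ ^ 2)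
      (Eventually.of_forall fun t => by positivity)
      (by
        apply Continuous.integrableOn_Ioc
        fun_prop) (L^2)
    have hint : ∫ t, ‖∑ n ∈ Finset.range N, Complex.exp (-2 * Complex.I * t * n ^ 2) * c n‖ ^ 2 ∂μ ≤ K := by
      have := aux_L2 a c N
      rw [intervalIntegral.integral_of_le (by linarith [Real.pi_pos])] at this
      rw [this, hK]
      have := Real.pi_pos
      gcongr
      exact hc.sum_le_tsum _ (fun i _ => by positivity)
    have hsub : B ⊆ {t : ℝ | L^2 ≤ ‖∑ n ∈ Finset.range N, Complex.exp (-2 * Complex.I * t * n ^ 2) * c n‖ ^ 2} := by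
      intro t ht
      have h1 := ht N
      rw [Finset.sum_add_distrib, ← Complex.re_sum] at h1
      have h2 := Complex.abs_re_le_norm (∑ n ∈ Finset.range N, Complex.exp (-2 * Complex.I * t * n ^ 2) * c n)
      have h3 := neg_abs_le (∑ n ∈ Finset.range N, Complex.exp (-2 * Complex.I * t * n ^ 2) * c n).re
      simp only [Set.mem_ofPred_eq]
      apply pow_le_pow_left₀ (by linarith)
      simp only [L]
      linarith
    have h4 : μ.real B ≤ μ.real {t : ℝ | L^2 ≤ ‖∑ n ∈ Finset.range N, Complex.exp (-2 * Complex.I * t * n ^ 2) * c n‖ ^ 2} :=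
      measureReal_mono hsub
    have h5 : L^2 * μ.real B ≤ K := le_trans (by gcongr) (hcheb.trans hint)
    have h6 : L * μ.real B = μ.real B + K := by simp only [L]; field_simp
    nlinarith
  rw [ae_iff]
  simp only [not_not]
  refine measure_null_of_locally_null _ fun x _ => ?_
  refine ⟨{t : ℝ | Summable fun n : ℕ => d n + (Complex.exp (-2 * Complex.I * t * n ^ 2) * c n).re} ∩
    Set.Ioc (x - Real.pi) (x - Real.pi + 2 * Real.pi), ?_, ?_⟩
  · apply inter_mem self_mem_nhdsWithin
    apply mem_nhdsWithin_of_mem_nhds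
    apply Ioc_mem_nhds <;> linarith [Real.pi_pos]
  · rw [← Measure.restrict_apply' measurableSet_Ioc]
    refine measure_mono_null ?_ (measure_iUnion_null (main (x - Real.pi)))
    intro t ht
    obtain ⟨M, hM⟩ := exists_nat_ge (∑' n : ℕ, (d n + (Complex.exp (-2 * Complex.I * t * n ^ 2) * c n).re))
    simp only [Set.mem_iUnion]
    exact ⟨M, fun N => (Summable.sum_le_tsum _ (fun i _ => hnn t i) ht).trans hM⟩

lemma aux_exp_norm (n : ℤ) (x : ℝ) : ‖Complex.exp (-Complex.I * (n : ℂ) * (x : ℂ))‖ = 1 := by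
  have : (-Complex.I * (n : ℂ) * (x : ℂ)) = ((-(n * x) : ℝ) : ℂ) * Complex.I := by push_cast; ring
  rw [this, Complex.norm_exp_ofReal_mul_I]

lemma aux_bv (g : ℝ → ℂ) (hbv : BoundedVariationOn g (Set.Icc 0 (2 * Real.pi))) :
    ∃ K : ℝ, 0 ≤ K ∧ ∀ n : ℤ, n ≠ 0 → ‖fourierCoef g n‖ ≤ K / |(n:ℝ)| := by
  have hpi := Real.pi_pos
  set S := Set.Icc 0 (2 * Real.pi)
  have h0S : (0:ℝ) ∈ S := ⟨le_rfl, by positivity⟩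
  set v := variationOnFromTo g S 0
  have hlbv : LocallyBoundedVariationOn g S := hbv.locallyBoundedVariationOn
  have hv : ∀ x ∈ S, ∀ y ∈ S, x ≤ y → ‖g y - g x‖ ≤ v y - v x := by
    intro x hx y hy hxy
    have h1 : v x + variationOnFromTo g S x y = v y := variationOnFromTo.add hlbv h0S hx hy
    have h2 : variationOnFromTo g S x y = (eVariationOn g (S ∩ Set.Icc x y)).toReal :=
      variationOnFromTo.eq_of_le g S hxy
    have h3 : edist (g y) (g x) ≤ eVariationOn g (S ∩ Set.Icc x y) :=
      eVariationOn.edist_le g ⟨hy, hxy, le_rfl⟩ ⟨hx, le_rfl, hxy⟩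
    have h4 := ENNReal.toReal_mono (hlbv x y hx hy) h3
    rw [edist_dist, ENNReal.toReal_ofReal dist_nonneg, dist_eq_norm] at h4
    linarith
  have hv2 : ∀ x ∈ S, ∀ y ∈ S, x ≤ y → v x ≤ v y := fun x hx y hy hxy => by
    have := (norm_nonneg _).trans (hv x hx y hy hxy); linarith
  have htop : 2 * Real.pi ∈ S := ⟨by positivity, le_rfl⟩
  have hV0 : 0 ≤ v (2 * Real.pi) - v 0 := (norm_nonneg _).trans (hv 0 h0S _ htop (by positivity))
  refine ⟨v (2 * Real.pi) - v 0, hV0, fun n hn => ?_⟩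
  set f : ℝ → ℂ := fun x => Complex.exp (-Complex.I * (n : ℂ) * (x : ℂ)) * g x with hf
  by_cases hi : IntervalIntegrable f volume 0 (2 * Real.pi)
  swap
  · rw [fourierCoef, intervalIntegral.integral_undef hi]
    simp only [mul_zero, norm_zero]; positivity
  obtain ⟨N, hN⟩ : ∃ N : ℕ, (N:ℤ) = |n| := ⟨n.natAbs, by simp⟩
  have hNr : (N:ℝ) = |(n:ℝ)| := by exact_mod_cast congrArg (Int.cast (R := ℝ)) hN
  have hNpos : (0:ℝ) < N := by rw [hNr]; positivity
  set h := 2 * Real.pi / N with hh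
  have hhpos : 0 < h := by positivity
  have hhN : N * h = 2 * Real.pi := by rw [hh]; field_simp
  have hmem : ∀ k : ℕ, k ≤ N → (k:ℝ) * h ∈ S := by
    intro k hk
    refine ⟨by positivity, ?_⟩
    rw [← hhN]; gcongr
  have hsub : ∀ k < N, IntervalIntegrable f volume ((k:ℕ) * h) ((k + 1 : ℕ) * h) := by
    intro k hk
    apply hi.mono_set
    have hle : (k:ℝ) * h ≤ ((k + 1 : ℕ):ℝ) * h := by gcongr; simp
    have hle2 : 0 ≤ 2 * Real.pi := by positivity
    rw [Set.uIcc_of_le hle, Set.uIcc_of_le hle2]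
    exact Set.Icc_subset_Icc (hmem k hk.le).1 (hmem (k+1) hk).2
  have hzero : ∀ k : ℕ, ∫ x in ((k:ℕ) * h)..((k + 1 : ℕ) * h), Complex.exp (-Complex.I * (n : ℂ) * (x : ℂ)) = 0 := by
    intro k
    have hc : (-Complex.I * n : ℂ) ≠ 0 :=
      mul_ne_zero (neg_ne_zero.2 Complex.I_ne_zero) (by exact_mod_cast hn)
    rw [integral_exp_mul_complex hc]
    have hstep : ∃ j : ℤ, (n:ℝ) * h = j * (2 * Real.pi) := by
      rcases abs_choice (n:ℝ) with h1 | h1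
      · exact ⟨1, by rw [← hhN, hNr, h1]; simp⟩
      · exact ⟨-1, by rw [← hhN, hNr, h1]; simp⟩
    obtain ⟨j, hj⟩ := hstep
    have hj' : (n:ℂ) * h = j * (2 * Real.pi) := by exact_mod_cast congrArg (Complex.ofReal) hj
    have : -Complex.I * n * (((k + 1 : ℕ) * h : ℝ) : ℂ) = -Complex.I * n * ((k * h : ℝ) : ℂ) + ((-j : ℤ):ℂ) * (2 * Real.pi * Complex.I) := by
      push_cast; linear_combination (-Complex.I) * hj'
    rw [this, Complex.exp_add, Complex.exp_int_mul_two_pi_mul_I]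
    simp
  have hpiece : ∀ k < N, ‖∫ x in ((k:ℕ) * h)..((k + 1 : ℕ) * h), f x‖ ≤
      (v ((k+1 : ℕ) * h) - v ((k:ℕ) * h)) * h := by
    intro k hk
    have hle : (k:ℝ) * h ≤ ((k + 1 : ℕ):ℝ) * h := by gcongr; simp
    have e1 : ∫ x in ((k:ℕ) * h)..((k + 1 : ℕ) * h), f x =
        ∫ x in ((k:ℕ) * h)..((k + 1 : ℕ) * h), (f x - Complex.exp (-Complex.I * (n : ℂ) * (x : ℂ)) * g (k * h)) := by
      rw [intervalIntegral.integral_sub (hsub k hk), intervalIntegral.integral_mul_const, hzero]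
      · simp
      · apply Continuous.intervalIntegrable; fun_prop
    rw [e1]
    refine (intervalIntegral.norm_integral_le_of_norm_le_const
      (C := v ((k+1 : ℕ) * h) - v ((k:ℕ) * h)) ?_).trans ?_
    · intro x hx
      rw [Set.uIoc_of_le hle] at hx
      have hk1 := hmem k hk.le
      have hk2 := hmem (k+1) hk
      have hxS : x ∈ S := ⟨hk1.1.trans hx.1.le, hx.2.trans hk2.2⟩
      rw [hf]
      simp only
      rw [← mul_sub, norm_mul, aux_exp_norm, one_mul]
      have := hv _ hk1 x hxS hx.1.le
      have := hv2 x hxS _ hk2 hx.2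
      linarith
    · rw [abs_of_nonneg (by linarith)]
      apply le_of_eq
      push_cast; ring
  have hsum := intervalIntegral.sum_integral_adjacent_intervals (f := f) (μ := volume) (a := fun k : ℕ => (k:ℝ) * h) (n := N) hsub
  simp only [Nat.cast_zero, zero_mul, hhN] at hsum
  have htot : ‖∫ x in (0:ℝ)..(2 * Real.pi), f x‖ ≤ (v (2 * Real.pi) - v 0) * h := by
    rw [← hsum]
    refine (norm_sum_le _ _).trans ((Finset.sum_le_sum fun k hk => hpiece k (Finset.mem_range.1 hk)).trans ?_)
    rw [← Finset.sum_mul, Finset.sum_range_sub (fun k : ℕ => v ((k:ℝ) * h))]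
    simp [hhN]
  rw [fourierCoef, norm_mul]
  have hn1 : ‖(1 / (2 * Real.pi) : ℂ)‖ = 1 / (2 * Real.pi) := by
    have : (1 / (2 * Real.pi) : ℂ) = ((1 / (2 * Real.pi) : ℝ) : ℂ) := by push_cast; rfl
    rw [this, Complex.norm_real, Real.norm_of_nonneg (by positivity)]
  rw [hn1, ← hNr]
  calc _ ≤ 1 / (2 * Real.pi) * ((v (2 * Real.pi) - v 0) * h) := by gcongr
    _ = _ := by rw [hh]; field_simp

lemma aux_rpow (x : ℝ) (hx : 1 ≤ x) (r s : ℝ) (h : r ≤ s) : x ^ (2 * r) ≤ x ^ (2 * s) :=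
  Real.rpow_le_rpow_of_exponent_le hx (by linarith)

lemma aux_mono (u : ℤ → ℝ) (hu : ∀ n, 0 ≤ u n) (r s : ℝ) (h : r ≤ s)
    (hs : Summable fun n : ℤ => (1 + |(n:ℝ)|) ^ (2 * s) * u n) :
    Summable fun n : ℤ => (1 + |(n:ℝ)|) ^ (2 * r) * u n := by
  refine Summable.of_nonneg_of_le (fun n => ?_) (fun n => ?_) hs
  · exact mul_nonneg (by positivity) (hu n)
  · exact mul_le_mul_of_nonneg_right (aux_rpow _ (by linarith [abs_nonneg (n:ℝ)]) r s h) (hu n)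

lemma aux_sq (t : ℝ) (n : ℤ) (a b : ℂ) (σ : ℝ) (hσ : σ ^ 2 = 1) :
    ‖Complex.exp (-Complex.I * (t : ℂ) * (n : ℂ) ^ 2) * a + σ *
            (starRingEnd ℂ) (Complex.exp (-Complex.I * (t : ℂ) * (n : ℂ) ^ 2) * b)‖ ^ 2
      = (‖a‖ ^ 2 + ‖b‖ ^ 2) + (Complex.exp (-2 * Complex.I * t * n ^ 2) * (2 * σ * a * b)).re := by
  have he : Complex.exp (-2 * Complex.I * t * n ^ 2) =
      Complex.exp (-Complex.I * (t : ℂ) * (n : ℂ) ^ 2) * Complex.exp (-Complex.I * (t : ℂ) * (n : ℂ) ^ 2) := by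
    rw [← Complex.exp_add]; congr 1; ring
  have hn : ‖Complex.exp (-Complex.I * (t : ℂ) * (n : ℂ) ^ 2)‖ = 1 := by
    have : (-Complex.I * (t : ℂ) * (n : ℂ) ^ 2) = ((-(t * n ^ 2) : ℝ) : ℂ) * Complex.I := by push_cast; ring
    rw [this, Complex.norm_exp_ofReal_mul_I]
  rw [he]
  generalize Complex.exp (-Complex.I * (t : ℂ) * (n : ℂ) ^ 2) = e at hn
  have h1 : ‖e * a‖ ^ 2 = ‖a‖ ^ 2 := by rw [norm_mul, hn, one_mul]
  have h2 : ‖e * b‖ ^ 2 = ‖b‖ ^ 2 := by rw [norm_mul, hn, one_mul]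
  have h3 : e * e * (2 * σ * a * b) = 2 * σ * ((e * a) * (e * b)) := by ring
  rw [← h1, ← h2, h3]
  generalize e * a = X
  generalize e * b = Y
  simp only [← Complex.normSq_eq_norm_sq, Complex.normSq_apply]
  simp
  linear_combination (Y.re * Y.re + Y.im * Y.im) * hσ

lemma aux_main (g : ℝ → ℂ) (r₀ : ℝ)
    (hbv : BoundedVariationOn g (Set.Icc 0 (2 * Real.pi)))
    (hsup : IsLUB {s : ℝ | InSobolev g s} r₀) (σ : ℝ) (hσ : σ ^ 2 = 1)
    (r : ℝ) (hr : r₀ < r) (hr2 : 2 * r - 1 < r₀) :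
    ∀ᵐ t : ℝ, ¬ Summable (fun n : ℤ => (1 + |(n : ℝ)|) ^ (2 * r) *
        ‖Complex.exp (-Complex.I * (t : ℂ) * (n : ℂ) ^ 2) * fourierCoef g n + σ *
            (starRingEnd ℂ) (Complex.exp (-Complex.I * (t : ℂ) * (n : ℂ) ^ 2) *
              fourierCoef g (-n))‖ ^ 2) := by
  obtain ⟨K, hK0, hK⟩ := aux_bv g hbv
  set D : ℕ → ℝ := fun n => ‖fourierCoef g (n:ℤ)‖ ^ 2 + ‖fourierCoef g (-(n:ℤ))‖ ^ 2 with hD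
  have hD0 : ∀ n, 0 ≤ D n := fun n => by simp only [hD]; positivity
  set d : ℕ → ℝ := fun n => (1 + (n:ℝ)) ^ (2 * r) * D n with hd
  set c : ℕ → ℂ := fun n => (((1 + (n:ℝ)) ^ (2 * r) : ℝ) : ℂ) *
    (2 * σ * fourierCoef g (n:ℤ) * fourierCoef g (-(n:ℤ))) with hc
  have hσ1 : |σ| = 1 := by
    have h := sq_abs σ
    nlinarith [abs_nonneg σ]
  have hcd : ∀ n, ‖c n‖ ≤ d n := by
    intro n
    simp only [hc, hd, hD]
    rw [norm_mul, Complex.norm_real, Real.norm_of_nonneg (by positivity)]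
    gcongr
    simp only [norm_mul, Complex.norm_real, Real.norm_eq_abs, hσ1, Complex.norm_ofNat]
    nlinarith [sq_nonneg (‖fourierCoef g (n:ℤ)‖ - ‖fourierCoef g (-(n:ℤ))‖)]
  have hdns : ¬ Summable d := by
    intro hs
    have : r ∈ {s : ℝ | InSobolev g s} := by
      refine Summable.of_nat_of_neg ?_ ?_
      · refine Summable.of_nonneg_of_le (fun n => by positivity) (fun n => ?_) hs
        simp only [hd, hD, Int.cast_natCast, Nat.abs_cast]
        gcongr
        simp
      · refine Summable.of_nonneg_of_le (fun n => by positivity) (fun n => ?_) hs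
        simp only [hd, hD, Int.cast_neg, abs_neg, Int.cast_natCast, Nat.abs_cast]
        gcongr
        simp
    exact absurd (hsup.1 this) (not_le.2 hr)
  have hcs : Summable fun n => ‖c n‖ ^ 2 := by
    obtain ⟨s, hs, hlt⟩ := (lt_isLUB_iff hsup).1 hr2
    have hs1 : InSobolev g (2 * r - 1) := aux_mono _ (fun n => by positivity) _ _ hlt.le hs
    have e1 : Summable fun n : ℕ => (1 + (n:ℝ)) ^ (2 * (2 * r - 1)) * D n := by
      have p1 := (hs1.comp_injective (Nat.cast_injective (R := ℤ)))
      have p2 := (hs1.comp_injective ((neg_injective (G := ℤ)).comp (Nat.cast_injective (R := ℤ))))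
      refine (p1.add p2).congr fun n => ?_
      simp only [Function.comp, hD, Int.cast_neg, abs_neg, Int.cast_natCast, Nat.abs_cast]
      ring
    rw [← summable_nat_add_iff 1] at e1 ⊢
    refine Summable.of_nonneg_of_le (fun n => by positivity) (fun n => ?_) (e1.mul_left (8 * K ^ 2))
    have hD1 : D (n+1) ≤ 8 * K ^ 2 / (1 + ((n + 1 : ℕ):ℝ)) ^ 2 := by
      have q1 := hK ((n+1 : ℕ):ℤ) (by positivity)
      have q2 := hK (-((n+1 : ℕ):ℤ)) (by simp; omega)
      simp only [Int.cast_neg, abs_neg, Int.cast_natCast, Nat.abs_cast] at q1 q2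
      have q3 : K / ((n+1:ℕ):ℝ) ≤ 2 * K / (1 + ((n + 1 : ℕ):ℝ)) := by
        rw [div_le_div_iff₀ (by positivity) (by positivity)]
        push_cast
        nlinarith [(Nat.cast_nonneg n : (0:ℝ) ≤ n), mul_nonneg hK0 (Nat.cast_nonneg n : (0:ℝ) ≤ n)]
      have q4 := pow_le_pow_left₀ (norm_nonneg _) (q1.trans q3) 2
      have q5 := pow_le_pow_left₀ (norm_nonneg _) (q2.trans q3) 2
      rw [div_pow] at q4 q5
      simp only [hD]
      calc _ ≤ _ := add_le_add q4 q5
        _ = _ := by ring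
    have hx : (0:ℝ) < 1 + ((n + 1 : ℕ):ℝ) := by positivity
    calc ‖c (n+1)‖ ^ 2 ≤ d (n+1) ^ 2 := pow_le_pow_left₀ (norm_nonneg _) (hcd _) 2
      _ = ((1 + ((n + 1 : ℕ):ℝ)) ^ (2 * r)) ^ 2 * D (n+1) * D (n+1) := by simp only [hd]; ring
      _ ≤ ((1 + ((n + 1 : ℕ):ℝ)) ^ (2 * r)) ^ 2 * D (n+1) * (8 * K ^ 2 / (1 + ((n + 1 : ℕ):ℝ)) ^ 2) := by
        have := hD0 (n+1)
        gcongr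
      _ = _ := by
        have : (1 + ((n + 1 : ℕ):ℝ)) ^ (2 * (2 * r - 1)) =
            ((1 + ((n + 1 : ℕ):ℝ)) ^ (2 * r)) ^ 2 / (1 + ((n + 1 : ℕ):ℝ)) ^ 2 := by
          rw [← Real.rpow_natCast, ← Real.rpow_natCast, ← Real.rpow_mul hx.le, ← Real.rpow_sub hx]
          congr 1; push_cast; ring
        rw [this]; ring
  filter_upwards [aux_ae d c hcd hdns hcs] with t ht hs
  apply ht
  refine (hs.comp_injective (Nat.cast_injective (R := ℤ))).congr fun n => ?_
  simp only [Function.comp]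
  rw [aux_sq _ _ _ _ _ hσ]
  simp only [hd, hD, hc, Int.cast_natCast, Nat.abs_cast]
  rw [mul_left_comm (Complex.exp _) (((1 + (n:ℝ)) ^ (2 * r) : ℝ) : ℂ), Complex.re_ofReal_mul]
  ring

/-- Let `g : 𝕋 → ℂ` have bounded variation and `r₀ = sup{s : g ∈ H^s} ∈ [1/2, 1)`.
Then for a.e. `t`, for every `r > r₀`, neither the real nor the imaginary part of
`e^{it∂ₓₓ}g` belongs to `H^r(𝕋)`.  The Fourier coefficients of the real and imaginary
parts of `u = e^{it∂ₓₓ}g`, whose coefficients are `û(n) = e^{-itn²}ĝ(n)`, are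
`(û(n) + conj û(-n))/2` and `(û(n) - conj û(-n))/(2i)` respectively. -/
theorem real_imag_not_sobolev (g : ℝ → ℂ) (r₀ : ℝ)
    (hper : Function.Periodic g (2 * Real.pi))
    (hbv : BoundedVariationOn g (Set.Icc 0 (2 * Real.pi)))
    (hr₀ : r₀ ∈ Set.Ico (1 / 2 : ℝ) 1)
    (hsup : IsLUB {s : ℝ | InSobolev g s} r₀) :
    ∀ᵐ t : ℝ, ∀ r : ℝ, r₀ < r →
      (¬ Summable (fun n : ℤ => (1 + |(n : ℝ)|) ^ (2 * r) *
        ‖(Complex.exp (-Complex.I * (t : ℂ) * (n : ℂ) ^ 2) * fourierCoef g n +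
            (starRingEnd ℂ) (Complex.exp (-Complex.I * (t : ℂ) * (n : ℂ) ^ 2) *
              fourierCoef g (-n))) / 2‖ ^ 2)) ∧
      ¬ Summable (fun n : ℤ => (1 + |(n : ℝ)|) ^ (2 * r) *
        ‖(Complex.exp (-Complex.I * (t : ℂ) * (n : ℂ) ^ 2) * fourierCoef g n -
            (starRingEnd ℂ) (Complex.exp (-Complex.I * (t : ℂ) * (n : ℂ) ^ 2) *
              fourierCoef g (-n))) / (2 * Complex.I)‖ ^ 2) := by
  have hpos : 0 < 1 - r₀ := by linarith [hr₀.2]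
  set ρ : ℕ → ℝ := fun k => r₀ + (1 - r₀) / (k + 3) with hρ
  have hρ1 : ∀ k, r₀ < ρ k := fun k => by
    have : 0 < (1 - r₀) / ((k:ℝ) + 3) := by positivity
    simp only [hρ]; linarith
  have hρ2 : ∀ k, 2 * ρ k - 1 < r₀ := fun k => by
    have : (1 - r₀) / ((k:ℝ) + 3) < (1 - r₀) / 2 := by
      apply div_lt_div_of_pos_left hpos (by norm_num)
      linarith [(Nat.cast_nonneg k : (0:ℝ) ≤ k)]
    simp only [hρ]; linarith
  have h1 := ae_all_iff.2 fun k => aux_main g r₀ hbv hsup 1 (by norm_num) (ρ k) (hρ1 k) (hρ2 k)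
  have h2 := ae_all_iff.2 fun k => aux_main g r₀ hbv hsup (-1) (by norm_num) (ρ k) (hρ1 k) (hρ2 k)
  filter_upwards [h1, h2] with t ht1 ht2 r hr
  obtain ⟨k, hk⟩ : ∃ k, ρ k ≤ r := by
    obtain ⟨k, hk⟩ := exists_nat_ge ((1 - r₀) / (r - r₀))
    refine ⟨k, ?_⟩
    have hrr : 0 < r - r₀ := by linarith
    have : (1 - r₀) / ((k:ℝ) + 3) ≤ r - r₀ := by
      rw [div_le_iff₀ hrr] at hk
      rw [div_le_iff₀ (by positivity)]
      nlinarith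
    simp only [hρ]; linarith
  constructor
  · intro hs
    apply ht1 k
    refine ((aux_mono _ (fun n => by positivity) _ _ hk hs).mul_left 4).congr fun n => ?_
    rw [norm_div, div_pow]
    simp only [Complex.norm_ofNat, Complex.ofReal_one, one_mul]
    ring
  · intro hs
    apply ht2 k
    refine ((aux_mono _ (fun n => by positivity) _ _ hk hs).mul_left 4).congr fun n => ?_
    rw [norm_div, div_pow]
    simp only [norm_mul, Complex.norm_I, Complex.norm_ofNat, Complex.ofReal_neg, Complex.ofReal_one,
      neg_mul, one_mul, ← sub_eq_add_neg]
    ring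
end

section
/- Let g be a nonconstant complex-valued step function on T, i.e. g = Σ_{ℓ=1}^{L} c_ℓ χ_{[a_ℓ, b_ℓ)} with 0 ≤ a₁ < b₁ ≤ a₂ < b₂ ≤ ⋯ < b_L ≤ 2π, where all the endpoints a_ℓ, b_ℓ are rational multiples of π. Then for every t ∈ ℝ such that t/(2π) is irrational, the function |e^{it∂ₓₓ}g|² does not belong to H^{1/2}(T). -/
open MeasureTheory Finset

lemma fourierCoef_eq_on (f : ℝ → ℂ) (n : ℤ) [Fact (0 < 2 * Real.pi)] :
    fourierCoeff (AddCircle.liftIoc (2 * Real.pi) 0 f) n = fourierCoef f n := by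
  rw [fourierCoeff_eq_intervalIntegral _ _ 0, fourierCoef, zero_add, Complex.real_smul]
  have hpi := Real.pi_pos
  congr 1
  · push_cast; rfl
  · refine intervalIntegral.integral_congr_ae (ae_of_all _ fun x hx => ?_)
    rw [Set.uIoc_of_le (by positivity)] at hx
    rw [AddCircle.liftIoc_coe_apply (by simpa using hx), fourier_coe_apply, smul_eq_mul]
    congr 2
    have : (Real.pi : ℂ) ≠ 0 := by exact_mod_cast hpi.ne'
    push_cast
    field_simp

lemma parseval (f₁ f₂ : ℝ → ℂ)
    (h₁ : MemLp f₁ 2 (volume.restrict (Set.Ioc 0 (2 * Real.pi))))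
    (h₂ : MemLp f₂ 2 (volume.restrict (Set.Ioc 0 (2 * Real.pi)))) :
    HasSum (fun n : ℤ => fourierCoef f₁ n * (starRingEnd ℂ) (fourierCoef f₂ n))
      ((1 / (2 * Real.pi)) * ∫ x in (0 : ℝ)..(2 * Real.pi), f₁ x * (starRingEnd ℂ) (f₂ x)) := by
  have : Fact (0 < 2 * Real.pi) := ⟨by positivity⟩
  have e : (2 * Real.pi) = 0 + 2 * Real.pi := by ring
  rw [show Set.Ioc 0 (2 * Real.pi) = Set.Ioc 0 (0 + 2 * Real.pi) by rw [zero_add]] at h₁ h₂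
  have k₁ := h₁.memLp_liftIoc.haarAddCircle
  have k₂ := h₂.memLp_liftIoc.haarAddCircle
  have H := (fourierBasis (T := 2 * Real.pi)).hasSum_inner_mul_inner k₂.toLp k₁.toLp
  convert! H using 1
  · funext n
    have r₁ : inner ℂ (fourierBasis (T := 2 * Real.pi) n) k₁.toLp = fourierCoef f₁ n := by
      have := fourierBasis_repr k₁.toLp n
      rw [HilbertBasis.repr_apply_apply, fourierCoeff_congr_ae k₁.coeFn_toLp,
        fourierCoef_eq_on] at this
      exact this
    have r₂ : inner ℂ (fourierBasis (T := 2 * Real.pi) n) k₂.toLp = fourierCoef f₂ n := by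
      have := fourierBasis_repr k₂.toLp n
      rw [HilbertBasis.repr_apply_apply, fourierCoeff_congr_ae k₂.coeFn_toLp,
        fourierCoef_eq_on] at this
      exact this
    have r₃ : inner ℂ k₂.toLp (fourierBasis (T := 2 * Real.pi) n)
        = (starRingEnd ℂ) (fourierCoef f₂ n) := by
      rw [← r₂]; exact (inner_conj_symm _ _).symm
    rw [r₁, r₃, mul_comm]
  · rw [L2.inner_def]
    have : ∫ a, inner ℂ ((MemLp.toLp _ k₂) a) ((MemLp.toLp _ k₁) a) ∂AddCircle.haarAddCircle
       = ∫ a, AddCircle.liftIoc (2 * Real.pi) 0 (fun x => f₁ x * (starRingEnd ℂ) (f₂ x)) a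
          ∂AddCircle.haarAddCircle := by
      apply integral_congr_ae
      filter_upwards [k₁.coeFn_toLp, k₂.coeFn_toLp] with x hx hy
      rw [hx, hy, RCLike.inner_apply]
      rfl
    rw [this, AddCircle.integral_haarAddCircle, AddCircle.integral_liftIoc_eq_intervalIntegral, zero_add,
      Complex.real_smul]
    congr 1
    push_cast
    simp

lemma exists_rot (α h : ℝ) (hh : 0 < h) (hh2 : h ≤ 2 * Real.pi)
    (hα : Irrational (α / (2 * Real.pi))) :
    ∃ r l : ℤ, r ≠ 0 ∧ 0 < r * α - l * (2 * Real.pi) ∧ r * α - l * (2 * Real.pi) < h := by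
  have hd := dense_addSubgroupClosure_pair_iff.mpr hα
  obtain ⟨y, hy, hmem⟩ := hd.exists_mem_open (isOpen_Ioo (a := 0) (b := h)) ⟨h/2, by constructor <;> linarith⟩
  rw [SetLike.mem_coe, AddSubgroup.mem_closure_pair] at hy
  obtain ⟨r, l, rfl⟩ := hy
  simp only [zsmul_eq_mul, Set.mem_Ioo] at hmem
  refine ⟨r, -l, ?_, by push_cast; linarith [hmem.1], by push_cast; linarith [hmem.2]⟩
  rintro rfl
  simp only [Int.cast_zero, zero_mul, zero_add] at hmem
  have hp := Real.pi_pos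
  have h1 : 0 < (l : ℝ) := by
    by_contra hc
    nlinarith [hmem.1]
  have h2 : (1 : ℝ) ≤ l := by exact_mod_cast h1
  nlinarith [hmem.2]

lemma second_diff (β : ℂ) (x : ℂ) (hβ : β.im = 0) (hx : x.im = 0) :
    ‖Complex.exp (-Complex.I * (2 * β)) - 1‖ ^ 2 ≤ 6 *
    (‖Complex.exp (-Complex.I * (β * x ^ 2)) - 1‖ ^ 2
      + ‖Complex.exp (-Complex.I * (β * (x + 1) ^ 2)) - 1‖ ^ 2
      + ‖Complex.exp (-Complex.I * (β * (x + 2) ^ 2)) - 1‖ ^ 2) := by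
  set z0 := Complex.exp (-Complex.I * (β * x ^ 2)) with hz0
  set z1 := Complex.exp (-Complex.I * (β * (x + 1) ^ 2)) with hz1
  set z2 := Complex.exp (-Complex.I * (β * (x + 2) ^ 2)) with hz2
  set w := Complex.exp (-Complex.I * (2 * β)) with hw
  obtain ⟨b, rfl⟩ : ∃ b : ℝ, β = b := ⟨β.re, Complex.ext rfl (by simp [hβ])⟩
  obtain ⟨y, rfl⟩ : ∃ b : ℝ, x = b := ⟨x.re, Complex.ext rfl (by simp [hx])⟩
  have n1 : ∀ s : ℝ, ‖Complex.exp (-Complex.I * s)‖ = 1 := by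
    intro s
    rw [show -Complex.I * (s : ℂ) = ((-s : ℝ) : ℂ) * Complex.I by push_cast; ring]
    exact Complex.norm_exp_ofReal_mul_I _
  have e0 : ‖z0‖ = 1 := by rw [hz0]; convert n1 (b * y ^ 2) using 3; push_cast; ring
  have e1 : ‖z1‖ = 1 := by rw [hz1]; convert n1 (b * (y + 1) ^ 2) using 3; push_cast; ring
  have key : z0 * z2 = w * z1 ^ 2 := by
    rw [hz0, hz1, hz2, hw, ← Complex.exp_add, ← Complex.exp_nat_mul, ← Complex.exp_add]
    congr 1; push_cast; ring
  have h1 : ‖w - 1‖ ≤ ‖z0 - 1‖ + ‖z2 - 1‖ + 2 * ‖z1 - 1‖ := by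
    calc ‖w - 1‖ = ‖(w - 1) * z1 ^ 2‖ := by rw [norm_mul, norm_pow, e1]; simp
      _ = ‖(z0 - 1) + z0 * (z2 - 1) - ((z1 - 1) + z1 * (z1 - 1))‖ := by
          congr 1; linear_combination -key
      _ ≤ ‖z0 - 1‖ + ‖z0 * (z2 - 1)‖ + (‖z1 - 1‖ + ‖z1 * (z1 - 1)‖) :=
          (norm_sub_le _ _).trans (add_le_add (norm_add_le _ _) (norm_add_le _ _))
      _ = _ := by rw [norm_mul, norm_mul, e0, e1]; ring
  have := norm_nonneg (w - 1)
  nlinarith [sq_nonneg (‖z0 - 1‖ - ‖z2 - 1‖), sq_nonneg (2 * ‖z0 - 1‖ - ‖z1 - 1‖),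
    sq_nonneg (2 * ‖z2 - 1‖ - ‖z1 - 1‖), norm_nonneg (z0 - 1), norm_nonneg (z1 - 1), norm_nonneg (z2 - 1)]

/-- divergence of the final series -/
lemma not_summable_final (f : ℤ → ℝ) (hf : ∀ k, 0 ≤ f k) (t ε C : ℝ) (hC : 0 < C) (hε : 0 < ε)
    (hε2 : ε ≤ 1) (K : ℤ) (hK : K ≠ 0) (ht : Irrational (t / (2 * Real.pi)))
    (H : ∀ i s : ℤ, 0 < i → 0 < i * ε - s * (2 * Real.pi) → i * ε - s * (2 * Real.pi) ≤ 3 * ε →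
      C * ‖Complex.exp (-Complex.I * (2 * t * (K * i) ^ 2)) - 1‖ ^ 2 ≤ (K * i : ℤ).natAbs * f (K * i)) :
    ¬ Summable f := by
  intro hs
  have hp := Real.pi_gt_three
  set β : ℂ := 2 * t * K ^ 2 with hβ
  set δ := ‖Complex.exp (-Complex.I * (2 * β)) - 1‖ ^ 2 with hδ
  have hδ0 : 0 < δ := by
    apply pow_pos
    rw [norm_pos_iff, sub_ne_zero]
    intro h
    rw [Complex.exp_eq_one_iff] at h
    obtain ⟨n, hn⟩ := h
    have hn2 : (-(2 * (2 * t * K ^ 2)) : ℂ) = n * (2 * Real.pi) := by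
      have := Complex.I_ne_zero
      apply mul_left_cancel₀ this
      rw [← hβ]; linear_combination hn
    have hn3 : (-(2 * (2 * t * K ^ 2)) : ℝ) = n * (2 * Real.pi) := by exact_mod_cast hn2
    apply ht
    refine ⟨(n : ℚ) / (-(4 * K ^ 2)), ?_⟩
    push_cast
    have : (K : ℝ) ≠ 0 := by exact_mod_cast hK
    field_simp
    linarith
  let i : ℕ → ℤ := fun s => ⌊(s : ℝ) * (2 * Real.pi) / ε⌋ + 1
  have hi1 : ∀ s : ℕ, (s : ℝ) * (2 * Real.pi) < i s * ε := by
    intro s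
    have := Int.lt_floor_add_one ((s : ℝ) * (2 * Real.pi) / ε)
    rw [div_lt_iff₀ hε] at this
    simpa [i] using this
  have hi2 : ∀ s : ℕ, i s * ε ≤ (s : ℝ) * (2 * Real.pi) + ε := by
    intro s
    have := Int.floor_le ((s : ℝ) * (2 * Real.pi) / ε)
    rw [le_div_iff₀ hε] at this
    simp only [i]; push_cast; linarith
  have hmono : StrictMono i := by
    apply strictMono_nat_of_lt_succ
    intro s
    have h1 := hi2 s
    have h2 := hi1 (s+1)
    push_cast at h2
    have : (i s : ℝ) * ε < i (s+1) * ε := by nlinarith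
    have := lt_of_mul_lt_mul_right this hε.le
    exact_mod_cast this
  have hipos : ∀ s, 0 < i s := by
    intro s
    have h1 := hi1 s
    have : 0 < (i s : ℝ) * ε := lt_of_le_of_lt (by positivity) h1
    have := pos_of_mul_pos_left this hε.le
    exact_mod_cast this
  have hsj : ∀ j : ℤ, Summable (fun s => f (K * (i s + j))) := by
    intro j
    apply hs.comp_injective (i := fun s => K * (i s + j))
    intro s s' h
    have := mul_left_cancel₀ hK h
    exact hmono.injective (by linarith)
  have hsum := ((hsj 0).add (hsj 1)).add (hsj 2)
  set A : ℝ := |(K : ℝ)| * (2 * Real.pi / ε + 4) with hA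
  have hApos : 0 < A := by
    have : 0 < |(K:ℝ)| := abs_pos.mpr (by exact_mod_cast hK)
    positivity
  have hlow : ∀ s : ℕ, (C * δ / (6 * A)) * (1 / ((s : ℝ) + 1)) ≤
      f (K * (i s + 0)) + f (K * (i s + 1)) + f (K * (i s + 2)) := by
    intro s
    have hk : ∀ j : ℤ, 0 ≤ j → j ≤ 2 → C * ‖Complex.exp (-Complex.I * (β * ((i s : ℂ) + j) ^ 2)) - 1‖ ^ 2
        ≤ A * (s + 1) * f (K * (i s + j)) := by
      intro j h0 h2
      have h0' : (0:ℝ) ≤ j := by exact_mod_cast h0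
      have h2' : (j:ℝ) ≤ 2 := by exact_mod_cast h2
      have a1 := hi1 s
      have a2 := hi2 s
      have h := H (i s + j) s (by linarith [hipos s]) (by push_cast; nlinarith) (by push_cast; nlinarith)
      have e : (2 * t * (K * ((i s + j : ℤ) : ℂ)) ^ 2 : ℂ) = β * ((i s : ℂ) + j) ^ 2 := by
        rw [hβ]; push_cast; ring
      rw [e] at h
      refine h.trans ?_
      apply mul_le_mul_of_nonneg_right _ (hf _)
      rw [Nat.cast_natAbs, Int.cast_abs]
      push_cast
      rw [abs_mul, hA, mul_assoc]
      apply mul_le_mul_of_nonneg_left _ (abs_nonneg _)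
      have ip : (0:ℝ) < i s := by exact_mod_cast hipos s
      rw [abs_of_nonneg (by linarith)]
      have : (i s : ℝ) ≤ s * (2 * Real.pi) / ε + 1 := by
        rw [← sub_le_iff_le_add, le_div_iff₀ hε]; linarith
      have q : 0 < 2 * Real.pi / ε := by positivity
      have : (s:ℝ) * (2 * Real.pi) / ε = s * (2 * Real.pi / ε) := by ring
      have : (0:ℝ) ≤ s := Nat.cast_nonneg s
      nlinarith
    have sd := second_diff β (i s) (by rw [hβ]; norm_cast) (by norm_cast)
    have b0 := hk 0 le_rfl (by norm_num)
    have b1 := hk 1 (by norm_num) (by norm_num)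
    have b2 := hk 2 (by norm_num) (by norm_num)
    simp only [Int.cast_zero, Int.cast_one, Int.cast_ofNat, add_zero] at b0 b1 b2
    rw [add_zero]
    rw [← hδ] at sd
    have s1 : (0:ℝ) < s + 1 := by positivity
    rw [div_mul_div_comm, mul_one, div_le_iff₀ (by positivity)]
    have := mul_le_mul_of_nonneg_left sd hC.le
    nlinarith
  have := Summable.of_nonneg_of_le (fun s => by positivity) hlow hsum
  rw [summable_mul_left_iff (by positivity)] at this
  exact Real.not_summable_one_div_natCast ((summable_nat_add_iff 1).mp (by simpa using this))

lemma ii_of_bdd (f : ℝ → ℂ) (hf : Measurable f) (M : ℝ) (hM : ∀ x, ‖f x‖ ≤ M) (a b : ℝ) :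
    IntervalIntegrable f volume a b := by
  refine IntervalIntegrable.mono_fun' (g := fun _ => M) intervalIntegrable_const
    hf.aestronglyMeasurable (ae_of_all _ fun x => hM x)

lemma norm_exp_I (s : ℝ) : ‖Complex.exp (Complex.I * s)‖ = 1 := by
  rw [mul_comm]
  exact Complex.norm_exp_ofReal_mul_I _

lemma coef_shift (p : ℝ → ℂ) (hp : Function.Periodic p (2 * Real.pi)) (θ : ℝ) (n : ℤ) :
    fourierCoef (fun x => p (x - θ)) n = Complex.exp (-Complex.I * n * θ) * fourierCoef p n := by
  unfold fourierCoef
  have h1 : ∀ x : ℝ, Complex.exp (-Complex.I * (n : ℂ) * (x : ℂ)) * p (x - θ) =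
      (fun y : ℝ => Complex.exp (-Complex.I * n * θ) *
        (Complex.exp (-Complex.I * (n : ℂ) * (y : ℂ)) * p y)) (x - θ) := by
    intro x
    simp only
    rw [← mul_assoc, ← Complex.exp_add]
    congr 2
    push_cast; ring
  simp_rw [h1]
  rw [intervalIntegral.integral_comp_sub_right
    (fun y : ℝ => Complex.exp (-Complex.I * n * θ) *
        (Complex.exp (-Complex.I * (n : ℂ) * (y : ℂ)) * p y)), intervalIntegral.integral_const_mul]
  have hper : Function.Periodic (fun y : ℝ => Complex.exp (-Complex.I * (n : ℂ) * (y : ℂ)) * p y)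
      (2 * Real.pi) := by
    intro y
    simp only
    rw [hp y]
    congr 1
    rw [Complex.exp_eq_exp_iff_exists_int]
    exact ⟨-n, by push_cast; ring⟩
  have := hper.intervalIntegral_add_eq (0 - θ) 0
  rw [show 2 * Real.pi - θ = (0 - θ) + 2 * Real.pi by ring, this, zero_add]
  ring

lemma coef_mod (p : ℝ → ℂ) (k n : ℤ) :
    fourierCoef (fun x => p x * Complex.exp (Complex.I * ((k * x : ℝ) : ℂ))) n
      = fourierCoef p (n - k) := by
  unfold fourierCoef
  congr 1
  apply intervalIntegral.integral_congr
  intro x _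
  simp only
  rw [mul_comm (p x), ← mul_assoc, ← Complex.exp_add]
  congr 2
  push_cast; ring

lemma integral_exp_k (k : ℤ) (hk : k ≠ 0) (u v : ℝ) :
    ∫ x in u..v, Complex.exp (-Complex.I * k * x) =
      (Complex.exp (-Complex.I * k * v) - Complex.exp (-Complex.I * k * u)) / (-Complex.I * k) := by
  rw [integral_exp_mul_complex]
  simp [hk]


lemma floor_on (N : ℕ) (hN : 0 < N) (j : ℤ) (x : ℝ) (h1 : j * (2 * Real.pi / N) ≤ x)
    (h2 : x < (j + 1) * (2 * Real.pi / N)) : ⌊x / (2 * Real.pi / N)⌋ = j := by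
  have : (0:ℝ) < N := by exact_mod_cast hN
  have hp := Real.pi_pos
  have hh : 0 < 2 * Real.pi / N := by positivity
  rw [Int.floor_eq_iff]
  exact ⟨by rwa [le_div_iff₀ hh], by rwa [div_lt_iff₀ hh]⟩

lemma step_integral (N : ℕ) (hN : 0 < N) (G : ℤ → ℂ) (M : ℝ) (hM : ∀ j, ‖G j‖ ≤ M)
    (m : ℤ) (k : ℤ) (hk : k = N * m) (hk0 : k ≠ 0)
    (θ : ℝ) (h0 : 0 < θ) (h1 : θ < 2 * Real.pi / N) :
    ∫ x in (0:ℝ)..(2 * Real.pi), G ⌊(x - θ) / (2 * Real.pi / N)⌋ *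
      (starRingEnd ℂ) (G ⌊x / (2 * Real.pi / N)⌋ * Complex.exp (Complex.I * ((k * x : ℝ) : ℂ))) =
    ((Complex.exp (-Complex.I * k * θ) - 1) / (-Complex.I * k)) *
      ∑ j ∈ range N, (G (j - 1) * (starRingEnd ℂ) (G j) - G j * (starRingEnd ℂ) (G j)) := by
  have hNr : (0:ℝ) < N := by exact_mod_cast hN
  have hNc : (N:ℂ) ≠ 0 := by exact_mod_cast hN.ne'
  have hp := Real.pi_pos
  set h : ℝ := 2 * Real.pi / N with hh
  have hhp : 0 < h := by positivity
  set P : ℝ → ℂ := fun x => G ⌊(x - θ) / h⌋ *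
      (starRingEnd ℂ) (G ⌊x / h⌋ * Complex.exp (Complex.I * ((k * x : ℝ) : ℂ))) with hP
  have hG : Measurable G := measurable_from_top
  have hPm : Measurable P := by
    have m1 : Measurable fun x : ℝ => G ⌊(x - θ) / h⌋ :=
      hG.comp (Int.measurable_floor.comp (by fun_prop))
    have m2 : Measurable fun x : ℝ => G ⌊x / h⌋ :=
      hG.comp (Int.measurable_floor.comp (by fun_prop))
    have m3 : Measurable fun x : ℝ => Complex.exp (Complex.I * ((k * x : ℝ) : ℂ)) := by fun_prop
    exact m1.mul (Complex.continuous_conj.measurable.comp (m2.mul m3))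
  have hM0 : 0 ≤ M := (norm_nonneg _).trans (hM 0)
  have hPb : ∀ x, ‖P x‖ ≤ M * M := by
    intro x
    simp only [hP]
    rw [norm_mul, RCLike.norm_conj, norm_mul, norm_exp_I, mul_one]
    exact mul_le_mul (hM _) (hM _) (norm_nonneg _) hM0
  have hPi : ∀ a b, IntervalIntegrable P volume a b := ii_of_bdd P hPm _ hPb
  have hper : ∀ j : ℤ, Complex.exp (-Complex.I * k * ((j * h : ℝ) : ℂ)) = 1 := by
    intro j
    rw [Complex.exp_eq_one_iff]
    refine ⟨-(m * j), ?_⟩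
    rw [hk, hh]; push_cast; field_simp
  have hconj : ∀ x : ℝ, (starRingEnd ℂ) (Complex.exp (Complex.I * ((k * x : ℝ) : ℂ))) =
      Complex.exp (-Complex.I * k * x) := by
    intro x
    rw [← Complex.exp_conj, map_mul, Complex.conj_I, Complex.conj_ofReal]
    push_cast; congr 1; ring
  have hpiece : ∀ j : ℕ, ∫ x in ((j:ℝ) * h)..(((j + 1 : ℕ) : ℝ) * h), P x =
      ((Complex.exp (-Complex.I * k * θ) - 1) / (-Complex.I * k)) *
      (G (j - 1) * (starRingEnd ℂ) (G j) - G j * (starRingEnd ℂ) (G j)) := by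
    intro j
    rw [← intervalIntegral.integral_add_adjacent_intervals (hPi _ ((j:ℝ) * h + θ)) (hPi _ _)]
    have e1 : ∫ x in ((j:ℝ) * h)..((j:ℝ) * h + θ), P x =
        ∫ x in ((j:ℝ) * h)..((j:ℝ) * h + θ), (G (j - 1) * (starRingEnd ℂ) (G j)) *
          Complex.exp (-Complex.I * k * x) := by
      apply intervalIntegral.integral_congr_Ioo_of_le (by linarith)
      intro x hx
      simp only [hP]
      rw [floor_on N hN (j - 1) (x - θ) (by push_cast; rw [← hh]; linarith [hx.1]) 
        (by push_cast; rw [← hh]; linarith [hx.2]),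
        floor_on N hN j x (by push_cast; rw [← hh]; linarith [hx.1]) 
        (by push_cast; rw [← hh]; linarith [hx.2]), map_mul, hconj]
      ring
    have e2 : ∫ x in ((j:ℝ) * h + θ)..(((j + 1 : ℕ) : ℝ) * h), P x =
        ∫ x in ((j:ℝ) * h + θ)..(((j + 1 : ℕ) : ℝ) * h), (G j * (starRingEnd ℂ) (G j)) *
          Complex.exp (-Complex.I * k * x) := by
      apply intervalIntegral.integral_congr_Ioo_of_le (by push_cast; linarith)
      intro x hx
      have hx1 := hx.1
      have hx2 := hx.2
      push_cast at hx2
      simp only [hP]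
      rw [floor_on N hN j (x - θ) (by push_cast; rw [← hh]; linarith) 
        (by push_cast; rw [← hh]; linarith),
        floor_on N hN j x (by push_cast; rw [← hh]; linarith) 
        (by push_cast; rw [← hh]; linarith), map_mul, hconj]
      ring
    rw [e1, e2, intervalIntegral.integral_const_mul, intervalIntegral.integral_const_mul,
      integral_exp_k k hk0, integral_exp_k k hk0]
    have p1 := hper j
    have p2 := hper (j + 1)
    have p3 : Complex.exp (-Complex.I * k * (((j:ℝ) * h + θ : ℝ) : ℂ)) =
        Complex.exp (-Complex.I * k * θ) := by
      rw [show (-Complex.I * k * (((j:ℝ) * h + θ : ℝ) : ℂ)) =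
        -Complex.I * k * (((j : ℤ) * h : ℝ) : ℂ) + -Complex.I * k * θ by push_cast; ring,
        Complex.exp_add, p1, one_mul]
    rw [p3]
    push_cast at p1 p2 ⊢
    rw [p1, p2]
    ring
  have hsum := intervalIntegral.sum_integral_adjacent_intervals (f := P) (μ := volume)
    (a := fun j : ℕ => (j:ℝ) * h) (n := N) (fun j _ => hPi _ _)
  have hend : (N:ℝ) * h = 2 * Real.pi := by rw [hh]; field_simp
  simp only [Nat.cast_zero, zero_mul] at hsum
  rw [hend] at hsum
  rw [← hsum, mul_sum]
  exact sum_congr rfl fun j _ => hpiece j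

lemma K_ne_zero (N : ℕ) (hN : 0 < N) (G : ℤ → ℂ) (hper : ∀ j, G (j + N) = G j)
    (hnc : ∃ j : ℕ, j < N ∧ G j ≠ G 0) :
    ∑ j ∈ range N, (G (j - 1) * (starRingEnd ℂ) (G j) - G j * (starRingEnd ℂ) (G j)) ≠ 0 := by
  intro h
  have hre := congrArg Complex.re h
  rw [Complex.re_sum, Complex.zero_re] at hre
  have hshift : ∑ j ∈ range N, ‖G (j - 1)‖ ^ 2 = ∑ j ∈ range N, ‖G j‖ ^ 2 := by
    have a1 := sum_range_succ (fun j : ℕ => ‖G ((j : ℤ) - 1)‖ ^ 2) N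
    rw [sum_range_succ'] at a1
    have : G ((N:ℤ) - 1) = G (-1) := by rw [← hper (-1), neg_add_eq_sub]
    simp only [Nat.cast_add, Nat.cast_one, add_sub_cancel_right, Nat.cast_zero, zero_sub, this] at a1
    linarith
  have hid : ∑ j ∈ range N, ‖G j - G (j - 1)‖ ^ 2 = 0 := by
    have : ∀ j : ℕ, ‖G j - G (j - 1)‖ ^ 2 = (‖G (j - 1)‖ ^ 2 - ‖G j‖ ^ 2)
        - 2 * (G (j - 1) * (starRingEnd ℂ) (G j) - G j * (starRingEnd ℂ) (G j)).re := by
      intro j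
      simp only [← Complex.normSq_eq_norm_sq, Complex.normSq_apply, Complex.sub_re, Complex.sub_im,
        Complex.mul_re, Complex.conj_re, Complex.conj_im]
      ring
    simp_rw [this]
    rw [sum_sub_distrib, sum_sub_distrib, hshift, ← mul_sum, hre]
    ring
  rw [sum_eq_zero_iff_of_nonneg (fun _ _ => by positivity)] at hid
  obtain ⟨j, hj, hne⟩ := hnc
  apply hne
  have : ∀ i : ℕ, i < N → G i = G 0 := by
    intro i
    induction i with
    | zero => intro _; rfl
    | succ i ih =>
      intro hi
      have h1 := hid (i + 1) (mem_range.mpr hi)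
      rw [pow_eq_zero_iff (by norm_num), norm_eq_zero, sub_eq_zero] at h1
      rw [h1, ← ih (by omega)]
      congr 1; push_cast; ring
  exact this j hj


lemma coef_formula (N : ℕ) (hN : 0 < N) (G : ℤ → ℂ) (M : ℝ) (hM : ∀ j, ‖G j‖ ≤ M)
    (hper : ∀ j, G (j + N) = G j) (t : ℝ)
    (m : ℤ) (k : ℤ) (hk : k = N * m) (hk0 : k ≠ 0) (l : ℤ)
    (θ : ℝ) (h0 : 0 < θ) (h1 : θ < 2 * Real.pi / N) (hθ : 2 * t * k = θ + 2 * Real.pi * l)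
    (p : ℝ → ℂ) (hp : p = fun x => G ⌊x / (2 * Real.pi / N)⌋) :
    ∑' n : ℤ, (Complex.exp (-Complex.I * (t : ℂ) * (n : ℂ) ^ 2) * fourierCoef p n) *
        (starRingEnd ℂ) (Complex.exp (-Complex.I * (t : ℂ) * ((n - k : ℤ) : ℂ) ^ 2) *
          fourierCoef p (n - k)) =
    Complex.exp (Complex.I * ((t * k ^ 2 : ℝ) : ℂ)) * ((1 / (2 * Real.pi)) *
    (((Complex.exp (-Complex.I * (2 * t * k ^ 2)) - 1) / (-Complex.I * k)) *
      ∑ j ∈ range N, (G (j - 1) * (starRingEnd ℂ) (G j) - G j * (starRingEnd ℂ) (G j)))) := by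
  have hNr : (0:ℝ) < N := by exact_mod_cast hN
  have hpi := Real.pi_pos
  have hG : Measurable G := measurable_from_top
  have hpm : Measurable p := by
    rw [hp]; exact hG.comp (Int.measurable_floor.comp (by fun_prop))
  have hpp : Function.Periodic p (2 * Real.pi) := by
    intro x
    rw [hp]
    simp only
    rw [show (x + 2 * Real.pi) / (2 * Real.pi / N) = x / (2 * Real.pi / N) + N by field_simp,
      Int.floor_add_natCast, hper]
  have hpb : ∀ x, ‖p x‖ ≤ M := by intro x; rw [hp]; exact hM _
  have hexp : Complex.exp (-Complex.I * (2 * t * k ^ 2)) = Complex.exp (-Complex.I * k * θ) := by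
    rw [Complex.exp_eq_exp_iff_exists_int]
    refine ⟨-(k * l), ?_⟩
    have : (2 * t * k : ℂ) = θ + 2 * Real.pi * l := by exact_mod_cast hθ
    push_cast
    linear_combination (-Complex.I * k) * this
  have key := parseval (fun x => p (x - θ))
    (fun x => p x * Complex.exp (Complex.I * ((k * x : ℝ) : ℂ)))
    (MemLp.of_bound (hpm.comp (by fun_prop)).aestronglyMeasurable M (ae_of_all _ fun x => hpb _))
    (MemLp.of_bound (hpm.mul (by fun_prop)).aestronglyMeasurable M (ae_of_all _ fun x => by
      rw [norm_mul, norm_exp_I, mul_one]; exact hpb x))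
  have hI := step_integral N hN G M hM m k hk hk0 θ h0 h1
  simp_rw [coef_shift p hpp, coef_mod] at key
  have hpx : ∀ x : ℝ, G ⌊x / (2 * Real.pi / N)⌋ = p x := by intro x; rw [hp]
  simp_rw [hpx] at hI
  rw [hI, ← hexp] at key
  rw [← (key.mul_left (Complex.exp (Complex.I * ((t * k ^ 2 : ℝ) : ℂ)))).tsum_eq]
  congr 1
  funext n
  rw [map_mul, ← Complex.exp_conj]
  have : Complex.exp (-Complex.I * (t : ℂ) * (n : ℂ) ^ 2) *
      Complex.exp ((starRingEnd ℂ) (-Complex.I * (t : ℂ) * ((n - k : ℤ) : ℂ) ^ 2)) =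
      Complex.exp (Complex.I * ((t * k ^ 2 : ℝ) : ℂ)) * Complex.exp (-Complex.I * n * θ) := by
    rw [← Complex.exp_add, ← Complex.exp_add, Complex.exp_eq_exp_iff_exists_int]
    refine ⟨-(n * l), ?_⟩
    have : (2 * t * k : ℂ) = θ + 2 * Real.pi * l := by exact_mod_cast hθ
    simp only [map_mul, map_neg, Complex.conj_I, Complex.conj_ofReal, map_pow, map_intCast]
    push_cast
    linear_combination (-Complex.I * n) * this
  linear_combination (fourierCoef p n * (starRingEnd ℂ) (fourierCoef p (n - k))) * this

lemma exists_grid (L : ℕ) (a : Fin L → ℝ) (b : Fin L → ℝ)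
    (hrat : ∀ ℓ : Fin L, (∃ r : ℚ, a ℓ = (r : ℝ) * Real.pi) ∧
      ∃ r : ℚ, b ℓ = (r : ℝ) * Real.pi) :
    ∃ N : ℕ, 0 < N ∧ ∀ ℓ, (∃ A : ℤ, a ℓ = A * (2 * Real.pi / N)) ∧
      ∃ B : ℤ, b ℓ = B * (2 * Real.pi / N) := by
  choose ra hra using fun ℓ => (hrat ℓ).1
  choose rb hrb using fun ℓ => (hrat ℓ).2
  set D : ℕ := ∏ ℓ, ((ra ℓ).den * (rb ℓ).den) with hD
  have hD0 : 0 < D := prod_pos fun ℓ _ => Nat.mul_pos (ra ℓ).pos (rb ℓ).pos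
  have aux : ∀ r : ℚ, r.den ∣ D → ∃ A : ℤ, (r : ℝ) * Real.pi = A * (2 * Real.pi / ((2 * D : ℕ) : ℝ)) := by
    rintro r ⟨e, he⟩
    refine ⟨r.num * e, ?_⟩
    have h1 : (r : ℝ) = r.num / r.den := by exact_mod_cast (Rat.num_div_den r).symm
    have h2 : (r.den : ℝ) ≠ 0 := by exact_mod_cast r.den_nz
    have h3 : (e : ℝ) ≠ 0 := by
      rintro h
      have : e = 0 := by exact_mod_cast h
      rw [this] at he; omega
    rw [he, h1]
    push_cast
    field_simp
  refine ⟨2 * D, by omega, fun ℓ => ⟨?_, ?_⟩⟩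
  · rw [hra]
    exact aux _ ((Dvd.intro _ rfl).trans (dvd_prod_of_mem _ (mem_univ ℓ)))
  · rw [hrb]
    exact aux _ ((Dvd.intro_left _ rfl).trans (dvd_prod_of_mem _ (mem_univ ℓ)))

/-- Let `g = Σ_{ℓ} c_ℓ χ_{[a_ℓ,b_ℓ)}` be a nonconstant complex step function on `𝕋` with
`0 ≤ a₁ < b₁ ≤ a₂ < b₂ ≤ ⋯ < b_L ≤ 2π`, all endpoints rational multiples of `π`.  Then for
every `t` with `t/(2π)` irrational, `|e^{it∂ₓₓ}g|²` is not in `H^{1/2}(𝕋)`.  Here the `k`-th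
Fourier coefficient of `|e^{it∂ₓₓ}g|² = u ⋅ conj u` (where `û(n) = e^{-itn²}ĝ(n)`) is the
absolutely convergent series `Σ_n û(n) conj(û(n-k))`. -/
theorem density_not_H_half (t : ℝ) (ht : Irrational (t / (2 * Real.pi)))
    (L : ℕ) (hL : 0 < L) (c : Fin L → ℂ) (a b : Fin L → ℝ) (g : ℝ → ℂ)
    (hab : ∀ ℓ : Fin L, a ℓ < b ℓ)
    (h0 : ∀ ℓ : Fin L, 0 ≤ a ℓ)
    (h2π : ∀ ℓ : Fin L, b ℓ ≤ 2 * Real.pi)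
    (hord : ∀ ℓ : Fin L, ∀ hℓ : (ℓ : ℕ) + 1 < L, b ℓ ≤ a ⟨(ℓ : ℕ) + 1, hℓ⟩)
    (hrat : ∀ ℓ : Fin L, (∃ r : ℚ, a ℓ = (r : ℝ) * Real.pi) ∧
      ∃ r : ℚ, b ℓ = (r : ℝ) * Real.pi)
    (hg : ∀ x : ℝ, g x = ∑ ℓ : Fin L, Set.indicator (Set.Ico (a ℓ) (b ℓ)) (fun _ => c ℓ) x)
    (hnc : ¬ ∃ z : ℂ, ∀ x ∈ Set.Ico (0 : ℝ) (2 * Real.pi), g x = z) :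
    ¬ Summable (fun k : ℤ => (1 + |(k : ℝ)|) ^ (2 * (1 / 2 : ℝ)) *
      ‖∑' n : ℤ, (Complex.exp (-Complex.I * (t : ℂ) * (n : ℂ) ^ 2) * fourierCoef g n) *
        (starRingEnd ℂ) (Complex.exp (-Complex.I * (t : ℂ) * ((n - k : ℤ) : ℂ) ^ 2) *
          fourierCoef g (n - k))‖ ^ 2) := by
  have hpi := Real.pi_pos
  obtain ⟨N, hN, hgrid⟩ := exists_grid L a b hrat
  have hNr : (0:ℝ) < N := by exact_mod_cast hN
  set h : ℝ := 2 * Real.pi / N with hh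
  have hhp : 0 < h := by positivity
  have hend : (N:ℝ) * h = 2 * Real.pi := by rw [hh]; field_simp
  -- g depends only on the floor
  have hfloor : ∀ x : ℝ, g x = g (⌊x / h⌋ * h) := by
    intro x
    rw [hg, hg]
    refine sum_congr rfl fun ℓ _ => ?_
    obtain ⟨⟨A, hA⟩, ⟨B, hB⟩⟩ := hgrid ℓ
    have cmp : ∀ Z : ℤ, (Z * h ≤ x ↔ (Z:ℝ) * h ≤ ⌊x / h⌋ * h) := by
      intro Z
      rw [mul_le_mul_iff_left₀ hhp, Int.cast_le, Int.le_floor, le_div_iff₀ hhp]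
    have hiff : x ∈ Set.Ico (a ℓ) (b ℓ) ↔ (⌊x / h⌋ * h : ℝ) ∈ Set.Ico (a ℓ) (b ℓ) := by
      rw [Set.mem_Ico, Set.mem_Ico, hA, hB, ← not_le, ← not_le, cmp A, cmp B]
    by_cases hx : x ∈ Set.Ico (a ℓ) (b ℓ)
    · rw [Set.indicator_of_mem hx, Set.indicator_of_mem (hiff.mp hx)]
    · rw [Set.indicator_of_notMem hx, Set.indicator_of_notMem (fun hc => hx (hiff.mpr hc))]
  have hgb : ∀ x, ‖g x‖ ≤ ∑ ℓ, ‖c ℓ‖ := by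
    intro x
    rw [hg]
    refine (norm_sum_le _ _).trans (sum_le_sum fun ℓ _ => ?_)
    exact norm_indicator_le_norm_self (fun _ => c ℓ) x
  let G : ℤ → ℂ := fun j => g (((j % N : ℤ) : ℝ) * h)
  have hGper : ∀ j, G (j + N) = G j := by intro j; simp [G]
  have hGb : ∀ j, ‖G j‖ ≤ ∑ ℓ, ‖c ℓ‖ := fun j => hgb _
  let p : ℝ → ℂ := fun x => G ⌊x / h⌋
  have hpg : ∀ x ∈ Set.Ico (0:ℝ) (2 * Real.pi), p x = g x := by
    intro x hx
    have f0 : 0 ≤ ⌊x / h⌋ := Int.floor_nonneg.mpr (div_nonneg hx.1 hhp.le)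
    have f1 : ⌊x / h⌋ < N := by
      rw [Int.floor_lt, div_lt_iff₀ hhp]
      push_cast
      rw [hend]; exact hx.2
    simp only [p, G]
    rw [Int.emod_eq_of_lt f0 f1, ← hfloor]
  have hcoef : ∀ n, fourierCoef g n = fourierCoef p n := by
    intro n
    unfold fourierCoef
    congr 1
    apply intervalIntegral.integral_congr_Ioo_of_le (by positivity)
    intro x hx
    simp only
    rw [hpg x ⟨hx.1.le, hx.2⟩]
  have hGnc : ∃ j : ℕ, j < N ∧ G j ≠ G 0 := by
    by_contra hc
    push Not at hc
    apply hnc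
    refine ⟨G 0, fun x hx => ?_⟩
    rw [← hpg x hx]
    have f0 : 0 ≤ ⌊x / h⌋ := Int.floor_nonneg.mpr (div_nonneg hx.1 hhp.le)
    have f1 : ⌊x / h⌋ < N := by
      rw [Int.floor_lt, div_lt_iff₀ hhp]
      push_cast
      rw [hend]; exact hx.2
    have := hc ⌊x / h⌋.toNat (by omega)
    rwa [Int.toNat_of_nonneg f0] at this
  have hK := K_ne_zero N hN G hGper hGnc
  set S := ∑ j ∈ range N, (G (j - 1) * (starRingEnd ℂ) (G j) - G j * (starRingEnd ℂ) (G j)) with hS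
  simp_rw [hcoef]
  have hirr : Irrational (2 * t * N / (2 * Real.pi)) := by
    rw [show 2 * t * N / (2 * Real.pi) = ((2 * N : ℕ) : ℝ) * (t / (2 * Real.pi)) by push_cast; ring]
    exact ht.natCast_mul (by omega)
  have hN1 : (1:ℝ) ≤ N := by exact_mod_cast hN
  have hh2 : h ≤ 2 * Real.pi := by rw [← hend]; nlinarith
  obtain ⟨r, l, hr0, hr1, hr2⟩ := exists_rot (2 * t * N) (min (h / 4) 1) (by positivity)
    ((min_le_left _ _).trans (by linarith)) hirr
  set ε := r * (2 * t * N) - l * (2 * Real.pi) with hε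
  have hε1 : ε < h / 4 := hr2.trans_le (min_le_left _ _)
  have hε2 : ε ≤ 1 := hr2.le.trans (min_le_right _ _)
  have hNz : (N : ℤ) ≠ 0 := by exact_mod_cast hN.ne'
  refine not_summable_final _ (fun k => by positivity) t ε ((‖S‖ / (2 * Real.pi)) ^ 2)
    (pow_pos (div_pos (norm_pos_iff.mpr hK) (by positivity)) 2) hr1 hε2 (N * r) (mul_ne_zero hNz hr0) ht ?_
  intro i s hi hs1 hs2
  have hk0 : (N : ℤ) * r * i ≠ 0 := mul_ne_zero (mul_ne_zero hNz hr0) hi.ne'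
  rw [coef_formula N hN G _ hGb hGper t (r * i) (N * r * i) (by ring) hk0 (i * l + s)
    (i * ε - s * (2 * Real.pi)) hs1 (by rw [← hh]; linarith) (by rw [hε]; push_cast; ring) p rfl]
  set k : ℤ := N * r * i with hk
  have hkk : (2 * t * (((N * r : ℤ) : ℂ) * i) ^ 2 : ℂ) = 2 * t * k ^ 2 := by
    rw [hk]; push_cast; ring
  rw [hkk]
  have hkr : 0 < |(k:ℝ)| := abs_pos.mpr (by exact_mod_cast hk0)
  rw [norm_mul, norm_exp_I, one_mul, ← hS]
  have n1 : ‖(1 / (2 * Real.pi) : ℂ)‖ = 1 / (2 * Real.pi) := by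
    rw [show (1 / (2 * Real.pi) : ℂ) = ((1 / (2 * Real.pi) : ℝ) : ℂ) by push_cast; rfl,
      Complex.norm_real, Real.norm_of_nonneg (by positivity)]
  have n2 : ‖(-Complex.I * k : ℂ)‖ = |(k:ℝ)| := by
    rw [norm_mul, norm_neg, Complex.norm_I, one_mul, Complex.norm_intCast]
  rw [norm_mul, n1, norm_mul, norm_div, n2, Nat.cast_natAbs, Int.cast_abs]
  rw [show (2 * (1 / 2 : ℝ)) = 1 by norm_num, Real.rpow_one]
  set E := ‖Complex.exp (-Complex.I * (2 * t * k ^ 2)) - 1‖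
  have : |(k:ℝ)| * ((1 + |(k:ℝ)|) * (1 / (2 * Real.pi) * (E / |(k:ℝ)| * ‖S‖)) ^ 2) =
     (‖S‖ / (2 * Real.pi)) ^ 2 * E ^ 2 * ((1 + |(k:ℝ)|) / |(k:ℝ)|) := by
    field_simp
  rw [this]
  apply le_mul_of_one_le_right (by positivity)
  rw [le_div_iff₀ hkr]; linarith
end
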